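/- arXiv:2104.06971 — 3 statements merged into one kernel-verified Lean document; each statement's English description precedes it below -/
import Mathlib

section
/- For every odd integer r ≥ 3 there exists a constant α_r > 0 such that every finite simple graph with m edges that contains no cycle of length r has a cut of size at least m/2 + α_r · m^((r+1)/(r+2)). -/
namespace MaxCutPaper

variable {V : Type*}

/-- The size of the cut induced by a vertex subset `S`: the number of edges of `G`
with one endpoint in `S` and the other outside `S` (counted via ordered pairs with
first coordinate in `S`). -/
noncomputable def cutSize [Fintype V] (G : SimpleGraph V) (S : Finset V) : ℕ :=
  Nat.card {p : V × V // p.1 ∈ S ∧ p.2 ∉ S ∧ G.Adj p.1 p.2}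

/-- The maximum size of a cut of `G`. -/
noncomputable def maxCut [Fintype V] (G : SimpleGraph V) : ℕ :=
  (Finset.univ : Finset V).powerset.sup (cutSize G)

/-- The number of edges of `G`. -/
noncomputable def edgeCount (G : SimpleGraph V) : ℕ := Nat.card G.edgeSet

/-- The surplus of `G`: `mc(G) - e(G)/2`. -/
noncomputable def surplus [Fintype V] (G : SimpleGraph V) : ℝ :=
  (maxCut G : ℝ) - (edgeCount G : ℝ) / 2

/-- The degree of a vertex. -/
noncomputable def degC (G : SimpleGraph V) (v : V) : ℕ := Nat.card (G.neighborSet v)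

/-- The number of copies of `K_r` in `G`, i.e. `r`-element sets of pairwise adjacent
vertices. -/
noncomputable def cliqueCount (G : SimpleGraph V) (r : ℕ) : ℕ :=
  Nat.card {s : Finset V // G.IsNClique r s}

/-- `G` contains no cycle of length `r`. -/
def CycleFree (G : SimpleGraph V) (r : ℕ) : Prop :=
  ∀ ⦃v : V⦄ (w : G.Walk v v), w.IsCycle → w.length ≠ r

/-- `G` is `d`-degenerate (for a real `d ≥ 0`): every (induced) subgraph has a vertex of
degree at most `d`. -/
def Degenerate (G : SimpleGraph V) (d : ℝ) : Prop :=
  ∀ B : Finset V, B.Nonempty → ∃ v ∈ B, (Nat.card {u : V // u ∈ B ∧ G.Adj v u} : ℝ) ≤ d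

/-- The number of edges of `G` with both endpoints in `T`. -/
noncomputable def edgesIn (G : SimpleGraph V) (T : Finset V) : ℝ :=
  (Nat.card {p : V × V // p.1 ∈ T ∧ p.2 ∈ T ∧ G.Adj p.1 p.2} : ℝ) / 2

section LevelColoring

/-- `S` can be properly coloured in `G` with `K` colours. -/
def ColorableOn (G : SimpleGraph V) (S : Set V) (K : ℕ) : Prop :=
  ∃ c : V → Fin K, ∀ u ∈ S, ∀ v ∈ S, G.Adj u v → c u ≠ c v

lemma ColorableOn.of_fintype {G : SimpleGraph V} {S : Set V} {K : ℕ} {ι : Type*} [Fintype ι]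
    (hK : Fintype.card ι ≤ K) (c : V → ι) (hc : ∀ u ∈ S, ∀ v ∈ S, G.Adj u v → c u ≠ c v) :
    ColorableOn G S K :=
  ⟨fun v => Fin.castLE hK (Fintype.equivFin ι (c v)), fun u hu v hv h e =>
    hc u hu v hv h ((Fintype.equivFin ι).injective (Fin.castLE_injective hK e))⟩

lemma ColorableOn.union {G : SimpleGraph V} {S T : Set V} {K L : ℕ}
    (hS : ColorableOn G S K) (hT : ColorableOn G T L) : ColorableOn G (S ∪ T) (K + L) := by
  classical
  obtain ⟨c, hc⟩ := hS
  obtain ⟨d, hd⟩ := hT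
  refine ColorableOn.of_fintype (ι := Fin K ⊕ Fin L) (by simp)
    (fun v => if v ∈ S then Sum.inl (c v) else Sum.inr (d v)) fun u hu v hv h => ?_
  by_cases hu' : u ∈ S <;> by_cases hv' : v ∈ S <;> simp only [hu', hv', if_true, if_false]
  · simpa using hc u hu' v hv' h
  · simp
  · simp
  · simpa using hd u (hu.resolve_left hu') v (hv.resolve_left hv') h

/-- `EndsChain R n y` says that some `R`-chain with `n` steps ends at `y`. -/
def EndsChain (R : V → V → Prop) : ℕ → V → Prop
  | 0, _ => True
  | n + 1, y => ∃ x, R x y ∧ EndsChain R n x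

/-- The easy half of the Gallai–Roy theorem: a relation without long chains has a potential
with few values. -/
lemma exists_lt_of_not_endsChain {R : V → V → Prop} {n : ℕ} (hn : 0 < n)
    (h : ∀ y, ¬ EndsChain R n y) : ∃ c : V → ℕ, (∀ v, c v < n) ∧ ∀ u v, R u v → c u < c v := by
  classical
  refine ⟨fun v => Nat.findGreatest (EndsChain R · v) (n - 1), fun v => ?_, fun u v huv => ?_⟩
  · exact (Nat.findGreatest_le (n - 1)).trans_lt (by omega)
  · set a := Nat.findGreatest (EndsChain R · u) (n - 1)
    have hau : EndsChain R a u :=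
      Nat.findGreatest_spec (P := (EndsChain R · u)) (Nat.zero_le _) trivial
    have hav : EndsChain R (a + 1) v := ⟨u, huv, hau⟩
    have hle : a ≤ n - 1 := Nat.findGreatest_le (n - 1)
    have hne : a + 1 ≠ n := fun e => h v (e ▸ hav)
    have hlt : a + 1 ≤ n - 1 := by omega
    exact Nat.lt_of_succ_le (Nat.le_findGreatest hlt hav)

/-- A chain of a relation that refines adjacency and increases `ρ` is a path. -/
lemma EndsChain.exists_isPath {G : SimpleGraph V} {R : V → V → Prop} {ρ : V → ℕ}
    (hadj : ∀ x y, R x y → G.Adj x y) (hρ : ∀ x y, R x y → ρ x < ρ y)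
    {P : V → V → Prop} (hrefl : ∀ y, P y y) (hP : ∀ x y z, P z x → R x y → P z y) :
    ∀ (n : ℕ) (y : V), EndsChain R n y → ∃ (x : V) (q : G.Walk x y), q.IsPath ∧ q.length = n ∧
      (∀ z ∈ q.support, P z y ∧ ρ z ≤ ρ y) ∧ (0 < n → ρ x < ρ y)
  | 0, y, _ => ⟨y, .nil, by simp, rfl, by simp [hrefl], by simp⟩
  | n + 1, y, ⟨x', hR, h⟩ => by
    obtain ⟨x, q, hq, hl, hs, hx⟩ := EndsChain.exists_isPath hadj hρ hrefl hP n x' h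
    have hlt := hρ _ _ hR
    refine ⟨x, q.concat (hadj _ _ hR), hq.concat (fun hy => ?_) _, by simp [hl], ?_, fun _ => ?_⟩
    · exact absurd (hs y hy).2 (by omega)
    · intro z hz
      rw [SimpleGraph.Walk.support_concat] at hz
      rcases List.mem_append.1 hz with hz | hz
      · exact ⟨hP _ _ _ (hs z hz).1 hR, (hs z hz).2.trans hlt.le⟩
      · obtain rfl : z = y := by simpa using hz
        exact ⟨hrefl _, le_rfl⟩
    · exact lt_of_le_of_lt (hs x q.start_mem_support).2 hlt

variable {G : SimpleGraph V} {L : V → ℕ} {p : V → V} {i : ℕ}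

lemma level_iterate (hp : ∀ v, 1 ≤ L v → L v ≤ i → G.Adj (p v) v ∧ L (p v) + 1 = L v)
    {x : V} (hx : L x = i) : ∀ s ≤ i, L (p^[s] x) + s = i
  | 0, _ => by simpa using hx
  | s + 1, hs => by
    have ih := level_iterate hp hx s (by omega)
    have := (hp (p^[s] x) (by omega) (by omega)).2
    rw [Function.iterate_succ_apply']
    omega

/-- A path in the top level is prolonged at both ends by walking towards the root. -/
lemma exists_isPath_iterate
    (hp : ∀ v, 1 ≤ L v → L v ≤ i → G.Adj (p v) v ∧ L (p v) + 1 = L v)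
    {x y : V} (q : G.Walk x y) (hq : q.IsPath) (hqL : ∀ z ∈ q.support, L z = i) {t : ℕ}
    (ht : t ≤ i) (hne : p^[t] x ≠ p^[t] y) :
    ∃ Q : G.Walk (p^[t] x) (p^[t] y), Q.IsPath ∧ Q.length = q.length + 2 * t ∧
      ∀ z ∈ Q.support, i ≤ L z + t := by
  have hx := hqL x q.start_mem_support
  have hy := hqL y q.end_mem_support
  induction t with
  | zero => exact ⟨q, hq, by simp, fun z hz => by simp [hqL z hz]⟩
  | succ t ih =>
    have hne' : p^[t] x ≠ p^[t] y := fun h => hne (by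
      rw [Function.iterate_succ_apply', Function.iterate_succ_apply', h])
    obtain ⟨Q, hQ, hQl, hQL⟩ := ih (by omega) hne'
    have hxt := level_iterate hp hx t (by omega)
    have hyt := level_iterate hp hy t (by omega)
    have hxa := hp (p^[t] x) (by omega) (by omega)
    have hya := hp (p^[t] y) (by omega) (by omega)
    rw [Function.iterate_succ_apply', Function.iterate_succ_apply'] at hne ⊢
    have hyQ : p (p^[t] y) ∉ Q.support := fun h => by have := hQL _ h; omega
    have hxQ : p (p^[t] x) ∉ Q.support := fun h => by have := hQL _ h; omega
    refine ⟨.cons hxa.1 (Q.concat hya.1.symm), ?_, by simp [hQl]; ring, fun z hz => ?_⟩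
    · rw [SimpleGraph.Walk.cons_isPath_iff, SimpleGraph.Walk.support_concat]
      exact ⟨hQ.concat hyQ _, by simp [hxQ, hne]⟩
    · rw [SimpleGraph.Walk.support_cons, SimpleGraph.Walk.support_concat] at hz
      simp only [List.mem_cons, List.mem_append, List.not_mem_nil, or_false] at hz
      rcases hz with rfl | hz | rfl
      · omega
      · have := hQL z hz; omega
      · omega

/-- A path inside the top level whose ends branch off exactly `t + 1` levels above closes up to a
cycle. -/
lemma exists_isCycle_of_branch
    (hp : ∀ v, 1 ≤ L v → L v ≤ i → G.Adj (p v) v ∧ L (p v) + 1 = L v)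
    {x y : V} (q : G.Walk x y) (hq : q.IsPath) (hqL : ∀ z ∈ q.support, L z = i) {t : ℕ}
    (ht : t < i) (hne : p^[t] x ≠ p^[t] y) (heq : p^[t + 1] x = p^[t + 1] y) :
    ∃ (v : V) (w : G.Walk v v), w.IsCycle ∧ w.length = q.length + 2 * (t + 1) := by
  obtain ⟨Q, hQ, hQl, hQL⟩ := exists_isPath_iterate hp q hq hqL ht.le hne
  have hxt := level_iterate hp (hqL x q.start_mem_support) t ht.le
  have hyt := level_iterate hp (hqL y q.end_mem_support) t ht.le
  have hxa := hp (p^[t] x) (by omega) (by omega)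
  have hya := hp (p^[t] y) (by omega) (by omega)
  rw [Function.iterate_succ_apply', Function.iterate_succ_apply'] at heq
  have hzQ : p (p^[t] x) ∉ Q.support := fun h => by have := hQL _ h; omega
  have hya' : G.Adj (p^[t] y) (p (p^[t] x)) := by
    rw [heq]
    exact hya.1.symm
  refine ⟨_, .cons hxa.1 (Q.concat hya'), ?_, by simp [hQl]; ring⟩
  rw [SimpleGraph.Walk.cons_isCycle_iff, SimpleGraph.Walk.edges_concat]
  refine ⟨hQ.concat hzQ _, fun h => ?_⟩
  rw [List.concat_eq_append, List.mem_append] at h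
  rcases h with h | h
  · exact hzQ (Q.fst_mem_support_of_mem_edges h)
  · simp only [List.mem_singleton, Sym2.eq_iff] at h
    rcases h with ⟨h, -⟩ | ⟨-, h⟩
    · exact hzQ (by rw [h]; exact Q.end_mem_support)
    · exact hne h

/-- In a graph without cycles of length `2 k + 1`, the vertices at level `i ≤ k` of a breadth
first search tree induce a subgraph of bounded chromatic number. -/
lemma colorableOn_level [Finite V] {k : ℕ} (hG : CycleFree G (2 * k + 1)) (hik : i ≤ k)
    (hp : ∀ v, 1 ≤ L v → L v ≤ i → G.Adj (p v) v ∧ L (p v) + 1 = L v)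
    (hroot : ∀ u v, L u = 0 → L v = 0 → u = v) :
    ColorableOn G {v | L v = i} ((2 * k + 1) ^ k) := by
  classical
  obtain ⟨N, ⟨e⟩⟩ := Finite.exists_equiv_fin V
  let ρ : ℕ → V → ℕ := fun t v => (e (p^[t] v) : ℕ)
  have hρ : ∀ t u v, ρ t u = ρ t v → p^[t] u = p^[t] v := fun t u v h =>
    e.injective (Fin.ext h)
  let R : ℕ → V → V → Prop := fun t x y =>
    L x = i ∧ L y = i ∧ G.Adj x y ∧ p^[t + 1] x = p^[t + 1] y ∧ ρ t x < ρ t y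
  have hchain : ∀ t < i, ∃ c : V → ℕ, (∀ v, c v < 2 * k + 1 - 2 * (t + 1)) ∧
      ∀ u v, R t u v → c u < c v := by
    intro t ht
    have hpos : 0 < 2 * k + 1 - 2 * (t + 1) := by omega
    refine exists_lt_of_not_endsChain hpos fun y hy => ?_
    obtain ⟨x, q, hq, hl, hs, hx⟩ := EndsChain.exists_isPath (G := G) (ρ := ρ t)
      (P := fun z y => (z = y ∨ L z = i ∧ L y = i) ∧ p^[t + 1] z = p^[t + 1] y)
      (fun x y h => h.2.2.1) (fun x y h => h.2.2.2.2) (fun y => ⟨.inl rfl, rfl⟩)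
      (fun x y z hz h => ⟨.inr ⟨by rcases hz.1 with rfl | h'; exacts [h.1, h'.1], h.2.1⟩,
        hz.2.trans h.2.2.2.1⟩) _ y hy
    have hxy := hx hpos
    have hxne : x ≠ y := by rintro rfl; exact lt_irrefl _ hxy
    have hyi : L y = i := ((hs x q.start_mem_support).1.1.resolve_left hxne).2
    obtain ⟨v, w, hw, hwl⟩ := exists_isCycle_of_branch hp q hq
      (fun z hz => by rcases (hs z hz).1.1 with rfl | h; exacts [hyi, h.1]) ht
      (fun h => by simp [ρ, h] at hxy) (hs x q.start_mem_support).1.2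
    exact hG w hw (by omega)
  choose! c hc hcR using hchain
  refine ColorableOn.of_fintype (ι := Fin i → Fin (2 * k + 1)) ?_
    (fun v t => ⟨c t v, (hc t t.2 v).trans_le (by omega)⟩) ?_
  · simpa using Nat.pow_le_pow_right (by omega) hik
  · intro u hu v hv huv h
    have hiter : p^[i] u = p^[i] v := hroot _ _
      (by have := level_iterate hp hu i le_rfl; omega)
      (by have := level_iterate hp hv i le_rfl; omega)
    have hex : ∃ s, p^[s] u = p^[s] v := ⟨i, hiter⟩
    have hmin := Nat.find_spec hex
    have hle : Nat.find hex ≤ i := Nat.find_min' hex hiter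
    obtain ⟨t, ht⟩ : ∃ t, Nat.find hex = t + 1 := Nat.exists_eq_succ_of_ne_zero fun h0 => by
      rw [h0] at hmin
      exact huv.ne hmin
    have hne : p^[t] u ≠ p^[t] v := Nat.find_min hex (by omega)
    rw [ht] at hmin
    have hct : c t u = c t v := congrArg Fin.val (congrFun h ⟨t, by omega⟩)
    rcases lt_trichotomy (ρ t u) (ρ t v) with hlt | heq | hlt
    · exact (hcR t (by omega) u v ⟨hu, hv, huv, hmin, hlt⟩).ne hct
    · exact hne (hρ _ _ _ heq)
    · exact (hcR t (by omega) v u ⟨hv, hu, huv.symm, hmin.symm, hlt⟩).ne' hct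

end LevelColoring

section Rounding

open MeasureTheory ProbabilityTheory

variable {E : Type*} [NormedAddCommGroup E] [InnerProductSpace ℝ E] [MeasurableSpace E]

/-- The directions whose orthogonal hyperplane strictly separates `x` from `y`. -/
def sepSet (x y : E) : Set E := {g | inner ℝ g x * inner ℝ g y < 0}

lemma measurableSet_sepSet [BorelSpace E] (x y : E) : MeasurableSet (sepSet x y) :=
  (isOpen_lt (by fun_prop) continuous_const).measurableSet

variable [FiniteDimensional ℝ E]

/-- The probability that a random hyperplane through the origin separates `x` from `y`. -/
noncomputable def sepProb (x y : E) : ℝ := (stdGaussian E).real (sepSet x y)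

lemma sepProb_comm (x y : E) : sepProb x y = sepProb y x := by
  unfold sepProb sepSet
  simp only [mul_comm]

variable [BorelSpace E]

lemma sepProb_map (f : E ≃ₗᵢ[ℝ] E) (x y : E) : sepProb (f x) (f y) = sepProb x y := by
  unfold sepProb
  conv_lhs => rw [← stdGaussian_map f]
  rw [measureReal_def, measureReal_def,
    Measure.map_apply f.continuous.measurable (measurableSet_sepSet _ _)]
  congr 2
  ext g
  simp [sepSet]

lemma ae_inner_ne_zero {x : E} (hx : x ≠ 0) : ∀ᵐ g ∂(stdGaussian E), inner ℝ g x ≠ 0 := by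
  have hL : (stdGaussian E).map (innerSL ℝ x) = gaussianReal 0 (‖x‖₊ ^ 2) := by
    rw [IsGaussian.map_eq_gaussianReal, integral_strongDual_stdGaussian,
      variance_dual_stdGaussian]
    congr 1
    ext
    simp
  have : NullSingletonClass (Measure.map (innerSL ℝ x) (stdGaussian E)) := by
    rw [hL]
    exact nullSingletonClass_gaussianReal (by simpa using hx)
  have h0 : Measure.map (innerSL ℝ x) (stdGaussian E) {0} = 0 := measure_singleton 0
  rw [Measure.map_apply (innerSL ℝ x).continuous.measurable (measurableSet_singleton 0)] at h0
  rw [ae_iff]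
  convert h0 using 2
  ext g
  simp [real_inner_comm]

lemma sepProb_triangle (x z : E) {y : E} (hy : y ≠ 0) :
    sepProb x z ≤ sepProb x y + sepProb y z := by
  refine le_trans ?_ (measureReal_union_le _ _)
  refine ENNReal.toReal_mono (measure_ne_top _ _) (measure_mono_ae ?_)
  filter_upwards [ae_inner_ne_zero hy] with g hg hxz
  change inner ℝ g x * inner ℝ g y < 0 ∨ inner ℝ g y * inner ℝ g z < 0
  change inner ℝ g x * inner ℝ g z < 0 at hxz
  by_contra! h
  have h1 := mul_nonneg h.1 h.2
  have h2 : 0 < inner ℝ g y ^ 2 := by positivity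
  nlinarith

lemma sepProb_neg {x y : E} (hx : x ≠ 0) (hy : y ≠ 0) : sepProb x y + sepProb (-x) y = 1 := by
  have hd : Disjoint (sepSet x y) (sepSet (-x) y) := Set.disjoint_left.2 fun g h1 h2 => by
    simp only [sepSet, Set.mem_ofPred_eq, inner_neg_right] at h1 h2
    linarith
  unfold sepProb
  rw [← measureReal_union hd (measurableSet_sepSet _ _), measureReal_def]
  have : (stdGaussian E) (sepSet x y ∪ sepSet (-x) y) = 1 := by
    refine (mem_ae_iff_prob_eq_one
      ((measurableSet_sepSet _ _).union (measurableSet_sepSet _ _))).1 ?_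
    filter_upwards [ae_inner_ne_zero hx, ae_inner_ne_zero hy] with g hgx hgy
    rcases lt_or_gt_of_ne (mul_ne_zero hgx hgy) with h | h
    · exact .inl h
    · right
      simpa [sepSet, inner_neg_right] using h
  simp [this]

lemma sepProb_of_inner_eq_zero {x y : E} (hx : x ≠ 0) (hy : y ≠ 0) (h : inner ℝ x y = 0) :
    sepProb x y = 1 / 2 := by
  have := sepProb_neg hx hy
  have h2 := sepProb_map (ℝ ∙ y).reflection x y
  have hxr : (ℝ ∙ y).reflection x = -x := by
    rw [Submodule.reflection_singleton_apply, real_inner_comm x y, h]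
    simp
  have hyr : (ℝ ∙ y).reflection y = y :=
    Submodule.reflection_mem_subspace_eq_self (Submodule.mem_span_singleton_self y)
  rw [hxr, hyr] at h2
  linarith

/-- If `x ⟂ z`, then the ray of `c = s z - t x` is separated from `x` whenever `z` is separated
from `x` or from `c`. -/
lemma sepProb_add_le {x z : E} (hx : x ≠ 0) (hz : z ≠ 0) {s t : ℝ} (hs : 0 < s) (ht : 0 ≤ t) :
    sepProb x z + sepProb z (s • z - t • x) ≤ sepProb x (s • z - t • x) := by
  have hd : Disjoint (sepSet x z) (sepSet z (s • z - t • x)) :=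
    Set.disjoint_left.2 fun g h1 h2 => by
      simp only [sepSet, Set.mem_ofPred_eq, inner_sub_right, inner_smul_right] at h1 h2
      nlinarith [mul_nonneg hs.le (sq_nonneg (inner ℝ g z)), mul_nonneg ht (neg_pos.2 h1).le]
  unfold sepProb
  rw [← measureReal_union hd (measurableSet_sepSet _ _)]
  refine ENNReal.toReal_mono (measure_ne_top _ _) (measure_mono_ae ?_)
  filter_upwards [ae_inner_ne_zero hx, ae_inner_ne_zero hz] with g hgx hgz hg
  change inner ℝ g x * inner ℝ g (s • z - t • x) < 0
  rcases hg with hg | hg <;>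
    simp only [sepSet, Set.mem_ofPred_eq, inner_sub_right, inner_smul_right] at hg ⊢
  · nlinarith [mul_nonneg ht (sq_nonneg (inner ℝ g x))]
  · have hz2 : 0 < inner ℝ g z ^ 2 := by positivity
    have hxz : 0 < inner ℝ g x * inner ℝ g z := by
      by_contra! hle
      nlinarith [mul_nonneg ht (neg_nonneg.2 hle)]
    by_contra! hle
    nlinarith [mul_nonneg hle hz2.le, mul_pos hxz (neg_pos.2 hg)]

/-- Two unit vectors at angle `δ ≤ π / 2` are separated with probability at least
`δ / (2 π)`. -/
lemma sepProb_rotate {x z : E} (hx : ‖x‖ = 1) (hz : ‖z‖ = 1) (hxz : inner ℝ x z = 0) {δ : ℝ}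
    (h0 : 0 < δ) (h1 : δ ≤ Real.pi / 2) :
    δ / (2 * Real.pi) ≤ sepProb z (Real.cos δ • z - Real.sin δ • x) := by
  have hx0 : x ≠ 0 := by rintro rfl; simp at hx
  have hz0 : z ≠ 0 := by rintro rfl; simp at hz
  have hxx : inner ℝ x x = (1 : ℝ) := by rw [real_inner_self_eq_norm_sq, hx]; norm_num
  have hzz : inner ℝ z z = (1 : ℝ) := by rw [real_inner_self_eq_norm_sq, hz]; norm_num
  have hzx : inner ℝ z x = (0 : ℝ) := by rw [real_inner_comm, hxz]
  set u : ℕ → E := fun k => Real.cos (k * δ) • z - Real.sin (k * δ) • x with hu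
  have hinner : ∀ k l, inner ℝ (u k) (u l) = Real.cos (k * δ - l * δ) := fun k l => by
    simp only [hu, inner_sub_left, inner_sub_right, inner_smul_left, inner_smul_right, hxx, hzz,
      hxz, hzx, Real.cos_sub, RCLike.conj_to_real]
    ring
  have hnorm : ∀ k, ‖u k‖ = 1 := fun k => by
    have := hinner k k
    rw [real_inner_self_eq_norm_sq, sub_self, Real.cos_zero] at this
    nlinarith [norm_nonneg (u k)]
  have hne : ∀ k, u k ≠ 0 := fun k h => by simpa [h] using hnorm k
  have hrefl : ∀ k, (ℝ ∙ u (k + 1)).reflection (u k) = u (k + 2) := fun k => by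
    rw [Submodule.reflection_singleton_apply, hnorm, hinner]
    have e1 : ((k + 1 : ℕ) : ℝ) * δ - k * δ = δ := by push_cast; ring
    have e2 : ((k + 2 : ℕ) : ℝ) * δ = (k + 1 : ℕ) * δ + δ := by push_cast; ring
    have e3 : (k : ℝ) * δ = (k + 1 : ℕ) * δ - δ := by push_cast; ring
    rw [e1]
    simp only [hu]
    rw [e2, e3, Real.cos_add, Real.sin_add, Real.cos_sub, Real.sin_sub]
    simp only [RCLike.ofReal_real_eq_id, id]
    module
  have hstep : ∀ k, sepProb (u k) (u (k + 1)) = sepProb (u 0) (u 1) := fun k => by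
    induction k with
    | zero => rfl
    | succ k ih =>
      rw [← ih, ← sepProb_map (ℝ ∙ u (k + 1)).reflection (u k), hrefl, sepProb_comm,
        Submodule.reflection_mem_subspace_eq_self (Submodule.mem_span_singleton_self _)]
  have hsum : ∀ k : ℕ, sepProb (u 0) (u (k + 1)) ≤ (k + 1) * sepProb (u 0) (u 1) := fun k => by
    induction k with
    | zero => simp
    | succ k ih =>
      have := sepProb_triangle (u 0) (u (k + 2)) (hne (k + 1))
      rw [hstep (k + 1)] at this
      push_cast
      linarith
  have hpi := Real.pi_pos
  obtain ⟨N, hN⟩ : ∃ N, ⌈Real.pi / (2 * δ)⌉₊ = N + 1 :=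
    Nat.exists_eq_succ_of_ne_zero (Nat.ceil_pos.2 (by positivity)).ne'
  have hN1 : Real.pi / (2 * δ) ≤ N + 1 := by
    have := Nat.le_ceil (Real.pi / (2 * δ))
    rw [hN] at this
    exact_mod_cast this
  have hN2 : (N : ℝ) + 1 < Real.pi / (2 * δ) + 1 := by
    have := Nat.ceil_lt_add_one (a := Real.pi / (2 * δ)) (by positivity)
    rw [hN] at this
    exact_mod_cast this
  have hlo : Real.pi / 2 ≤ (N + 1) * δ := by
    rw [div_le_iff₀ (by positivity)] at hN1
    linarith
  have hhi : (N + 1) * δ < Real.pi / 2 + δ := by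
    have := mul_lt_mul_of_pos_right hN2 h0
    have e : (Real.pi / (2 * δ) + 1) * δ = Real.pi / 2 + δ := by field_simp
    linarith
  have hhalf : 1 / 2 ≤ sepProb (u 0) (u (N + 1)) := by
    have hu0 : u 0 = z := by simp [hu]
    have hc : Real.cos ((N + 1 : ℕ) * δ) ≤ 0 :=
      Real.cos_nonpos_of_pi_div_two_le_of_le (by push_cast; linarith) (by push_cast; linarith)
    have hs : 0 < Real.sin ((N + 1 : ℕ) * δ) :=
      Real.sin_pos_of_pos_of_lt_pi (by positivity) (by push_cast; linarith)
    have h := sepProb_add_le hz0 (neg_ne_zero.2 hx0) hs (neg_nonneg.2 hc)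
    rw [sepProb_of_inner_eq_zero hz0 (neg_ne_zero.2 hx0) (by rw [inner_neg_right, hzx, neg_zero])]
      at h
    have he : Real.sin ((N + 1 : ℕ) * δ) • -x - -Real.cos ((N + 1 : ℕ) * δ) • z = u (N + 1) := by
      simp only [hu]
      module
    rw [hu0, ← he]
    exact le_trans (le_add_of_nonneg_right measureReal_nonneg) h
  have := hsum N
  have hu1 : u 1 = Real.cos δ • z - Real.sin δ • x := by simp [hu]
  have hu0 : u 0 = z := by simp [hu]
  rw [← hu1, ← hu0]
  have hkey : 1 / 2 ≤ (N + 1) * sepProb (u 0) (u 1) := hhalf.trans this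
  have hNpos : (0 : ℝ) < N + 1 := by positivity
  have : 1 / (2 * ((N : ℝ) + 1)) ≤ sepProb (u 0) (u 1) := by
    rw [div_le_iff₀ (by positivity)]
    linarith
  refine le_trans ?_ this
  rw [div_le_div_iff₀ (by positivity) (by positivity)]
  nlinarith

lemma sepProb_neg_self {x : E} (hx : x ≠ 0) : sepProb x (-x) = 1 := by
  have h := sepProb_neg hx hx
  have h0 : sepSet x x = ∅ :=
    Set.eq_empty_of_forall_notMem fun g hg => (mul_self_nonneg (inner ℝ g x)).not_gt hg
  have h1 : sepProb x x = 0 := by simp [sepProb, h0]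
  rw [sepProb_comm]
  linarith

lemma half_sub_inner_le_sepProb {x y : E} (hx : ‖x‖ = 1) (hy : ‖y‖ = 1) (h : inner ℝ x y ≤ 0) :
    1 / 2 - inner ℝ x y / (2 * Real.pi) ≤ sepProb x y := by
  have hx0 : x ≠ 0 := by rintro rfl; simp at hx
  have hy0 : y ≠ 0 := by rintro rfl; simp at hy
  have hpi := Real.pi_gt_three
  obtain ⟨ρ, hρ⟩ : ∃ ρ : ℝ, ρ = -inner ℝ x y := ⟨_, rfl⟩
  have hxx : inner ℝ x x = (1 : ℝ) := by rw [real_inner_self_eq_norm_sq, hx]; norm_num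
  have hyy : inner ℝ y y = (1 : ℝ) := by rw [real_inner_self_eq_norm_sq, hy]; norm_num
  have hxy : inner ℝ x y = -ρ := by rw [hρ, neg_neg]
  have hyx : inner ℝ y x = -ρ := by rw [real_inner_comm, hxy]
  have hρ0 : 0 ≤ ρ := by linarith
  have hw : ‖y + ρ • x‖ ^ 2 = 1 - ρ ^ 2 := by
    rw [← real_inner_self_eq_norm_sq]
    simp only [inner_add_left, inner_add_right, inner_smul_left, inner_smul_right, hxx, hyy, hxy,
      hyx, RCLike.conj_to_real]
    ring
  have hρ1 : ρ ≤ 1 := by nlinarith [sq_nonneg ‖y + ρ • x‖]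
  rw [hxy]
  rcases hρ1.eq_or_lt with rfl | hρ1
  · have hyn : y = -x := by
      have : y + (1 : ℝ) • x = 0 := by
        rw [← norm_eq_zero, ← sq_eq_zero_iff, hw]
        norm_num
      rw [one_smul] at this
      exact eq_neg_of_add_eq_zero_left this
    rw [hyn, sepProb_neg_self hx0, neg_div, sub_neg_eq_add]
    have : 1 / (2 * Real.pi) ≤ 1 / 2 := by
      apply one_div_le_one_div_of_le <;> linarith
    linarith
  rcases hρ0.eq_or_lt with rfl | hρ0
  · rw [sepProb_of_inner_eq_zero hx0 hy0 (by rw [hxy, neg_zero])]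
    simp
  have hδ0 : 0 < Real.arcsin ρ := Real.arcsin_pos.2 hρ0
  have hsin : Real.sin (Real.arcsin ρ) = ρ := Real.sin_arcsin (by linarith) hρ1.le
  have hcos : 0 < Real.cos (Real.arcsin ρ) := by
    rw [Real.cos_arcsin]
    exact Real.sqrt_pos.2 (by nlinarith)
  have hcos2 : Real.cos (Real.arcsin ρ) ^ 2 = 1 - ρ ^ 2 := by
    have := Real.sin_sq_add_cos_sq (Real.arcsin ρ)
    rw [hsin] at this
    linarith
  obtain ⟨s, hs⟩ : ∃ s, s = Real.cos (Real.arcsin ρ) := ⟨_, rfl⟩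
  rw [← hs] at hcos hcos2
  have hns : ‖y + ρ • x‖ = s := by
    rw [← hcos2] at hw
    exact (sq_eq_sq₀ (norm_nonneg _) hcos.le).1 hw
  set z := s⁻¹ • (y + ρ • x) with hzdef
  have hz : ‖z‖ = 1 := by
    rw [hzdef, norm_smul, hns, norm_inv, Real.norm_of_nonneg hcos.le, inv_mul_cancel₀ hcos.ne']
  have hz0 : z ≠ 0 := by intro h0; simp [h0] at hz
  have hxz : inner ℝ x z = 0 := by
    rw [hzdef, inner_smul_right, inner_add_right, inner_smul_right, hxx, hxy]
    ring
  have hy' : y = s • z - ρ • x := by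
    rw [hzdef, smul_inv_smul₀ hcos.ne']
    simp
  have h1 := sepProb_rotate hx hz hxz hδ0 (Real.arcsin_le_pi_div_two ρ)
  have h2 := sepProb_add_le hx0 hz0 hcos hρ0.le
  rw [sepProb_of_inner_eq_zero hx0 hz0 hxz] at h2
  rw [← hs, hsin, ← hy'] at h1
  rw [← hy'] at h2
  have h3 : ρ ≤ Real.arcsin ρ := by
    have := Real.sin_le hδ0.le
    rwa [hsin] at this
  have h4 : ρ / (2 * Real.pi) ≤ Real.arcsin ρ / (2 * Real.pi) := by gcongr
  rw [neg_div]
  linarith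

lemma two_mul_edgeCount [Fintype V] (G : SimpleGraph V) [DecidableRel G.Adj] :
    (2 * edgeCount G : ℝ) = ∑ u, ∑ v, if G.Adj u v then (1 : ℝ) else 0 := by
  have h := G.sum_degrees_eq_twice_card_edges
  have h2 : edgeCount G = G.edgeFinset.card := by
    rw [edgeCount, Nat.card_eq_fintype_card, SimpleGraph.edgeFinset_card]
  rw [h2]
  have h3 : (2 * G.edgeFinset.card : ℝ) = ((∑ v, G.degree v : ℕ) : ℝ) := by rw [h]; push_cast; rfl
  rw [h3]
  push_cast
  refine Finset.sum_congr rfl fun u _ => ?_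
  rw [Finset.sum_boole, ← SimpleGraph.card_neighborFinset_eq_degree,
    SimpleGraph.neighborFinset_eq_filter]

/-- Every labelling of the vertices by nonzero reals has at most `2 mc(G)` ordered pairs of
adjacent vertices whose labels have opposite signs. -/
lemma sum_sign_change_le [Fintype V] (G : SimpleGraph V) [DecidableRel G.Adj] (a : V → ℝ) :
    (∑ u, ∑ v, if G.Adj u v ∧ a u * a v < 0 then (1 : ℝ) else 0) ≤ 2 * maxCut G := by
  classical
  set S : Finset V := Finset.univ.filter fun v => 0 < a v with hS
  have hcut : (∑ u, ∑ v, if u ∈ S ∧ v ∉ S ∧ G.Adj u v then (1 : ℝ) else 0) = cutSize G S := by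
    rw [cutSize, Nat.card_eq_fintype_card, Fintype.card_subtype, ← Fintype.sum_prod_type',
      Finset.sum_boole]
  have hmax : (cutSize G S : ℝ) ≤ maxCut G := by
    exact_mod_cast Finset.le_sup (f := cutSize G) (by simp)
  have hcut' : (∑ u, ∑ v, if v ∈ S ∧ u ∉ S ∧ G.Adj v u then (1 : ℝ) else 0) = cutSize G S := by
    rw [Finset.sum_comm, hcut]
  have key : (∑ u, ∑ v, if G.Adj u v ∧ a u * a v < 0 then (1 : ℝ) else 0) ≤
      (∑ u, ∑ v, if u ∈ S ∧ v ∉ S ∧ G.Adj u v then (1 : ℝ) else 0) +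
      ∑ u, ∑ v, if v ∈ S ∧ u ∉ S ∧ G.Adj v u then (1 : ℝ) else 0 := by
    simp only [← Finset.sum_add_distrib]
    refine Finset.sum_le_sum fun u _ => Finset.sum_le_sum fun v _ => ?_
    by_cases h : G.Adj u v ∧ a u * a v < 0
    · rw [if_pos h]
      rcases mul_neg_iff.1 h.2 with h2 | h2
      · rw [if_pos (by simp [hS, h2.1, h2.2.le, h.1])]
        split_ifs <;> norm_num
      · rw [add_comm, if_pos (by simp [hS, h2.1.le, h2.2, h.1.symm])]
        split_ifs <;> norm_num
    · rw [if_neg h]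
      positivity
  rw [hcut, hcut'] at key
  linarith

/-- Goemans–Williamson rounding of a vector configuration with obtuse angles along edges. -/
lemma maxCut_ge_of_unit_vectors [Fintype V] (G : SimpleGraph V) [DecidableRel G.Adj] (x : V → E)
    (hx : ∀ v, ‖x v‖ = 1) (hadj : ∀ u v, G.Adj u v → inner ℝ (x u) (x v) ≤ 0) :
    (edgeCount G : ℝ) / 2 +
      (∑ u, ∑ v, if G.Adj u v then -inner ℝ (x u) (x v) else 0) / (4 * Real.pi) ≤ maxCut G := by
  have hpi := Real.pi_pos
  have h1 : ∑ u, ∑ v, (if G.Adj u v then sepProb (x u) (x v) else 0) ≤ 2 * maxCut G := by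
    have hmeas : ∀ u v, MeasurableSet {g : E | G.Adj u v ∧ inner ℝ g (x u) * inner ℝ g (x v) < 0} :=
      fun u v => (MeasurableSet.const _).inter (measurableSet_sepSet (x u) (x v))
    have hinteg : ∀ u v, Integrable
        (fun g : E => if G.Adj u v ∧ inner ℝ g (x u) * inner ℝ g (x v) < 0 then (1 : ℝ) else 0)
        (stdGaussian E) := fun u v => by
      refine ((integrable_const (1 : ℝ) (μ := stdGaussian E)).indicator (hmeas u v)).congr
        (.of_forall fun g => ?_)
      simp only [Set.indicator, Set.mem_ofPred_eq]
    have hval : ∀ u v, (if G.Adj u v then sepProb (x u) (x v) else 0) =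
        ∫ g, (if G.Adj u v ∧ inner ℝ g (x u) * inner ℝ g (x v) < 0 then (1 : ℝ) else 0)
          ∂(stdGaussian E) := fun u v => by
      have := integral_indicator_one (μ := stdGaussian E) (hmeas u v)
      simp only [Set.indicator, Set.mem_ofPred_eq, Pi.one_apply] at this
      rw [this]
      split_ifs with h <;> simp [h, sepProb, sepSet]
    simp only [hval]
    simp only [← integral_finsetSum _ fun v _ => hinteg _ v]
    rw [← integral_finsetSum _ fun u _ => integrable_finsetSum _ fun v _ => hinteg u v]
    calc _ ≤ ∫ g : E, (2 * maxCut G : ℝ) ∂(stdGaussian E) :=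
          integral_mono (integrable_finsetSum _ fun u _ => integrable_finsetSum _ fun v _ =>
            hinteg u v) (integrable_const _) fun g => sum_sign_change_le G fun v => inner ℝ g (x v)
      _ = 2 * maxCut G := by simp
  have h2 : ∑ u, ∑ v, (if G.Adj u v then (1 : ℝ) else 0) / 2 +
      ∑ u, ∑ v, (if G.Adj u v then -inner ℝ (x u) (x v) else 0) / (2 * Real.pi) ≤
      ∑ u, ∑ v, (if G.Adj u v then sepProb (x u) (x v) else 0) := by
    simp only [← Finset.sum_add_distrib]
    refine Finset.sum_le_sum fun u _ => Finset.sum_le_sum fun v _ => ?_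
    split_ifs with h
    · have := half_sub_inner_le_sepProb (hx u) (hx v) (hadj u v h)
      rw [neg_div]
      linarith
    · simp
  simp only [← Finset.sum_div] at h2
  rw [← two_mul_edgeCount] at h2
  have h3 : ∀ a : ℝ, a / (4 * Real.pi) = a / (2 * Real.pi) / 2 := fun a => by
    rw [div_div]; ring_nf
  rw [h3]
  linarith

end Rounding

section Duality

lemma nonneg_of_forall_le_add_mul {a b c : ℝ} (h : ∀ l : ℝ, 0 ≤ l → c ≤ a + l * b) : 0 ≤ b := by
  by_contra! hb
  have h1 := h ((|a - c| + 1) / -b) (by have := neg_pos.2 hb; positivity)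
  have h2 : (|a - c| + 1) / -b * b = -(|a - c| + 1) := by
    rw [div_neg, neg_mul, div_mul_cancel₀ _ hb.ne]
  rw [h2] at h1
  linarith [le_abs_self (a - c)]

lemma single_single_apply {V : Type*} [DecidableEq V] (u v a b : V) :
    (Pi.single u (Pi.single v 1) : V → V → ℝ) a b = if a = u ∧ b = v then 1 else 0 := by
  by_cases ha : a = u
  · subst ha
    simp [Pi.single_apply]
  · simp [ha]

variable [Fintype V]

/-- The quadratic form of a square array. -/
def quadForm (M : V → V → ℝ) (z : V → ℝ) : ℝ := ∑ u, ∑ v, M u v * (z u * z v)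

lemma quadForm_add (M N : V → V → ℝ) (z : V → ℝ) :
    quadForm (M + N) z = quadForm M z + quadForm N z := by
  simp [quadForm, add_mul, Finset.sum_add_distrib]

lemma quadForm_smul (a : ℝ) (M : V → V → ℝ) (z : V → ℝ) :
    quadForm (a • M) z = a * quadForm M z := by
  simp [quadForm, mul_assoc, Finset.mul_sum]

lemma quadForm_diagonal [DecidableEq V] (D : V → ℝ) (z : V → ℝ) :
    quadForm (fun u v => if u = v then D u else 0) z = ∑ v, D v * z v ^ 2 := by
  simp [quadForm, sq]

lemma quadForm_swap (M : V → V → ℝ) (z : V → ℝ) :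
    quadForm (fun u v => M v u) z = quadForm M z := by
  unfold quadForm
  rw [Finset.sum_comm]
  simp only [mul_comm]

/-- The arrays whose quadratic form is positive definite. -/
def posDefSet (V : Type*) [Fintype V] : Set (V → V → ℝ) :=
  {M | ∃ ε > 0, ∀ z : V → ℝ, ε * ∑ v, z v ^ 2 ≤ quadForm M z}

lemma convex_posDefSet : Convex ℝ (posDefSet V) := by
  rintro M ⟨ε, hε, hM⟩ N ⟨η, hη, hN⟩ a b ha hb hab
  refine ⟨a * ε + b * η, ?_, fun z => ?_⟩
  · rcases ha.eq_or_lt with rfl | ha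
    · obtain rfl : b = 1 := by linarith
      simpa using hη
    · positivity
  · rw [quadForm_add, quadForm_smul, quadForm_smul]
    nlinarith [mul_le_mul_of_nonneg_left (hM z) ha, mul_le_mul_of_nonneg_left (hN z) hb]

lemma isOpen_posDefSet : IsOpen (posDefSet V) := by
  rw [Metric.isOpen_iff]
  rintro M ⟨ε, hε, hM⟩
  set n : ℝ := ((Fintype.card V : ℕ) : ℝ) with hn
  have hn0 : 0 ≤ n := Nat.cast_nonneg _
  set δ : ℝ := ε / (2 * (n + 1)) with hδ
  have hδ0 : 0 < δ := by positivity
  have hδn : δ * n ≤ ε / 2 := by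
    have : δ * (n + 1) = ε / 2 := by rw [hδ]; field_simp
    nlinarith
  refine ⟨δ, hδ0, fun N hN => ⟨ε / 2, by positivity, fun z => ?_⟩⟩
  have hentry : ∀ u v, |M u v - N u v| ≤ δ := fun u v => by
    rw [← Real.dist_eq, dist_comm]
    exact (dist_le_pi_dist (N u) (M u) v).trans ((dist_le_pi_dist N M u).trans hN.le)
  have h1 : quadForm M z - quadForm N z ≤ δ * (∑ v, |z v|) ^ 2 := by
    rw [sq, Finset.sum_mul_sum, Finset.mul_sum, quadForm, quadForm, ← Finset.sum_sub_distrib]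
    refine Finset.sum_le_sum fun u _ => ?_
    rw [Finset.mul_sum, ← Finset.sum_sub_distrib]
    refine Finset.sum_le_sum fun v _ => ?_
    calc _ = (M u v - N u v) * (z u * z v) := by ring
      _ ≤ |(M u v - N u v) * (z u * z v)| := le_abs_self _
      _ = |M u v - N u v| * (|z u| * |z v|) := by rw [abs_mul, abs_mul]
      _ ≤ δ * (|z u| * |z v|) := by gcongr; exact hentry u v
  have h2 : (∑ v, |z v|) ^ 2 ≤ n * ∑ v, z v ^ 2 := by
    have := sq_sum_le_card_mul_sum_sq (s := Finset.univ) (f := fun v => |z v|)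
    simpa [sq_abs, hn] using this
  have h3 : 0 ≤ ∑ v, z v ^ 2 := Finset.sum_nonneg fun v _ => sq_nonneg _
  nlinarith [hM z, mul_le_mul_of_nonneg_left h2 hδ0.le, mul_le_mul_of_nonneg_right hδn h3]

/-- The arrays `D + B` with `D` a nonnegative diagonal of sum at most `T` and `B` supported on the
edges of `G`, where it is at least `1`. -/
def dualSet [DecidableEq V] (G : SimpleGraph V) (T : ℝ) : Set (V → V → ℝ) :=
  {M | ∃ (D : V → ℝ) (B : V → V → ℝ), (∀ v, 0 ≤ D v) ∧ ∑ v, D v ≤ T ∧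
    (∀ u v, G.Adj u v → 1 ≤ B u v) ∧ (∀ u v, ¬ G.Adj u v → B u v = 0) ∧
    M = (fun u v => if u = v then D u else 0) + B}

lemma convex_dualSet [DecidableEq V] (G : SimpleGraph V) (T : ℝ) : Convex ℝ (dualSet G T) := by
  rintro _ ⟨D, B, hD, hDT, hB, hB0, rfl⟩ _ ⟨D', B', hD', hDT', hB', hB0', rfl⟩ a b ha hb hab
  refine ⟨a • D + b • D', a • B + b • B', fun v => ?_, ?_, fun u v h => ?_, fun u v h => ?_, ?_⟩
  · have := hD v
    have := hD' v
    simp only [Pi.add_apply, Pi.smul_apply, smul_eq_mul]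
    positivity
  · simp only [Pi.add_apply, Pi.smul_apply, smul_eq_mul, Finset.sum_add_distrib, ← Finset.mul_sum]
    have : a * T + b * T = T := by rw [← add_mul, hab, one_mul]
    linarith [mul_le_mul_of_nonneg_left hDT ha, mul_le_mul_of_nonneg_left hDT' hb]
  · simp only [Pi.add_apply, Pi.smul_apply, smul_eq_mul]
    nlinarith [hB u v h, hB' u v h]
  · simp [hB0 u v h, hB0' u v h]
  · ext u v
    simp only [Pi.add_apply, Pi.smul_apply, smul_eq_mul]
    split_ifs <;> ring

/-- Duality for the MaxCut semidefinite program with nonpositivity constraints along edges. -/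
lemma exists_dual_certificate (G : SimpleGraph V) [DecidableRel G.Adj] {T : ℝ} (hT : 0 < T)
    (hprim : ∀ X : V → V → ℝ, (∀ u v, X u v = X v u) → (∀ z, 0 ≤ quadForm X z) →
      (∀ v, X v v ≤ 1) → (∀ u v, G.Adj u v → X u v ≤ 0) →
      ∑ u, ∑ v, (if G.Adj u v then -X u v else 0) < T) :
    ∃ (D : V → ℝ) (B : V → V → ℝ), (∀ v, 0 < D v) ∧ ∑ v, D v ≤ T ∧ (∀ u v, B u v = B v u) ∧
      (∀ u v, G.Adj u v → 1 ≤ B u v) ∧ (∀ u v, ¬ G.Adj u v → B u v = 0) ∧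
      ∀ z, 0 ≤ ∑ v, D v * z v ^ 2 + quadForm B z := by
  classical
  by_cases hdisj : Disjoint (posDefSet V) (dualSet G T)
  swap
  · obtain ⟨_, ⟨ε, hε, hM⟩, D, B, hD, hDT, hB, hB0, rfl⟩ := Set.not_disjoint_iff.1 hdisj
    simp only [quadForm_add, quadForm_diagonal] at hM
    refine ⟨D, (1 / 2 : ℝ) • (B + fun u v => B v u), fun v => ?_, hDT, fun u v => ?_,
      fun u v h => ?_, fun u v h => ?_, fun z => ?_⟩
    · have := hM (Pi.single v 1)
      simp [quadForm, Pi.single_apply, hB0 v v] at this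
      linarith
    · simp [add_comm]
    · have := hB u v h
      have := hB v u h.symm
      simp only [Pi.smul_apply, Pi.add_apply, smul_eq_mul]
      linarith
    · simp [hB0 u v h, hB0 v u fun h' => h h'.symm]
    · rw [quadForm_smul, quadForm_add, quadForm_swap B z]
      have := hM z
      have : 0 ≤ ε * ∑ v, z v ^ 2 := by positivity
      linarith
  exfalso
  obtain ⟨f, c, hfs, hft⟩ :=
    geometric_hahn_banach_open convex_posDefSet isOpen_posDefSet (convex_dualSet G T) hdisj
  set φ : V → V → ℝ := fun u v => f (Pi.single u (Pi.single v 1)) with hφ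
  have hf : ∀ M, f M = ∑ u, ∑ v, M u v * φ u v := fun M => by
    have hM : M = ∑ u, ∑ v, M u v • (Pi.single u (Pi.single v 1) : V → V → ℝ) := by
      ext a b
      simp [Finset.sum_apply, single_single_apply, ite_and]
    conv_lhs => rw [hM]
    simp [hφ]
  set A : V → V → ℝ := fun u v => if G.Adj u v then 1 else 0 with hA
  set I : V → V → ℝ := fun u v => if u = v then 1 else 0 with hI
  set X : V → V → ℝ := fun u v => -(φ u v + φ v u) / 2 with hX
  have hquad : ∀ z : V → ℝ, f (fun u v => z u * z v) = -quadForm X z := fun z => by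
    have h1 : ∑ u, ∑ v, φ v u * (z u * z v) = ∑ u, ∑ v, φ u v * (z u * z v) :=
      quadForm_swap φ z
    have h2 : quadForm X z = -(∑ u, ∑ v, φ u v * (z u * z v) +
        ∑ u, ∑ v, φ v u * (z u * z v)) / 2 := by
      simp only [quadForm, hX, ← Finset.sum_add_distrib, neg_div, Finset.sum_div,
        ← Finset.sum_neg_distrib]
      refine Finset.sum_congr rfl fun u _ => Finset.sum_congr rfl fun v _ => by ring
    rw [h2, h1, hf]
    simp only [mul_comm (z _ * z _)]
    ring
  have hps : ∀ (z : V → ℝ) (l ε : ℝ), 0 ≤ l → 0 < ε →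
      l * f (fun u v => z u * z v) + ε * f I < c := fun z l ε hl hε => by
    have : l • (fun u v => z u * z v) + ε • I ∈ posDefSet V := by
      refine ⟨ε, hε, fun y => ?_⟩
      rw [quadForm_add, quadForm_smul, quadForm_smul, hI, quadForm_diagonal]
      have : 0 ≤ quadForm (fun u v => z u * z v) y := by
        have : quadForm (fun u v => z u * z v) y = (∑ v, z v * y v) ^ 2 := by
          rw [sq, Finset.sum_mul_sum, quadForm]
          refine Finset.sum_congr rfl fun u _ => Finset.sum_congr rfl fun v _ => by ring
        rw [this]
        positivity
      simp only [one_mul]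
      have := mul_nonneg hl this
      linarith
    simpa using hfs _ this
  have hXpsd : ∀ z, 0 ≤ quadForm X z := fun z => by
    refine nonneg_of_forall_le_add_mul (a := - f I) (c := - c) fun l hl => ?_
    have := hps z l 1 hl one_pos
    rw [hquad] at this
    linarith
  have hc : 0 ≤ c := by
    by_contra! hc
    have h0 : ∀ ε > 0, ε * f I < c := fun ε hε => by simpa using hps 0 0 ε le_rfl hε
    have h1 := h0 1 one_pos
    have h2 := h0 (c / f I) (div_pos_of_neg_of_neg hc (by linarith))
    rw [div_mul_cancel₀ _ (by linarith)] at h2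
    exact lt_irrefl _ h2
  have hfA : f A = ∑ u, ∑ v, (if G.Adj u v then -X u v else 0) := by
    have h1 : ∑ u, ∑ v, A v u * φ v u = ∑ u, ∑ v, A u v * φ u v := Finset.sum_comm
    have h2 : ∑ u, ∑ v, (if G.Adj u v then -X u v else 0) =
        (∑ u, ∑ v, A u v * φ u v + ∑ u, ∑ v, A v u * φ v u) / 2 := by
      simp only [← Finset.sum_add_distrib, Finset.sum_div]
      refine Finset.sum_congr rfl fun u _ => Finset.sum_congr rfl fun v _ => ?_
      simp only [hA, hX, G.adj_comm v u]
      split_ifs <;> ring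
    rw [h2, h1, hf]
    ring
  have hfD : ∀ D : V → ℝ, f (fun u v => if u = v then D u else 0) = -∑ v, D v * X v v := fun D => by
    rw [hf, ← Finset.sum_neg_distrib]
    refine Finset.sum_congr rfl fun u _ => ?_
    simp [hX]
  have hdiag : ∀ v, c + T * X v v ≤ f A := fun v => by
    have := hft _ ⟨Pi.single v T, A, fun w => ?_, ?_, fun u w h => ?_, fun u w h => ?_, rfl⟩
    · rw [map_add, hfD] at this
      rw [Finset.sum_eq_single v (fun w _ hw => by simp [hw]) (by simp)] at this
      simp at this
      linarith
    · by_cases h : w = v <;> simp [h, hT.le]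
    · simp
    · simp [hA, h]
    · simp [hA, h]
  have hadj : ∀ u v, G.Adj u v → 0 ≤ φ u v := fun u v h => by
    refine nonneg_of_forall_le_add_mul (a := f A) (c := c) fun l hl => ?_
    have := hft _ ⟨0, A + l • (Pi.single u (Pi.single v 1) : V → V → ℝ), fun w => le_rfl, by simpa using hT.le,
      fun a b hab => ?_, fun a b hab => ?_, rfl⟩
    · rw [map_add, hfD, map_add, map_smul] at this
      simpa [hφ] using this
    · have : 0 ≤ (Pi.single u (Pi.single v 1) : V → V → ℝ) a b := by
        rw [single_single_apply]
        split_ifs <;> norm_num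
      simp only [Pi.add_apply, Pi.smul_apply, smul_eq_mul, hA, if_pos hab]
      have := mul_nonneg hl this
      linarith
    · have : (Pi.single u (Pi.single v 1) : V → V → ℝ) a b = 0 := by
        rw [single_single_apply, if_neg]
        rintro ⟨rfl, rfl⟩
        exact hab h
      simp [hA, if_neg hab, this]
  have hXadj : ∀ u v, G.Adj u v → X u v ≤ 0 := fun u v h => by
    have := hadj u v h
    have := hadj v u h.symm
    simp only [hX]
    linarith
  have hXdiag : ∀ v, 0 ≤ X v v := fun v => by
    have := hXpsd (Pi.single v 1)
    simpa [quadForm, Pi.single_apply] using this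
  rcases le_or_gt (f A) 0 with hP | hP
  · have hcA : c ≤ f A := by
      have := hft _ ⟨0, A, fun w => le_rfl, by simpa using hT.le, fun u w h => by simp [hA, h],
        fun u w h => by simp [hA, h], rfl⟩
      rw [map_add, hfD] at this
      simpa using this
    have hX0 : ∀ v, X v v = 0 := fun v => by
      have := hdiag v
      nlinarith [hXdiag v]
    have h1 := hps 0 0 1 le_rfl one_pos
    have h2 : f I = 0 := by rw [hI, hfD]; simp [hX0]
    rw [h2] at h1
    linarith
  · have h := hprim ((T / f A) • X) (fun u v => by simp [hX, add_comm])
      (fun z => by rw [quadForm_smul]; have := hXpsd z; positivity)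
      (fun v => by
        have := hdiag v
        simp only [Pi.smul_apply, smul_eq_mul]
        rw [div_mul_eq_mul_div, div_le_one hP]
        linarith)
      (fun u v h => by
        have h1 := hXadj u v h
        have h2 : 0 ≤ T / f A := by positivity
        simp only [Pi.smul_apply, smul_eq_mul]
        exact mul_nonpos_of_nonneg_of_nonpos h2 h1)
    have h2 : ∑ u, ∑ v, (if G.Adj u v then -((T / f A) • X) u v else 0) = T / f A * f A := by
      rw [hfA, Finset.mul_sum]
      refine Finset.sum_congr rfl fun u _ => ?_
      rw [Finset.mul_sum]
      refine Finset.sum_congr rfl fun v _ => ?_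
      split_ifs <;> simp
    rw [h2, div_mul_cancel₀ _ hP.ne'] at h
    exact lt_irrefl _ h

end Duality

section Primal

variable [Fintype V]

/-- A feasible point of the MaxCut semidefinite program gives a large cut. -/
lemma maxCut_ge_of_psd (G : SimpleGraph V) [DecidableRel G.Adj] {X : V → V → ℝ}
    (hsymm : ∀ u v, X u v = X v u) (hpsd : ∀ z, 0 ≤ quadForm X z) (hdiag : ∀ v, X v v ≤ 1)
    (hadj : ∀ u v, G.Adj u v → X u v ≤ 0) :
    (edgeCount G : ℝ) / 2 + (∑ u, ∑ v, if G.Adj u v then -X u v else 0) / (4 * Real.pi) ≤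
      maxCut G := by
  classical
  set Y : Matrix V V ℝ := X + fun u v => if u = v then 1 - X u u else 0 with hY
  have hYpsd : Y.PosSemidef := by
    refine .of_dotProduct_mulVec_nonneg ?_ fun z => ?_
    · ext u v
      change Y v u = Y u v
      by_cases h : u = v
      · rw [h]
      · simp [hY, h, Ne.symm h, hsymm v u]
    · have h1 : star z ⬝ᵥ Y.mulVec z = quadForm Y z := by
        simp only [dotProduct, Matrix.mulVec, quadForm, Finset.mul_sum, star_trivial]
        refine Finset.sum_congr rfl fun u _ => Finset.sum_congr rfl fun v _ => by ring
      have h2 : 0 ≤ ∑ v, (1 - X v v) * z v ^ 2 :=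
        Finset.sum_nonneg fun v _ => mul_nonneg (sub_nonneg.2 (hdiag v)) (sq_nonneg _)
      rw [h1, hY, quadForm_add, quadForm_diagonal]
      linarith [hpsd z]
  obtain ⟨n, w, hw⟩ := Matrix.posSemidef_iff_eq_sum_vecMulVec.mp hYpsd
  have hinner : ∀ u v, inner ℝ (WithLp.toLp 2 (fun i => w i u) : EuclideanSpace ℝ (Fin n))
      (WithLp.toLp 2 fun i => w i v) = Y u v := fun u v => by
    rw [hw, Matrix.sum_apply]
    simp [PiLp.inner_apply, Matrix.vecMulVec_apply, mul_comm]
  have hoff : ∀ u v, G.Adj u v → Y u v = X u v := fun u v h => by simp [hY, h.ne]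
  have hmain := maxCut_ge_of_unit_vectors G
    (fun v => (WithLp.toLp 2 (fun i => w i v) : EuclideanSpace ℝ (Fin n)))
    (fun v => by
      have h := real_inner_self_eq_norm_sq
        (WithLp.toLp 2 (fun i => w i v) : EuclideanSpace ℝ (Fin n))
      rw [hinner] at h
      have h1 : Y v v = 1 := by simp [hY]
      rw [h1] at h
      exact (pow_eq_one_iff_of_nonneg (norm_nonneg _) two_ne_zero).1 h.symm)
    (fun u v h => by rw [hinner, hoff u v h]; exact hadj u v h)
  refine le_of_eq_of_le ?_ hmain
  congr 2
  refine Finset.sum_congr rfl fun u _ => Finset.sum_congr rfl fun v _ => ?_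
  split_ifs with h
  · rw [hinner, hoff u v h]
  · rfl

/-- A graph with small surplus has a dual certificate of small trace. -/
lemma exists_dual_certificate_of_maxCut_lt (G : SimpleGraph V) {T : ℝ} (hT : 0 < T)
    (hcut : (maxCut G : ℝ) < edgeCount G / 2 + T / (4 * Real.pi)) :
    ∃ (D : V → ℝ) (B : V → V → ℝ), (∀ v, 0 < D v) ∧ ∑ v, D v ≤ T ∧ (∀ u v, B u v = B v u) ∧
      (∀ u v, G.Adj u v → 1 ≤ B u v) ∧ (∀ u v, ¬ G.Adj u v → B u v = 0) ∧
      ∀ z, 0 ≤ ∑ v, D v * z v ^ 2 + quadForm B z := by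
  classical
  refine exists_dual_certificate G hT fun X h1 h2 h3 h4 => ?_
  have h5 := maxCut_ge_of_psd G h1 h2 h3 h4
  have h6 := lt_of_add_lt_add_left (h5.trans_lt hcut)
  exact (div_lt_div_iff_of_pos_right (by positivity)).1 h6

end Primal

section Certificate

variable [Fintype V]

/-- The bilinear form of a square array. -/
def bilin (M : V → V → ℝ) (y z : V → ℝ) : ℝ := ∑ u, ∑ v, M u v * (y u * z v)

/-- The inner product with weights `D`. -/
def wInner (D y z : V → ℝ) : ℝ := ∑ v, D v * (y v * z v)

lemma bilin_add_left (M : V → V → ℝ) (x y z : V → ℝ) :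
    bilin M (x + y) z = bilin M x z + bilin M y z := by
  simp only [bilin, ← Finset.sum_add_distrib, Pi.add_apply]
  exact Finset.sum_congr rfl fun u _ => Finset.sum_congr rfl fun v _ => by ring

lemma bilin_add_right (M : V → V → ℝ) (x y z : V → ℝ) :
    bilin M x (y + z) = bilin M x y + bilin M x z := by
  simp only [bilin, ← Finset.sum_add_distrib, Pi.add_apply]
  exact Finset.sum_congr rfl fun u _ => Finset.sum_congr rfl fun v _ => by ring

lemma bilin_smul_left (M : V → V → ℝ) (a : ℝ) (x y : V → ℝ) :
    bilin M (a • x) y = a * bilin M x y := by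
  simp only [bilin, Finset.mul_sum, Pi.smul_apply, smul_eq_mul]
  exact Finset.sum_congr rfl fun u _ => Finset.sum_congr rfl fun v _ => by ring

lemma bilin_smul_right (M : V → V → ℝ) (a : ℝ) (x y : V → ℝ) :
    bilin M x (a • y) = a * bilin M x y := by
  simp only [bilin, Finset.mul_sum, Pi.smul_apply, smul_eq_mul]
  exact Finset.sum_congr rfl fun u _ => Finset.sum_congr rfl fun v _ => by ring

lemma bilin_comm {M : V → V → ℝ} (hM : ∀ u v, M u v = M v u) (y z : V → ℝ) :
    bilin M y z = bilin M z y := by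
  unfold bilin
  rw [Finset.sum_comm]
  exact Finset.sum_congr rfl fun u _ => Finset.sum_congr rfl fun v _ => by rw [hM u v]; ring

lemma bilin_nonneg {M : V → V → ℝ} (hM : ∀ u v, 0 ≤ M u v) {y z : V → ℝ} (hy : ∀ v, 0 ≤ y v)
    (hz : ∀ v, 0 ≤ z v) : 0 ≤ bilin M y z :=
  Finset.sum_nonneg fun u _ => Finset.sum_nonneg fun v _ =>
    mul_nonneg (hM u v) (mul_nonneg (hy u) (hz v))

lemma wInner_add_left (D x y z : V → ℝ) : wInner D (x + y) z = wInner D x z + wInner D y z := by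
  simp only [wInner, ← Finset.sum_add_distrib, Pi.add_apply]
  exact Finset.sum_congr rfl fun v _ => by ring

lemma wInner_smul_left (D : V → ℝ) (a : ℝ) (x y : V → ℝ) :
    wInner D (a • x) y = a * wInner D x y := by
  simp only [wInner, Finset.mul_sum, Pi.smul_apply, smul_eq_mul]
  exact Finset.sum_congr rfl fun v _ => by ring

lemma wInner_comm (D y z : V → ℝ) : wInner D y z = wInner D z y :=
  Finset.sum_congr rfl fun v _ => by ring

lemma wInner_self_nonneg {D : V → ℝ} (hD : ∀ v, 0 < D v) (z : V → ℝ) : 0 ≤ wInner D z z :=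
  Finset.sum_nonneg fun v _ => mul_nonneg (hD v).le (mul_self_nonneg _)

lemma wInner_self_eq_zero {D : V → ℝ} (hD : ∀ v, 0 < D v) {z : V → ℝ} (hz : wInner D z z = 0) :
    z = 0 := by
  ext v
  have h := (Finset.sum_eq_zero_iff_of_nonneg
    fun v _ => mul_nonneg (hD v).le (mul_self_nonneg (z v))).1 hz v (Finset.mem_univ v)
  simpa [(hD v).ne'] using h

lemma le_wInner_self {D : V → ℝ} (hD : ∀ v, 0 < D v) (z : V → ℝ) (v : V) :
    D v * (z v * z v) ≤ wInner D z z :=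
  Finset.single_le_sum (f := fun v => D v * (z v * z v))
    (fun v _ => mul_nonneg (hD v).le (mul_self_nonneg _)) (Finset.mem_univ v)

/-- `B` is a symmetric nonnegative array supported on edges of `G`, such that `D + B` is positive
semidefinite. -/
structure IsCertificate (G : SimpleGraph V) (D : V → ℝ) (B : V → V → ℝ) : Prop where
  pos : ∀ v, 0 < D v
  symm : ∀ u v, B u v = B v u
  nonneg : ∀ u v, 0 ≤ B u v
  adj : ∀ u v, B u v ≠ 0 → G.Adj u v
  psd : ∀ z, 0 ≤ wInner D z z + bilin B z z

namespace IsCertificate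

variable {G : SimpleGraph V} {D : V → ℝ} {B : V → V → ℝ}

lemma restrict (h : IsCertificate G D B) (H : Finset V) [DecidableEq V] :
    IsCertificate G D fun u v => if u ∈ H ∧ v ∈ H then B u v else 0 where
  pos := h.pos
  symm u v := by simp only [and_comm, h.symm u v]
  nonneg u v := by
    split_ifs
    exacts [h.nonneg u v, le_rfl]
  adj u v huv := h.adj u v fun h0 => huv (by simp [h0])
  psd z := by
    set y : V → ℝ := fun v => if v ∈ H then z v else 0 with hy
    have h1 : wInner D y y ≤ wInner D z z := by
      refine Finset.sum_le_sum fun v _ => mul_le_mul_of_nonneg_left ?_ (h.pos v).le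
      simp only [hy]
      split_ifs
      exacts [le_rfl, by simpa using mul_self_nonneg (z v)]
    have h2 : bilin (fun u v => if u ∈ H ∧ v ∈ H then B u v else 0) z z = bilin B y y := by
      refine Finset.sum_congr rfl fun u _ => Finset.sum_congr rfl fun v _ => ?_
      by_cases hu : u ∈ H <;> by_cases hv : v ∈ H <;> simp [hy, hu, hv]
    rw [h2]
    linarith [h.psd y]

/-- A Hoffman-type bound: the form of `B` is small on vectors supported on sets of small chromatic
number. -/
lemma bilin_self_le (h : IsCertificate G D B) {S : Set V} {K : ℕ} (hS : ColorableOn G S K)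
    {z : V → ℝ} (hz : ∀ v, z v ≠ 0 → v ∈ S) : bilin B z z ≤ K * wInner D z z := by
  obtain ⟨c, hc⟩ := hS
  rcases Nat.eq_zero_or_pos K with rfl | hK
  · have : IsEmpty V := ⟨fun v => (c v).elim0⟩
    simp [bilin, wInner]
  have hK' : (0 : ℝ) < K := by exact_mod_cast hK
  set s : Fin K → V → ℝ := fun i v => 1 - K * (if c v = i then 1 else 0) with hs
  have hsum : ∀ u v, ∑ i, s i u * s i v = K ^ 2 * (if c u = c v then 1 else 0) - K := fun u v => by
    have : ∀ i, s i u * s i v = 1 - K * (if c u = i then 1 else 0) - K * (if c v = i then 1 else 0)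
        + K ^ 2 * (if c u = i then (if c v = i then 1 else 0) else 0) := fun i => by
      simp only [hs]
      split_ifs <;> ring
    simp only [this, Finset.sum_add_distrib, Finset.sum_sub_distrib, ← Finset.mul_sum]
    simp [eq_comm]
    ring
  have hB : ∑ i, bilin B (fun v => s i v * z v) (fun v => s i v * z v) = -K * bilin B z z := by
    simp only [bilin]
    rw [Finset.sum_comm, Finset.mul_sum]
    refine Finset.sum_congr rfl fun u _ => ?_
    rw [Finset.sum_comm, Finset.mul_sum]
    refine Finset.sum_congr rfl fun v _ => ?_
    calc _ = B u v * (z u * z v) * ∑ i, s i u * s i v := by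
          rw [Finset.mul_sum]
          exact Finset.sum_congr rfl fun i _ => by ring
      _ = -K * (B u v * (z u * z v)) +
          K ^ 2 * (B u v * (z u * z v) * (if c u = c v then 1 else 0)) := by
          rw [hsum]; ring
      _ = _ := by
          have : B u v * (z u * z v) * (if c u = c v then 1 else 0) = 0 := by
            by_contra hne
            have h1 : c u = c v := by
              by_contra h1
              simp [h1] at hne
            simp only [h1, if_true, mul_one, mul_ne_zero_iff] at hne
            exact hc u (hz u hne.2.1) v (hz v hne.2.2) (h.adj u v hne.1) h1
          rw [this]; ring
  have hD : ∑ i, wInner D (fun v => s i v * z v) (fun v => s i v * z v) =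
      (K ^ 2 - K) * wInner D z z := by
    simp only [wInner]
    rw [Finset.sum_comm, Finset.mul_sum]
    refine Finset.sum_congr rfl fun v _ => ?_
    calc _ = D v * (z v * z v) * ∑ i, s i v * s i v := by
          rw [Finset.mul_sum]
          exact Finset.sum_congr rfl fun i _ => by ring
      _ = _ := by rw [hsum]; simp; ring
  have h0 : 0 ≤ ∑ i, (wInner D (fun v => s i v * z v) (fun v => s i v * z v) +
      bilin B (fun v => s i v * z v) (fun v => s i v * z v)) :=
    Finset.sum_nonneg fun i _ => h.psd _
  rw [Finset.sum_add_distrib, hB, hD] at h0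
  refine le_of_mul_le_mul_left ?_ hK'
  nlinarith [mul_nonneg hK'.le (wInner_self_nonneg h.pos z)]

lemma bilin_le (h : IsCertificate G D B) {S S' : Set V} {K : ℕ} (hS : ColorableOn G S K)
    (hS' : ColorableOn G S' K) {y z : V → ℝ} (hy0 : ∀ v, 0 ≤ y v) (hz0 : ∀ v, 0 ≤ z v)
    (hy : ∀ v, y v ≠ 0 → v ∈ S) (hz : ∀ v, z v ≠ 0 → v ∈ S') :
    bilin B y z ≤ 4 * K * (√(wInner D y y) * √(wInner D z z)) := by
  set a := √(wInner D y y) with ha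
  set b := √(wInner D z z) with hb
  have ha2 : a ^ 2 = wInner D y y := Real.sq_sqrt (wInner_self_nonneg h.pos y)
  have hb2 : b ^ 2 = wInner D z z := Real.sq_sqrt (wInner_self_nonneg h.pos z)
  rcases (Real.sqrt_nonneg _ : 0 ≤ a).eq_or_lt with ha0 | ha0
  · have : y = 0 := wInner_self_eq_zero h.pos (by rw [← ha2, ha, ← ha0]; norm_num)
    rw [ha, ← ha0, this]
    simp [bilin]
  rcases (Real.sqrt_nonneg _ : 0 ≤ b).eq_or_lt with hb0 | hb0
  · have : z = 0 := wInner_self_eq_zero h.pos (by rw [← hb2, hb, ← hb0]; norm_num)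
    rw [hb, ← hb0, this]
    simp [bilin]
  have h1 := h.bilin_self_le (hS.union hS') (z := b • y + a • z) fun v hv => by
    by_contra hn
    simp only [Set.mem_union, not_or] at hn
    have h1 : y v = 0 := by_contra fun h' => hn.1 (hy v h')
    have h2 : z v = 0 := by_contra fun h' => hn.2 (hz v h')
    simp [h1, h2] at hv
  have h2 : bilin B (b • y + a • z) (b • y + a • z) =
      b ^ 2 * bilin B y y + 2 * (a * b) * bilin B y z + a ^ 2 * bilin B z z := by
    simp only [bilin_add_left, bilin_add_right, bilin_smul_left, bilin_smul_right,
      bilin_comm h.symm z y]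
    ring
  have h3 : wInner D (b • y + a • z) (b • y + a • z) ≤ 4 * (a * b) ^ 2 := by
    have : wInner D (b • y + a • z) (b • y + a • z) ≤
        2 * b ^ 2 * wInner D y y + 2 * a ^ 2 * wInner D z z := by
      simp only [wInner, Finset.mul_sum, ← Finset.sum_add_distrib]
      refine Finset.sum_le_sum fun v _ => ?_
      simp only [Pi.add_apply, Pi.smul_apply, smul_eq_mul]
      nlinarith [mul_nonneg (h.pos v).le (sq_nonneg (b * y v - a * z v))]
    rw [← ha2, ← hb2] at this
    linarith
  have h4 := bilin_nonneg h.nonneg hy0 hy0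
  have h5 := bilin_nonneg h.nonneg hz0 hz0
  have h6 : (a * b) * bilin B y z ≤ (a * b) * (4 * K * (a * b)) := by
    rw [h2] at h1
    push_cast at h1
    nlinarith [mul_nonneg (sq_nonneg b) h4, mul_nonneg (sq_nonneg a) h5,
      mul_le_mul_of_nonneg_left h3 (Nat.cast_nonneg K : (0 : ℝ) ≤ K)]
  exact le_of_mul_le_mul_left h6 (mul_pos ha0 hb0)

end IsCertificate

end Certificate

section Perron

variable [Fintype V] {G : SimpleGraph V} {D : V → ℝ} {B : V → V → ℝ}

lemma isCompact_wSphere (hD : ∀ v, 0 < D v) : IsCompact {z : V → ℝ | wInner D z z = 1} := by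
  refine Metric.isCompact_of_isClosed_isBounded ?_ ?_
  · refine isClosed_eq ?_ continuous_const
    unfold wInner
    fun_prop
  · refine (Metric.isBounded_closedBall (x := (0 : V → ℝ)) (r := 1 + ∑ v, 1 / D v)).subset ?_
    intro z hz
    have hsum : ∀ v, 1 / D v ≤ ∑ v, 1 / D v := fun v =>
      Finset.single_le_sum (f := fun v => 1 / D v) (fun w _ => (one_div_pos.2 (hD w)).le)
        (Finset.mem_univ v)
    have h0 : 0 ≤ ∑ v, 1 / D v := Finset.sum_nonneg fun w _ => (one_div_pos.2 (hD w)).le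
    rw [mem_closedBall_zero_iff, pi_norm_le_iff_of_nonneg (by linarith)]
    intro v
    have h1 : D v * (z v * z v) ≤ 1 := (le_wInner_self hD z v).trans (le_of_eq hz)
    have h2 : z v * z v ≤ 1 / D v := by
      rw [le_div_iff₀ (hD v)]
      linarith
    rw [Real.norm_eq_abs]
    nlinarith [hsum v, abs_mul_abs_self (z v), sq_nonneg (|z v| - 1), abs_nonneg (z v)]

/-- A nonnegative top eigenvector of `B` relative to the weights `D`. -/
lemma IsCertificate.exists_eigenvector [Nonempty V] (h : IsCertificate G D B) :
    ∃ (f : V → ℝ) (l : ℝ), (∀ v, 0 ≤ f v) ∧ wInner D f f = 1 ∧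
      (∀ z, bilin B z f = l * wInner D z f) ∧ ∀ z, bilin B z z ≤ l * wInner D z z := by
  classical
  have hne : {z : V → ℝ | wInner D z z = 1}.Nonempty := by
    obtain ⟨v⟩ := ‹Nonempty V›
    refine ⟨Pi.single v (√(D v))⁻¹, ?_⟩
    have h1 := h.pos v
    simp only [Set.mem_ofPred_eq, wInner]
    rw [Finset.sum_eq_single v (fun w _ hw => by simp [hw]) (by simp), Pi.single_eq_same,
      ← mul_inv, Real.mul_self_sqrt h1.le, mul_inv_cancel₀ h1.ne']
  have hcont : Continuous fun z : V → ℝ => bilin B z z := by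
    unfold bilin
    fun_prop
  obtain ⟨g, hg, hmax⟩ := (isCompact_wSphere h.pos).exists_isMaxOn hne hcont.continuousOn
  set f : V → ℝ := fun v => |g v| with hf
  have hf1 : wInner D f f = 1 := by
    rw [← hg]
    exact Finset.sum_congr rfl fun v _ => by simp [hf]
  have hle : bilin B g g ≤ bilin B f f :=
    Finset.sum_le_sum fun u _ => Finset.sum_le_sum fun v _ => by
      refine mul_le_mul_of_nonneg_left ?_ (h.nonneg u v)
      simpa [hf, abs_mul] using le_abs_self (g u * g v)
  have hray : ∀ z, bilin B z z ≤ bilin B f f * wInner D z z := fun z => by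
    rcases (wInner_self_nonneg h.pos z).eq_or_lt with h0 | h0
    · rw [wInner_self_eq_zero h.pos h0.symm]
      simp [bilin, wInner]
    · set s := √(wInner D z z) with hs
      have hs0 : 0 < s := Real.sqrt_pos.2 h0
      have hs2 : s * s = wInner D z z := Real.mul_self_sqrt h0.le
      have h1 : wInner D (s⁻¹ • z) (s⁻¹ • z) = 1 := by
        rw [wInner_smul_left, wInner_comm, wInner_smul_left, ← hs2]
        field_simp
      have h2 : bilin B (s⁻¹ • z) (s⁻¹ • z) ≤ bilin B g g := hmax h1
      rw [bilin_smul_left, bilin_smul_right] at h2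
      have h3 : bilin B z z = s * s * (s⁻¹ * (s⁻¹ * bilin B z z)) := by field_simp
      rw [h3, hs2, mul_comm]
      exact mul_le_mul_of_nonneg_right (h2.trans hle) h0.le
  refine ⟨f, bilin B f f, fun v => abs_nonneg _, hf1, fun z => ?_, hray⟩
  set l := bilin B f f with hl
  have hquad : ∀ t : ℝ, 0 ≤ (l * wInner D z z - bilin B z z) * (t * t) +
      2 * (l * wInner D z f - bilin B z f) * t + 0 := fun t => by
    have h1 := hray (f + t • z)
    simp only [bilin_add_left, bilin_add_right, bilin_smul_left, bilin_smul_right,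
      bilin_comm h.symm f z] at h1
    have h2 : wInner D (f + t • z) (f + t • z) = 1 + 2 * t * wInner D z f
        + t * t * wInner D z z := by
      rw [wInner_add_left, wInner_smul_left, wInner_comm D f, wInner_comm D z, wInner_add_left,
        wInner_add_left, wInner_smul_left, wInner_smul_left, hf1, wInner_comm D f z]
      ring
    rw [h2] at h1
    linarith
  have hd := discrim_le_zero hquad
  rw [discrim] at hd
  nlinarith [sq_nonneg (l * wInner D z f - bilin B z f)]

end Perron

section Levels

/-- The distance from `w`, with a default value on the other components. -/
noncomputable def distLevel (G : SimpleGraph V) (w : V) (N : ℕ) (v : V) : ℕ :=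
  open Classical in if G.Reachable v w then G.dist v w else N

lemma distLevel_self (G : SimpleGraph V) (w : V) (N : ℕ) : distLevel G w N w = 0 := by
  simp [distLevel]

lemma distLevel_le_of_adj {G : SimpleGraph V} {w : V} {N : ℕ} {u v : V} (h : G.Adj u v) :
    distLevel G w N u ≤ distLevel G w N v + 1 := by
  by_cases hv : G.Reachable v w
  · have hu : G.Reachable u w := h.reachable.trans hv
    rw [distLevel, distLevel, if_pos hu, if_pos hv]
    obtain ⟨p, hp⟩ := hv.exists_walk_length_eq_dist
    rw [← hp]
    exact G.dist_le (p.cons h)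
  · have hu : ¬ G.Reachable u w := fun hu => hv (h.symm.reachable.trans hu)
    rw [distLevel, distLevel, if_neg hu, if_neg hv]
    omega

lemma exists_distLevel_parent (G : SimpleGraph V) (w : V) (N : ℕ) (v : V) :
    ∃ p, 1 ≤ distLevel G w N v → distLevel G w N v < N →
      G.Adj p v ∧ distLevel G w N p + 1 = distLevel G w N v := by
  by_cases hv : G.Reachable v w
  · obtain ⟨q, hq⟩ := hv.exists_walk_length_eq_dist
    cases q with
    | nil => exact ⟨w, fun h => by simp [distLevel] at h⟩
    | @cons _ p _ hvp q =>
      refine ⟨p, fun _ _ => ⟨hvp.symm, ?_⟩⟩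
      have hp : G.Reachable p w := ⟨q⟩
      have h1 := distLevel_le_of_adj (w := w) (N := N) hvp
      have h2 : G.dist p w ≤ q.length := G.dist_le q
      rw [SimpleGraph.Walk.length_cons] at hq
      rw [distLevel, distLevel, if_pos hv, if_pos hp] at *
      omega
  · exact ⟨v, fun _ h => by simp [distLevel, hv] at h⟩

lemma eq_of_distLevel_eq_zero {G : SimpleGraph V} {w : V} {N : ℕ} (hN : 0 < N) {v : V}
    (h : distLevel G w N v = 0) : v = w := by
  unfold distLevel at h
  split_ifs at h with hv
  · exact hv.dist_eq_zero_iff.1 h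
  · omega

lemma colorableOn_distLevel [Finite V] {G : SimpleGraph V} {k : ℕ}
    (hG : CycleFree G (2 * k + 1)) (w : V) {i : ℕ} (hi : i ≤ k) :
    ColorableOn G {v | distLevel G w (k + 2) v = i} ((2 * k + 1) ^ k) := by
  choose p hp using exists_distLevel_parent G w (k + 2)
  exact colorableOn_level (p := p) hG hi (fun v h1 h2 => hp v h1 (by omega)) fun u v hu hv =>
    (eq_of_distLevel_eq_zero (by omega) hu).trans (eq_of_distLevel_eq_zero (by omega) hv).symm

end Levels

section Bounds

variable [Fintype V] {G : SimpleGraph V} {D : V → ℝ} {B : V → V → ℝ} {k : ℕ}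

/-- Four times the number of colours needed for the distance levels up to `k` in a graph without
`(2 * k + 1)`-cycles. -/
def levelConst (k : ℕ) : ℝ := 4 * ((2 * k + 1 : ℕ) ^ k : ℕ)

lemma four_le_levelConst (k : ℕ) : 4 ≤ levelConst k := by
  have : 1 ≤ (2 * k + 1 : ℕ) ^ k := Nat.one_le_pow _ _ (by omega)
  have : (1 : ℝ) ≤ ((2 * k + 1 : ℕ) ^ k : ℕ) := by exact_mod_cast this
  rw [levelConst]
  linarith

lemma IsCertificate.bilin_le_of_level (h : IsCertificate G D B) (hG : CycleFree G (2 * k + 1))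
    (w : V) {i j : ℕ} (hi : i ≤ k) (hj : j ≤ k) {y z : V → ℝ} (hy0 : ∀ v, 0 ≤ y v)
    (hz0 : ∀ v, 0 ≤ z v) (hy : ∀ v, y v ≠ 0 → distLevel G w (k + 2) v = i)
    (hz : ∀ v, z v ≠ 0 → distLevel G w (k + 2) v = j) :
    bilin B y z ≤ levelConst k * (√(wInner D y y) * √(wInner D z z)) :=
  h.bilin_le (colorableOn_distLevel hG w hi) (colorableOn_distLevel hG w hj) hy0 hz0 hy hz

lemma IsCertificate.sum_neighbors_inv_le [DecidableRel G.Adj] (h : IsCertificate G D B)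
    (hB : ∀ u v, G.Adj u v → 1 ≤ B u v) (hk : 1 ≤ k) (hG : CycleFree G (2 * k + 1)) (v : V) :
    ∑ u, (if G.Adj v u then 1 / D u else 0) ≤ levelConst k ^ 2 * D v := by
  classical
  set z : V → ℝ := fun u => if G.Adj v u then 1 / D u else 0 with hz
  set S := ∑ u, z u with hS
  have hz0 : ∀ u, 0 ≤ z u := fun u => by
    simp only [hz]
    split_ifs
    exacts [(one_div_pos.2 (h.pos u)).le, le_rfl]
  have hS0 : 0 ≤ S := Finset.sum_nonneg fun u _ => hz0 u
  have h1 : wInner D (Pi.single v 1) (Pi.single v 1) = D v := by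
    rw [wInner, Finset.sum_eq_single v (fun w _ hw => by simp [hw]) (by simp)]
    simp
  have h2 : wInner D z z = S := by
    refine Finset.sum_congr rfl fun u _ => ?_
    have := (h.pos u).ne'
    simp only [hz]
    split_ifs
    · field_simp
    · ring
  have h3 : S ≤ bilin B (Pi.single v 1) z := by
    rw [bilin, Finset.sum_eq_single v (fun w _ hw => by simp [hw]) (by simp)]
    refine Finset.sum_le_sum fun u _ => ?_
    simp only [Pi.single_eq_same, one_mul]
    by_cases huv : G.Adj v u
    · exact le_mul_of_one_le_left (hz0 u) (hB v u huv)
    · simp [hz, huv]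
  have h4 := h.bilin_le_of_level hG v (i := 0) (j := 1) (y := Pi.single v 1) (z := z)
    (Nat.zero_le k) hk
    (fun u => by by_cases huv : u = v <;> simp [huv]) hz0
    (fun u hu => by
      obtain rfl : u = v := by
        by_contra huv
        simp [huv] at hu
      exact distLevel_self G u _)
    (fun u hu => by
      have huv : G.Adj v u := by
        by_contra huv
        simp [hz, huv] at hu
      have h5 := distLevel_le_of_adj (w := v) (N := k + 2) huv.symm
      rw [distLevel_self] at h5
      have h6 : distLevel G v (k + 2) u ≠ 0 := fun h0 =>
        huv.ne (eq_of_distLevel_eq_zero (by omega) h0).symm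
      omega)
  rw [h1, h2] at h4
  have h5 : S ≤ levelConst k * √(D v) * √S := by linarith
  rcases hS0.eq_or_lt with h0 | h0
  · rw [← h0]
    have := (h.pos v).le
    positivity
  · have h6 : √S ≤ levelConst k * √(D v) := by
      refine le_of_mul_le_mul_right ?_ (Real.sqrt_pos.2 h0)
      rwa [Real.mul_self_sqrt hS0]
    have h7 := pow_le_pow_left₀ (Real.sqrt_nonneg S) h6 2
    rwa [mul_pow, Real.sq_sqrt hS0, Real.sq_sqrt (h.pos v).le] at h7

/-- The number of edges at vertices of small degree is controlled by the trace. -/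
lemma IsCertificate.sum_low_degree_le [DecidableRel G.Adj] (h : IsCertificate G D B)
    (hB : ∀ u v, G.Adj u v → 1 ≤ B u v) (hk : 1 ≤ k) (hG : CycleFree G (2 * k + 1))
    {T Δ : ℝ} (hT : ∑ v, D v ≤ T) (hΔ : 0 ≤ Δ) {S : Finset V}
    (hS : ∀ v ∈ S, (G.degree v : ℝ) ≤ Δ) :
    ∑ v ∈ S, (G.degree v : ℝ) ≤ levelConst k * T * √Δ := by
  have hC := four_le_levelConst k
  have hT0 : 0 ≤ T := (Finset.sum_nonneg fun v _ => (h.pos v).le).trans hT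
  have hdeg : ∀ v, (G.degree v : ℝ) = ∑ u, if G.Adj u v then (1 : ℝ) else 0 := fun v => by
    rw [← G.card_neighborFinset_eq_degree, G.neighborFinset_eq_filter, Finset.sum_boole]
    simp only [G.adj_comm v]
  have h1 : ∑ v ∈ S, (G.degree v : ℝ) / D v ≤ levelConst k ^ 2 * T := by
    calc ∑ v ∈ S, (G.degree v : ℝ) / D v ≤ ∑ v, (G.degree v : ℝ) / D v :=
          Finset.sum_le_sum_of_subset_of_nonneg (Finset.subset_univ S)
            fun v _ _ => div_nonneg (Nat.cast_nonneg _) (h.pos v).le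
      _ = ∑ u, ∑ v, (if G.Adj u v then 1 / D v else 0) := by
          rw [Finset.sum_comm]
          refine Finset.sum_congr rfl fun v _ => ?_
          rw [hdeg, Finset.sum_div]
          exact Finset.sum_congr rfl fun u _ => by split_ifs <;> simp
      _ ≤ ∑ u, levelConst k ^ 2 * D u :=
          Finset.sum_le_sum fun u _ => h.sum_neighbors_inv_le hB hk hG u
      _ ≤ levelConst k ^ 2 * T := by
          rw [← Finset.mul_sum]
          gcongr
  have h2 : ∑ v ∈ S, (G.degree v : ℝ) * D v ≤ Δ * T := by
    calc ∑ v ∈ S, (G.degree v : ℝ) * D v ≤ ∑ v ∈ S, Δ * D v :=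
          Finset.sum_le_sum fun v hv => mul_le_mul_of_nonneg_right (hS v hv) (h.pos v).le
      _ ≤ ∑ v, Δ * D v := Finset.sum_le_sum_of_subset_of_nonneg (Finset.subset_univ S)
            fun v _ _ => mul_nonneg hΔ (h.pos v).le
      _ ≤ Δ * T := by
          rw [← Finset.mul_sum]
          gcongr
  have h3 := Finset.sum_sq_le_sum_mul_sum_of_sq_le_mul S (r := fun v => (G.degree v : ℝ))
    (f := fun v => (G.degree v : ℝ) / D v) (g := fun v => (G.degree v : ℝ) * D v)
    (fun v _ => div_nonneg (Nat.cast_nonneg _) (h.pos v).le)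
    (fun v _ => mul_nonneg (Nat.cast_nonneg _) (h.pos v).le)
    (fun v _ => le_of_eq (by have := (h.pos v).ne'; field_simp))
  refine le_of_sq_le_sq ?_ (by positivity)
  calc _ ≤ _ := h3
    _ ≤ (levelConst k ^ 2 * T) * (Δ * T) := mul_le_mul h1 h2
        (Finset.sum_nonneg fun v _ => mul_nonneg (Nat.cast_nonneg _) (h.pos v).le) (by positivity)
    _ = (levelConst k * T * √Δ) ^ 2 := by
        rw [mul_pow, Real.sq_sqrt hΔ]
        ring

end Bounds

section Eigenvalue

variable [Fintype V] {G : SimpleGraph V} {D : V → ℝ} {B : V → V → ℝ} {k : ℕ}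

/-- The part of `f` on the vertices at distance `i` from `w`. -/
noncomputable def levelPart (G : SimpleGraph V) (w : V) (N : ℕ) (f : V → ℝ) (i : ℕ) (v : V) : ℝ :=
  if distLevel G w N v = i then f v else 0

lemma wInner_levelPart (w : V) (N : ℕ) (f : V → ℝ) (i : ℕ) :
    wInner D (levelPart G w N f i) f =
      wInner D (levelPart G w N f i) (levelPart G w N f i) :=
  Finset.sum_congr rfl fun v _ => by
    simp only [levelPart]
    split_ifs <;> simp

lemma IsCertificate.bilin_levelPart_le (h : IsCertificate G D B) {w : V} {N i : ℕ} {f g : V → ℝ}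
    (hf : ∀ v, 0 ≤ f v)
    (hfg : ∀ u v, G.Adj u v → distLevel G w N u = i → f v ≤ g v) :
    bilin B (levelPart G w N f i) f ≤ bilin B (levelPart G w N f i) g := by
  refine Finset.sum_le_sum fun u _ => Finset.sum_le_sum fun v _ => ?_
  by_cases hu : distLevel G w N u = i
  · by_cases hB : B u v = 0
    · simp [hB]
    · simp only [levelPart, if_pos hu]
      exact mul_le_mul_of_nonneg_left
        (mul_le_mul_of_nonneg_left (hfg u v (h.adj u v hB) hu) (hf u)) (h.nonneg u v)
  · simp [levelPart, hu]

/-- The norms of the level parts of an eigenvector grow geometrically. -/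
lemma IsCertificate.levelPart_growth (h : IsCertificate G D B) (hG : CycleFree G (2 * k + 1))
    (w : V) {f : V → ℝ} {l : ℝ} (hf : ∀ v, 0 ≤ f v)
    (heig : ∀ z, bilin B z f = l * wInner D z f) (hl : 3 * levelConst k ≤ l) {F : ℕ → ℝ}
    (hF : ∀ i, F i = √(wInner D (levelPart G w (k + 2) f i) (levelPart G w (k + 2) f i)))
    {i : ℕ} (hi : i + 1 ≤ k) : l / (3 * levelConst k) * F i ≤ F (i + 1) := by
  set C := levelConst k with hC
  have hC0 : 0 < C := by linarith [four_le_levelConst k]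
  set q := l / (3 * C) with hq
  have hq1 : 1 ≤ q := by rwa [hq, one_le_div (by positivity)]
  have hlq : l = 3 * C * q := by rw [hq]; field_simp
  have hF0 : ∀ i, 0 ≤ F i := fun i => by rw [hF]; exact Real.sqrt_nonneg _
  have hpart0 : ∀ i v, 0 ≤ levelPart G w (k + 2) f i v := fun i v => by
    unfold levelPart
    split_ifs
    exacts [hf v, le_rfl]
  have hpart : ∀ i v, levelPart G w (k + 2) f i v ≠ 0 → distLevel G w (k + 2) v = i :=
    fun i v hv => by
      by_contra hne
      simp [levelPart, hne] at hv
  have hcross : ∀ i j, i ≤ k → j ≤ k →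
      bilin B (levelPart G w (k + 2) f i) (levelPart G w (k + 2) f j) ≤ C * (F i * F j) :=
    fun i j hi hj => by
      rw [hF, hF]
      exact h.bilin_le_of_level hG w hi hj (hpart0 i) (hpart0 j) (hpart i) (hpart j)
  have heigF : ∀ i, bilin B (levelPart G w (k + 2) f i) f = l * (F i * F i) := fun i => by
    rw [heig, wInner_levelPart, hF, Real.mul_self_sqrt (wInner_self_nonneg h.pos _)]
  have hcancel : ∀ {i : ℕ} {x : ℝ}, 0 ≤ x → l * (F i * F i) ≤ C * (F i * x) → 3 * q * F i ≤ x := by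
    intro i x hx hle
    rcases (hF0 i).eq_or_lt with h0 | h0
    · simpa [← h0] using hx
    · refine le_of_mul_le_mul_left ?_ (mul_pos hC0 h0)
      rw [hlq] at hle
      linarith
  induction i with
  | zero =>
    have h1 := h.bilin_levelPart_le (w := w) (N := k + 2) (i := 0) (f := f)
      (g := levelPart G w (k + 2) f 0 + levelPart G w (k + 2) f 1) hf fun u v huv hu => by
        have h2 := distLevel_le_of_adj (w := w) (N := k + 2) huv.symm
        rw [hu] at h2
        have h3 : distLevel G w (k + 2) v = 0 ∨ distLevel G w (k + 2) v = 1 := by omega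
        rcases h3 with h3 | h3 <;> simp [levelPart, h3]
    rw [heigF, bilin_add_right] at h1
    have h4 := hcancel (i := 0) (x := F 0 + F 1) (add_nonneg (hF0 0) (hF0 1))
      (by linarith [hcross 0 0 (by omega) (by omega), hcross 0 1 (by omega) (by omega)])
    rw [zero_add]
    nlinarith [hF0 0]
  | succ i ih =>
    have hprev := ih (by omega)
    have h1 := h.bilin_levelPart_le (w := w) (N := k + 2) (i := i + 1) (f := f)
      (g := levelPart G w (k + 2) f i + levelPart G w (k + 2) f (i + 1) +
        levelPart G w (k + 2) f (i + 2)) hf fun u v huv hu => by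
        have h2 := distLevel_le_of_adj (w := w) (N := k + 2) huv.symm
        have h2' := distLevel_le_of_adj (w := w) (N := k + 2) huv
        rw [hu] at h2 h2'
        have h3 : distLevel G w (k + 2) v = i ∨ distLevel G w (k + 2) v = i + 1 ∨
          distLevel G w (k + 2) v = i + 2 := by omega
        rcases h3 with h3 | h3 | h3 <;> simp [levelPart, h3]
    rw [heigF, bilin_add_right, bilin_add_right] at h1
    have h4 := hcancel (i := i + 1) (x := F i + F (i + 1) + F (i + 2))
      (add_nonneg (add_nonneg (hF0 _) (hF0 _)) (hF0 _))
      (by linarith [hcross (i + 1) i (by omega) (by omega),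
        hcross (i + 1) (i + 1) (by omega) (by omega), hcross (i + 1) (i + 2) (by omega) (by omega)])
    have h5 : F i ≤ F (i + 1) := le_trans (le_mul_of_one_le_left (hF0 i) hq1) hprev
    rw [add_assoc, one_add_one_eq_two]
    nlinarith [hF0 (i + 1)]

/-- A set of small chromatic number carries little of the mass of an eigenvector with a large
eigenvalue. -/
lemma IsCertificate.eigenvalue_mul_levelPart_le (h : IsCertificate G D B)
    (hG : CycleFree G (2 * k + 1)) (w : V) {f : V → ℝ} {l : ℝ} (hf1 : wInner D f f = 1)
    (heig : ∀ z, bilin B z f = l * wInner D z f) {i : ℕ} (hi : i ≤ k) {s : ℝ}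
    (hs : s = wInner D (levelPart G w (k + 2) f i) (levelPart G w (k + 2) f i)) :
    l * s ≤ levelConst k := by
  set g := levelPart G w (k + 2) f i with hg
  have hs0 : 0 ≤ s := hs ▸ wInner_self_nonneg h.pos g
  have hgf : wInner D g f = s := by rw [hs, wInner_levelPart]
  have hC : (((2 * k + 1 : ℕ) ^ k : ℕ) : ℝ) = levelConst k / 4 := by
    rw [levelConst]; ring
  have h1 : bilin B g g ≤ levelConst k / 4 * s := by
    rw [hs, ← hC]
    refine h.bilin_self_le (colorableOn_distLevel hG w hi) fun v hv => ?_
    by_contra hne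
    have hne' : distLevel G w (k + 2) v ≠ i := hne
    simp [hg, levelPart, hne'] at hv
  have h2 := h.psd (g + (-s) • f)
  have h3 : bilin B f g = l * s := by rw [bilin_comm h.symm, heig, hgf]
  simp only [bilin_add_left, bilin_add_right, bilin_smul_left, bilin_smul_right, heig, h3] at h2
  rw [wInner_add_left, wInner_smul_left, wInner_comm D g, wInner_comm D f, wInner_add_left,
    wInner_add_left, wInner_smul_left, wInner_smul_left, hf1, wInner_comm D f g, hgf, ← hs] at h2
  rcases hs0.eq_or_lt with h0 | h0
  · rw [← h0]
    linarith [four_le_levelConst k]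
  · refine le_of_mul_le_mul_right ?_ h0
    nlinarith [four_le_levelConst k]

lemma IsCertificate.eigenvalue_pow_le (h : IsCertificate G D B) (hG : CycleFree G (2 * k + 1))
    {f : V → ℝ} {l : ℝ} (hf : ∀ v, 0 ≤ f v) (hf1 : wInner D f f = 1)
    (heig : ∀ z, bilin B z f = l * wInner D z f) (hl : 3 * levelConst k ≤ l) {H : Finset V}
    (hH : ∀ v, v ∉ H → f v = 0) :
    l ^ (2 * k + 1) ≤ (3 * levelConst k) ^ (2 * k + 1) * H.card := by
  set C := levelConst k with hC
  have hC4 : 4 ≤ C := four_le_levelConst k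
  have hC0 : 0 < C := by linarith
  have hsumH : ∑ v ∈ H, D v * (f v * f v) = 1 := by
    rw [← hf1]
    exact Finset.sum_subset (Finset.subset_univ H) fun v _ hv => by simp [hH v hv]
  have hHne : H.Nonempty := by
    by_contra hne
    rw [Finset.not_nonempty_iff_eq_empty.1 hne, Finset.sum_empty] at hsumH
    exact zero_ne_one hsumH
  obtain ⟨w, -, hw⟩ := H.exists_max_image (fun v => D v * (f v * f v)) hHne
  have hcard : 1 ≤ H.card * (D w * (f w * f w)) := by
    have := Finset.sum_le_card_nsmul H _ _ hw
    rwa [hsumH, nsmul_eq_mul] at this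
  set F : ℕ → ℝ := fun i =>
    √(wInner D (levelPart G w (k + 2) f i) (levelPart G w (k + 2) f i)) with hF
  set q := l / (3 * C) with hq
  have hq0 : 0 ≤ q := div_nonneg (by linarith) (by positivity)
  have hlq : l = 3 * C * q := by rw [hq, mul_div_cancel₀ _ (by positivity)]
  have hFsq : ∀ i, F i ^ 2 = wInner D (levelPart G w (k + 2) f i) (levelPart G w (k + 2) f i) :=
    fun i => Real.sq_sqrt (wInner_self_nonneg h.pos _)
  have hgrow : ∀ i, i ≤ k → q ^ i * F 0 ≤ F i := fun i => by
    induction i with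
    | zero => simp
    | succ i ih =>
      intro hi
      have h1 := h.levelPart_growth hG w hf heig hl (F := F) (fun _ => rfl) hi
      calc q ^ (i + 1) * F 0 = q * (q ^ i * F 0) := by ring
        _ ≤ q * F i := mul_le_mul_of_nonneg_left (ih (by omega)) hq0
        _ ≤ F (i + 1) := h1
  have hF0 : D w * (f w * f w) ≤ F 0 ^ 2 := by
    rw [hFsq]
    have := le_wInner_self h.pos (levelPart G w (k + 2) f 0) w
    simpa [levelPart, distLevel_self] using this
  have hFk : q ^ (2 * k) * (D w * (f w * f w)) ≤ F k ^ 2 := by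
    calc q ^ (2 * k) * (D w * (f w * f w)) ≤ q ^ (2 * k) * F 0 ^ 2 := by gcongr
      _ = (q ^ k * F 0) ^ 2 := by ring
      _ ≤ F k ^ 2 :=
        pow_le_pow_left₀ (mul_nonneg (pow_nonneg hq0 _) (Real.sqrt_nonneg _)) (hgrow k le_rfl) 2
  have hmass : l * F k ^ 2 ≤ C := h.eigenvalue_mul_levelPart_le hG w hf1 heig le_rfl (hFsq k)
  have hl0 : 0 ≤ l := by linarith
  have h1 : l * q ^ (2 * k) ≤ C * H.card := by
    calc l * q ^ (2 * k) ≤ l * q ^ (2 * k) * (H.card * (D w * (f w * f w))) :=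
          le_mul_of_one_le_right (by positivity) hcard
      _ = H.card * (l * (q ^ (2 * k) * (D w * (f w * f w)))) := by ring
      _ ≤ H.card * C := mul_le_mul_of_nonneg_left
          ((mul_le_mul_of_nonneg_left hFk hl0).trans hmass) (Nat.cast_nonneg _)
      _ = C * H.card := mul_comm _ _
  calc l ^ (2 * k + 1) = (3 * C) ^ (2 * k) * (l * q ^ (2 * k)) := by
        rw [pow_succ l, show l ^ (2 * k) = (3 * C) ^ (2 * k) * q ^ (2 * k) by
          rw [← mul_pow, ← hlq]]
        ring
    _ ≤ (3 * C) ^ (2 * k) * (C * H.card) := by gcongr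
    _ ≤ (3 * C) ^ (2 * k) * (3 * C * H.card) := mul_le_mul_of_nonneg_left
        (mul_le_mul_of_nonneg_right (by linarith) (Nat.cast_nonneg _)) (by positivity)
    _ = _ := by ring

end Eigenvalue

section Assembly

variable [Fintype V] {G : SimpleGraph V} {D : V → ℝ} {B : V → V → ℝ} {k : ℕ}

/-- The number of edges inside a vertex set is controlled by the trace and the number of
vertices. -/
lemma IsCertificate.pairs_pow_le [DecidableRel G.Adj] (h : IsCertificate G D B)
    (hB : ∀ u v, G.Adj u v → 1 ≤ B u v) (hG : CycleFree G (2 * k + 1))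
    {T : ℝ} (hT : ∑ v, D v ≤ T) (H : Finset V) :
    (∑ u ∈ H, ∑ v ∈ H, if G.Adj u v then (1 : ℝ) else 0) ^ (2 * k + 1) ≤
      (3 * levelConst k * T) ^ (2 * k + 1) * H.card := by
  classical
  have hC := four_le_levelConst k
  have hD0 : 0 ≤ ∑ v, D v := Finset.sum_nonneg fun v _ => (h.pos v).le
  have hT0 : 0 ≤ T := hD0.trans hT
  rcases H.eq_empty_or_nonempty with rfl | hHne
  · simp
  have : Nonempty V := ⟨hHne.choose⟩
  have hcard : (1 : ℝ) ≤ H.card := by exact_mod_cast hHne.card_pos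
  set P := ∑ u ∈ H, ∑ v ∈ H, if G.Adj u v then (1 : ℝ) else 0 with hP
  have hP0 : 0 ≤ P := Finset.sum_nonneg fun u _ => Finset.sum_nonneg fun v _ => by
    split_ifs <;> norm_num
  have h' := h.restrict H
  obtain ⟨f, l, hf, hf1, heig, hray⟩ := h'.exists_eigenvector
  have hPl : P ≤ l * ∑ v, D v := by
    have h1 := hray 1
    have h2 : wInner D 1 1 = ∑ v, D v := by simp [wInner]
    rw [h2] at h1
    refine le_trans ?_ h1
    have h3 : P = ∑ u, ∑ v, if u ∈ H ∧ v ∈ H then (if G.Adj u v then (1 : ℝ) else 0) else 0 := by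
      have hrow : ∀ u, (∑ v, if u ∈ H ∧ v ∈ H then (if G.Adj u v then (1 : ℝ) else 0) else 0) =
          if u ∈ H then ∑ v ∈ H, (if G.Adj u v then (1 : ℝ) else 0) else 0 := fun u => by
        by_cases hu : u ∈ H <;> simp only [hu, true_and, false_and, if_true, if_false,
          Finset.sum_ite_mem, Finset.univ_inter, Finset.sum_const_zero]
      simp only [hrow, Finset.sum_ite_mem, Finset.univ_inter, hP]
    rw [h3]
    refine Finset.sum_le_sum fun u _ => Finset.sum_le_sum fun v _ => ?_
    simp only [Pi.one_apply, mul_one]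
    by_cases huv : u ∈ H ∧ v ∈ H
    · rw [if_pos huv, if_pos huv]
      split_ifs with hadj
      exacts [hB u v hadj, h.nonneg u v]
    · rw [if_neg huv, if_neg huv]
  rcases lt_or_ge l (3 * levelConst k) with hl | hl
  · have h1 : P ≤ 3 * levelConst k * T :=
      hPl.trans ((mul_le_mul_of_nonneg_right hl.le hD0).trans
        (mul_le_mul_of_nonneg_left hT (by linarith)))
    calc P ^ (2 * k + 1) ≤ (3 * levelConst k * T) ^ (2 * k + 1) := pow_le_pow_left₀ hP0 h1 _
      _ ≤ _ := le_mul_of_one_le_right (pow_nonneg (hP0.trans h1) _) hcard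
  · have hl0 : 0 < l := by linarith
    have hfH : ∀ v, v ∉ H → f v = 0 := fun v hv => by
      have h1 := heig (Pi.single v 1)
      have h2 : bilin (fun u v => if u ∈ H ∧ v ∈ H then B u v else 0) (Pi.single v 1) f = 0 := by
        rw [bilin, Finset.sum_eq_single v (fun w _ hw => by simp [hw]) (by simp)]
        simp [hv]
      have h3 : wInner D (Pi.single v 1) f = D v * f v := by
        rw [wInner, Finset.sum_eq_single v (fun w _ hw => by simp [hw]) (by simp)]
        simp
      rw [h2, h3] at h1
      simpa [hl0.ne', (h.pos v).ne'] using h1.symm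
    have h1 := h'.eigenvalue_pow_le hG hf hf1 heig hl hfH
    have h2 : P ≤ l * T := hPl.trans (mul_le_mul_of_nonneg_left hT hl0.le)
    calc P ^ (2 * k + 1) ≤ (l * T) ^ (2 * k + 1) := pow_le_pow_left₀ hP0 h2 _
      _ = l ^ (2 * k + 1) * T ^ (2 * k + 1) := mul_pow _ _ _
      _ ≤ (3 * levelConst k) ^ (2 * k + 1) * H.card * T ^ (2 * k + 1) :=
        mul_le_mul_of_nonneg_right h1 (pow_nonneg hT0 _)
      _ = _ := by rw [mul_pow _ T]; ring

lemma IsCertificate.edgeCount_le_or [DecidableRel G.Adj] (h : IsCertificate G D B)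
    (hB : ∀ u v, G.Adj u v → 1 ≤ B u v) (hk : 1 ≤ k) (hG : CycleFree G (2 * k + 1))
    {T Δ : ℝ} (hT : ∑ v, D v ≤ T) (hΔ : 0 ≤ Δ) :
    (edgeCount G : ℝ) ≤ 2 * (levelConst k * T * √Δ) ∨
      (edgeCount G : ℝ) ^ (2 * k + 1) * Δ ≤
        (3 * levelConst k * T) ^ (2 * k + 1) * (2 * edgeCount G) := by
  classical
  set m : ℝ := (edgeCount G : ℝ) with hm
  set S := Finset.univ.filter fun v => (G.degree v : ℝ) ≤ Δ with hS
  set H := Finset.univ.filter fun v => ¬ (G.degree v : ℝ) ≤ Δ with hH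
  have hT0 : 0 ≤ T := (Finset.sum_nonneg fun v _ => (h.pos v).le).trans hT
  have hC := four_le_levelConst k
  have hdeg : ∀ v, (G.degree v : ℝ) = ∑ u, if G.Adj v u then (1 : ℝ) else 0 := fun v => by
    rw [← G.card_neighborFinset_eq_degree, G.neighborFinset_eq_filter, Finset.sum_boole]
  have hsum : 2 * m = ∑ v, (G.degree v : ℝ) := by
    rw [two_mul_edgeCount]
    exact Finset.sum_congr rfl fun v _ => (hdeg v).symm
  have hlow : ∑ v ∈ S, (G.degree v : ℝ) ≤ levelConst k * T * √Δ :=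
    h.sum_low_degree_le hB hk hG hT hΔ fun v hv => (Finset.mem_filter.1 hv).2
  have hsplit : ∀ g : V → ℝ, ∑ v, g v = ∑ v ∈ S, g v + ∑ v ∈ H, g v := fun g =>
    (Finset.sum_filter_add_sum_filter_not Finset.univ _ g).symm
  set P := ∑ u ∈ H, ∑ v ∈ H, if G.Adj u v then (1 : ℝ) else 0 with hP
  have hcrossle : ∑ u ∈ H, ∑ v ∈ S, (if G.Adj u v then (1 : ℝ) else 0) ≤
      ∑ v ∈ S, (G.degree v : ℝ) := by
    rw [Finset.sum_comm]
    refine Finset.sum_le_sum fun v _ => ?_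
    rw [hdeg]
    simp only [G.adj_comm v]
    exact Finset.sum_le_sum_of_subset_of_nonneg (Finset.subset_univ H)
      fun u _ _ => by split_ifs <;> norm_num
  have hPge : 2 * m - 2 * ∑ v ∈ S, (G.degree v : ℝ) ≤ P := by
    have h1 : ∑ v ∈ H, (G.degree v : ℝ) =
        ∑ u ∈ H, ∑ v ∈ S, (if G.Adj u v then (1 : ℝ) else 0) + P := by
      rw [hP, ← Finset.sum_add_distrib]
      exact Finset.sum_congr rfl fun u _ => by rw [hdeg, hsplit]
    rw [hsum, hsplit, h1]
    linarith
  rcases le_or_gt (m / 2) (∑ v ∈ S, (G.degree v : ℝ)) with hlarge | hsmall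
  · left
    linarith
  · right
    have hHcard : H.card * Δ ≤ 2 * m := by
      rw [hsum, hsplit, ← nsmul_eq_mul]
      have h1 : H.card • Δ ≤ ∑ v ∈ H, (G.degree v : ℝ) :=
        Finset.card_nsmul_le_sum H _ _ fun v hv => (not_le.1 (Finset.mem_filter.1 hv).2).le
      have h2 : 0 ≤ ∑ v ∈ S, (G.degree v : ℝ) := Finset.sum_nonneg fun v _ => Nat.cast_nonneg _
      linarith
    have hmP : m ≤ P := by linarith
    have hm0 : 0 ≤ m := Nat.cast_nonneg _
    calc m ^ (2 * k + 1) * Δ ≤ P ^ (2 * k + 1) * Δ :=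
          mul_le_mul_of_nonneg_right (pow_le_pow_left₀ hm0 hmP _) hΔ
      _ ≤ (3 * levelConst k * T) ^ (2 * k + 1) * H.card * Δ :=
        mul_le_mul_of_nonneg_right (h.pairs_pow_le hB hG hT H) hΔ
      _ = (3 * levelConst k * T) ^ (2 * k + 1) * (H.card * Δ) := mul_assoc _ _ _
      _ ≤ (3 * levelConst k * T) ^ (2 * k + 1) * (2 * m) :=
        mul_le_mul_of_nonneg_left hHcard
          (pow_nonneg (mul_nonneg (by linarith) hT0) _)

/-- The surplus bound, with `x` the `(r + 2)`-nd root of the number of edges. -/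
lemma maxCut_ge_of_edgeCount_eq_pow (hk : 1 ≤ k) (hG : CycleFree G (2 * k + 1)) {x : ℝ}
    (hx : 0 < x) (hm : (edgeCount G : ℝ) = x ^ (2 * k + 3)) :
    (edgeCount G : ℝ) / 2 + 1 / (12 * levelConst k) * x ^ (2 * k + 2) / (4 * Real.pi) ≤
      maxCut G := by
  classical
  by_contra! hcut
  have hC := four_le_levelConst k
  have hC0 : 0 < levelConst k := by linarith
  set T := 1 / (12 * levelConst k) * x ^ (2 * k + 2) with hT
  obtain ⟨D, B, hD, hDT, hsymm, hB1, hB0, hpsd⟩ :=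
    exists_dual_certificate_of_maxCut_lt G (by positivity : 0 < T) hcut
  have h : IsCertificate G D B :=
    { pos := hD
      symm := hsymm
      nonneg := fun u v => by
        by_cases huv : G.Adj u v
        · exact zero_le_one.trans (hB1 u v huv)
        · exact (hB0 u v huv).ge
      adj := fun u v huv => by_contra fun hn => huv (hB0 u v hn)
      psd := fun z => by simpa [wInner, bilin, quadForm, sq] using hpsd z }
  have hCT : levelConst k * T = x ^ (2 * k + 2) / 12 := by
    rw [hT]; field_simp
  rcases h.edgeCount_le_or hB1 hk hG hDT (sq_nonneg x) with h1 | h1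
  · rw [Real.sqrt_sq hx.le, hCT, hm] at h1
    have h2 : x ^ (2 * k + 3) = x ^ (2 * k + 2) * x := pow_succ _ _
    have h3 : 0 < x ^ (2 * k + 2) * x := by positivity
    linarith
  · rw [mul_assoc 3, hCT, hm] at h1
    have h2 : (3 * (x ^ (2 * k + 2) / 12)) ^ (2 * k + 1) * (2 * x ^ (2 * k + 3)) =
        2 * (1 / 4) ^ (2 * k + 1) * ((x ^ (2 * k + 3)) ^ (2 * k + 1) * x ^ 2) := by
      rw [show 3 * (x ^ (2 * k + 2) / 12) = 1 / 4 * x ^ (2 * k + 2) by ring, mul_pow]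
      ring
    have h3 : 0 < (x ^ (2 * k + 3)) ^ (2 * k + 1) * x ^ 2 := by positivity
    have h4 : (1 / 4 : ℝ) ^ (2 * k + 1) ≤ 1 / 4 :=
      pow_le_of_le_one (by norm_num) (by norm_num) (by omega)
    rw [h2] at h1
    nlinarith

end Assembly

/-- For every odd integer `r ≥ 3` there exists `α_r > 0` such that every finite simple
graph with `m` edges containing no cycle of length `r` has a cut of size at least
`m/2 + α_r * m^((r+1)/(r+2))`. -/
theorem statement0 (r : ℕ) (hr : 3 ≤ r) (hodd : Odd r) :
    ∃ α : ℝ, 0 < α ∧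
      ∀ (V : Type) [Fintype V] (G : SimpleGraph V), CycleFree G r →
        (maxCut G : ℝ) ≥ (edgeCount G : ℝ) / 2 +
          α * (edgeCount G : ℝ) ^ (((r : ℝ) + 1) / ((r : ℝ) + 2)) := by
  obtain ⟨k, rfl⟩ := hodd
  have hC := four_le_levelConst k
  refine ⟨1 / (12 * levelConst k) / (4 * Real.pi), by positivity, fun V _ G hG => ?_⟩
  rcases Nat.eq_zero_or_pos (edgeCount G) with h0 | hpos
  · have hexp : (((2 * k + 1 : ℕ) : ℝ) + 1) / (((2 * k + 1 : ℕ) : ℝ) + 2) ≠ 0 := by positivity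
    rw [h0, Nat.cast_zero, Real.zero_rpow hexp]
    simp
  set m : ℝ := (edgeCount G : ℝ) with hm
  have hm0 : 0 < m := Nat.cast_pos.2 hpos
  set x : ℝ := m ^ (((2 * k + 3 : ℕ) : ℝ)⁻¹) with hx
  have hx0 : 0 < x := Real.rpow_pos_of_pos hm0 _
  have hmx : m = x ^ (2 * k + 3) := (Real.rpow_inv_natCast_pow hm0.le (by omega)).symm
  have hxpow : m ^ ((((2 * k + 1 : ℕ) : ℝ) + 1) / (((2 * k + 1 : ℕ) : ℝ) + 2)) =
      x ^ (2 * k + 2) := by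
    rw [hx, ← Real.rpow_natCast, ← Real.rpow_mul hm0.le]
    congr 1
    push_cast
    field_simp
    ring
  have h := maxCut_ge_of_edgeCount_eq_pow (by omega) hG hx0 hmx
  rw [hxpow]
  refine le_of_eq_of_le ?_ h
  ring

end MaxCutPaper
end

section
/- For every ε > 0 there exists a constant c = c(ε) > 0 such that the following holds: if G is a finite simple graph with n ≥ 1 vertices and average degree d = 2e(G)/n, and G contains fewer than (1−ε)·d³/6 triangles, then the surplus of G is at least c·d². -/
namespace MaxCutPaper

variable {V : Type*}

open Finset in
theorem exists_sign_le {W : Type*} [Fintype W] (A : W → W → ℝ) (hd : ∀ i, A i i = 0)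
    (x : W → ℝ) (hx : ∀ i, |x i| ≤ 1) :
    ∃ y : W → ℝ, (∀ i, y i = 1 ∨ y i = -1) ∧
      ∑ i, ∑ j, A i j * (y i * y j) ≤ ∑ i, ∑ j, A i j * (x i * x j) := by
  classical
  suffices H : ∀ s : Finset W, ∃ y : W → ℝ, (∀ i ∈ s, y i = 1 ∨ y i = -1) ∧ (∀ i, |y i| ≤ 1) ∧
      ∑ i, ∑ j, A i j * (y i * y j) ≤ ∑ i, ∑ j, A i j * (x i * x j) by
    obtain ⟨y, hy, -, hQ⟩ := H univ
    exact ⟨y, fun i => hy i (mem_univ i), hQ⟩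
  intro s
  induction s using Finset.induction_on with
  | empty => exact ⟨x, by simp, hx, le_rfl⟩
  | insert k s hk ih =>
    obtain ⟨y, hy, hy1, hQ⟩ := ih
    set b : ℝ := (∑ j, A k j * y j) + ∑ i, A i k * y i with hb
    have affine (t : ℝ) : ∑ i, ∑ j, A i j * (Function.update y k t i * Function.update y k t j) =
        (∑ i, ∑ j, A i j * (y i * y j)) + (t - y k) * b := by
      have hu : ∀ i, Function.update y k t i = y i + (t - y k) * (if i = k then 1 else 0) := by
        intro i
        by_cases h : i = k
        · subst h; simp
        · simp [h]
      have e : ∀ i j, A i j * (Function.update y k t i * Function.update y k t j) =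
          A i j * (y i * y j) + (if i = k then (t - y k) * (A i j * y j) else 0)
            + (if j = k then (t - y k) * (A i j * y i) else 0) := by
        intro i j
        rw [hu, hu]
        by_cases h : i = k <;> by_cases h' : j = k
        · subst h; subst h'; simp [hd]
        · simp [h, h']; ring
        · simp [h, h']; ring
        · simp [h, h']
      have e1 : ∑ i, ∑ j, (if i = k then (t - y k) * (A i j * y j) else 0) =
          (t - y k) * ∑ j, A k j * y j := by
        rw [sum_comm]; simp [mul_sum]
      simp only [e, sum_add_distrib]
      rw [e1, hb]
      simp [mul_sum, mul_add, add_assoc]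
    have aux : ∀ t : ℝ, (t = 1 ∨ t = -1) → (t - y k) * b ≤ 0 →
        ∃ y : W → ℝ, (∀ i ∈ insert k s, y i = 1 ∨ y i = -1) ∧ (∀ i, |y i| ≤ 1) ∧
          ∑ i, ∑ j, A i j * (y i * y j) ≤ ∑ i, ∑ j, A i j * (x i * x j) := by
      intro t ht hneg
      refine ⟨Function.update y k t, ?_, ?_, ?_⟩
      · intro i hi
        by_cases h : i = k
        · subst h; simpa using ht
        · simpa [h] using hy i (by simpa [h] using hi)
      · intro i
        by_cases h : i = k
        · subst h; rcases ht with rfl | rfl <;> simp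
        · simpa [h] using hy1 i
      · rw [affine]; linarith
    have := abs_le.1 (hy1 k)
    rcases le_total 0 b with h | h
    · exact aux (-1) (Or.inr rfl) (by nlinarith)
    · exact aux 1 (Or.inl rfl) (by nlinarith)

theorem prod_one_add_odd_even_bound {ι : Type*} (s : Finset ι) (p : ι → ℝ)
    (h : ∑ k ∈ s, |p k| ≤ 1) :
    |(∏ k ∈ s, (1 + p k) - ∏ k ∈ s, (1 - p k)) / 2 - ∑ k ∈ s, p k| ≤ (∑ k ∈ s, |p k|) ^ 3 ∧
    |(∏ k ∈ s, (1 + p k) + ∏ k ∈ s, (1 - p k)) / 2 - 1| ≤ (∑ k ∈ s, |p k|) ^ 2 := by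
  classical
  induction s using Finset.induction_on with
  | empty => simp
  | insert a s ha ih =>
    rw [Finset.sum_insert ha] at h
    obtain ⟨h1, h2⟩ := ih (by linarith [abs_nonneg (p a)])
    rw [Finset.prod_insert ha, Finset.prod_insert ha, Finset.sum_insert ha, Finset.sum_insert ha]
    have hr : 0 ≤ ∑ k ∈ s, |p k| := Finset.sum_nonneg fun _ _ => abs_nonneg _
    have hs : |∑ k ∈ s, p k| ≤ ∑ k ∈ s, |p k| := Finset.abs_sum_le_sum_abs _ _
    have hp := abs_nonneg (p a)
    generalize ∑ k ∈ s, |p k| = r at *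
    generalize ∑ k ∈ s, p k = σ at *
    generalize ∏ k ∈ s, (1 + p k) = P at *
    generalize ∏ k ∈ s, (1 - p k) = N at *
    generalize p a = q at *
    have hO : |(P - N) / 2| ≤ 2 * r := by
      have : |(P - N) / 2| ≤ |(P - N) / 2 - σ| + |σ| := by
        simpa using abs_add_le ((P - N) / 2 - σ) σ
      nlinarith [mul_nonneg hr hr]
    constructor
    · rw [show ((1 + q) * P - (1 - q) * N) / 2 - (q + σ) =
        ((P - N) / 2 - σ) + q * ((P + N) / 2 - 1) by ring]
      refine (abs_add_le _ _).trans ?_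
      rw [abs_mul]
      have := mul_le_mul_of_nonneg_left h2 hp
      nlinarith [mul_nonneg hp (sq_nonneg r), mul_nonneg hr (sq_nonneg |q|),
        mul_nonneg hp (sq_nonneg |q|)]
    · rw [show ((1 + q) * P + (1 - q) * N) / 2 - 1 =
        ((P + N) / 2 - 1) + q * ((P - N) / 2) by ring]
      refine (abs_add_le _ _).trans ?_
      rw [abs_mul]
      have := mul_le_mul_of_nonneg_left hO hp
      nlinarith [sq_nonneg |q|]

open Finset in
/-- Riesz-product rounding: the vectors `v i` are rounded to the bounded random variables
`Im ∏ k, (1 + I * g k * v i k)` with `g` a uniformly random sign vector. -/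
theorem riesz_rounding {W : Type*} [Fintype W] (A : W → W → ℝ) (M : ℝ)
    (hM : ∀ x : W → ℝ, (∀ i, |x i| ≤ 1) → -∑ i, ∑ j, A i j * (x i * x j) ≤ M)
    {ι : Type*} [Fintype ι] (v : W → ι → ℝ) (hv : ∀ i, ∑ k, v i k ^ 2 ≤ 1) :
    -∑ i, ∑ j, A i j * ((∏ k, (1 + v i k * v j k) - ∏ k, (1 - v i k * v j k)) / 2) ≤ 3 * M := by
  classical
  set sg : Bool → ℝ := fun b => if b then 1 else -1 with hsg
  set Y : (ι → Bool) → W → ℂ := fun g i => ∏ k, (1 + Complex.I * ((sg (g k) * v i k : ℝ) : ℂ))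
    with hY
  have sgsq : ∀ b, sg b ^ 2 = 1 := by intro b; cases b <;> simp [hsg]
  have hnorm : ∀ g i, (Y g i).im ^ 2 ≤ 3 := by
    intro g i
    have h1 : Complex.normSq (Y g i) = ∏ k, (1 + v i k ^ 2) := by
      rw [hY]
      simp only [map_prod]
      refine prod_congr rfl fun k _ => ?_
      rw [Complex.normSq_apply]
      simp
      nlinarith [sgsq (g k)]
    have h2 : ∏ k, (1 + v i k ^ 2) ≤ Real.exp (∑ k, v i k ^ 2) := by
      rw [Real.exp_sum]
      refine prod_le_prod (fun _ _ => by positivity) fun k _ => ?_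
      linarith [Real.add_one_le_exp (v i k ^ 2)]
    have h3 : Real.exp (∑ k, v i k ^ 2) ≤ 3 :=
      (Real.exp_le_exp.2 (hv i)).trans (by linarith [Real.exp_one_lt_d9])
    have h4 : (Y g i).im ^ 2 ≤ Complex.normSq (Y g i) := by
      rw [Complex.normSq_apply]; nlinarith [sq_nonneg (Y g i).re]
    linarith
  have hpt : ∀ g : ι → Bool, -∑ i, ∑ j, A i j * ((Y g i).im * (Y g j).im) ≤ 3 * M := by
    intro g
    have h3 : (√3 : ℝ) ^ 2 = 3 := Real.sq_sqrt (by norm_num)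
    have h30 : (0 : ℝ) < √3 := by positivity
    have := hM (fun i => (Y g i).im / √3) (fun i => by
      rw [abs_div, abs_of_pos h30, div_le_one h30]
      exact Real.abs_le_sqrt (hnorm g i))
    have e : ∑ i, ∑ j, A i j * ((Y g i).im / √3 * ((Y g j).im / √3)) =
        (∑ i, ∑ j, A i j * ((Y g i).im * (Y g j).im)) / 3 := by
      simp only [sum_div]
      refine sum_congr rfl fun i _ => sum_congr rfl fun j _ => ?_
      rw [div_mul_div_comm, ← sq, h3]; ring
    rw [e] at this
    linarith
  have hprod : ∀ i j, ∑ g, (Y g i).im * (Y g j).im =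
      2 ^ Fintype.card ι * ((∏ k, (1 + v i k * v j k) - ∏ k, (1 - v i k * v j k)) / 2) := by
    intro i j
    have c1 : ∑ g, Y g i * (starRingEnd ℂ) (Y g j) =
        ((2 ^ Fintype.card ι * ∏ k, (1 + v i k * v j k) : ℝ) : ℂ) := by
      simp only [hY, map_prod, ← prod_mul_distrib]
      rw [← Fintype.prod_sum fun k b => (1 + Complex.I * ((sg b * v i k : ℝ) : ℂ)) *
        (starRingEnd ℂ) (1 + Complex.I * ((sg b * v j k : ℝ) : ℂ))]
      rw [Fintype.card, ← prod_const, ← prod_mul_distrib, Complex.ofReal_prod]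
      refine prod_congr rfl fun k _ => ?_
      simp [hsg, Complex.ext_iff]
      constructor <;> ring
    have c2 : ∑ g, Y g i * Y g j =
        ((2 ^ Fintype.card ι * ∏ k, (1 - v i k * v j k) : ℝ) : ℂ) := by
      simp only [hY, ← prod_mul_distrib]
      rw [← Fintype.prod_sum fun k b => (1 + Complex.I * ((sg b * v i k : ℝ) : ℂ)) *
        (1 + Complex.I * ((sg b * v j k : ℝ) : ℂ))]
      rw [Fintype.card, ← prod_const, ← prod_mul_distrib, Complex.ofReal_prod]
      refine prod_congr rfl fun k _ => ?_
      simp [hsg, Complex.ext_iff]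
      constructor <;> ring
    have c3 : ∀ g, (Y g i).im * (Y g j).im =
        ((Y g i * (starRingEnd ℂ) (Y g j)).re - (Y g i * Y g j).re) / 2 := by
      intro g; simp
    simp only [c3]
    rw [← sum_div, sum_sub_distrib, ← Complex.re_sum, ← Complex.re_sum, c1, c2,
      Complex.ofReal_re, Complex.ofReal_re]
    ring
  have hsum := sum_le_sum fun g (_ : g ∈ (univ : Finset (ι → Bool))) => hpt g
  rw [sum_neg_distrib, sum_comm] at hsum
  have e : ∀ i, ∑ g, ∑ j, A i j * ((Y g i).im * (Y g j).im) = 2 ^ Fintype.card ι *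
      ∑ j, A i j * ((∏ k, (1 + v i k * v j k) - ∏ k, (1 - v i k * v j k)) / 2) := by
    intro i
    rw [sum_comm, mul_sum]
    refine sum_congr rfl fun j _ => ?_
    rw [← mul_sum, hprod]
    ring
  simp only [e, ← mul_sum] at hsum
  simp only [sum_const, card_univ, Fintype.card_fun, Fintype.card_bool, nsmul_eq_mul,
    ← mul_neg] at hsum
  push_cast at hsum
  exact le_of_mul_le_mul_left (hsum.trans_eq (mul_left_comm _ _ _)) (by positivity)

open Finset in
theorem quadratic_form_of_bounded_degree {W : Type*} [Fintype W] (A : W → W → ℝ)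
    (hsymm : ∀ i j, A i j = A j i) (h0 : ∀ i j, 0 ≤ A i j) (h1 : ∀ i j, A i j ≤ 1) (M : ℝ)
    (hM : ∀ x : W → ℝ, (∀ i, |x i| ≤ 1) → -∑ i, ∑ j, A i j * (x i * x j) ≤ M)
    (a D K ε : ℝ) (ha0 : 0 ≤ a) (haD : a ≤ D) (hD : 0 < D) (hK : 1 ≤ K) (hε : 0 < ε) (hε1 : ε < 1)
    (hcard : 0 < Fintype.card W)
    (ha : ∑ i, ∑ j, A i j = a * Fintype.card W) (hdeg : ∀ i, ∑ j, A i j ≤ K * D)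
    (ht : ∑ i, ∑ j, ∑ k, A i j * (A i k * A j k) ≤ D ^ 3)
    (hta : ∑ i, ∑ j, ∑ k, A i j * (A i k * A j k) - a ^ 3 ≤ -(ε * D ^ 3 / 2)) :
    ε ^ 2 / (384 * K ^ 2) * D ^ 2 ≤ M := by
  set s : ℝ := (Fintype.card W : ℝ) with hs
  have hs0 : 0 < s := by rw [hs]; exact_mod_cast hcard
  set t3 := ∑ i, ∑ j, ∑ k, A i j * (A i k * A j k) with ht3
  set deg : W → ℝ := fun i => ∑ j, A i j with hdegdef
  have hdeg' : ∀ j, ∑ i, A i j = deg j := fun j => sum_congr rfl fun i _ => hsymm i j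
  have hsumdeg : ∑ i, deg i = a * s := ha
  set q : ℝ := a / s with hq
  have hq0 : 0 ≤ q := by positivity
  have has : a ≤ s := by
    have : a * s ≤ s * s := by
      rw [← ha]
      refine (sum_le_sum fun i _ => sum_le_sum fun j _ => h1 i j).trans ?_
      simp [hs]
    exact le_of_mul_le_mul_right this hs0
  have hq1 : q ≤ 1 := (div_le_one hs0).2 has
  have hqs : q * s = a := by rw [hq]; field_simp
  -- second moment of the degrees
  have hdsq0 : ∀ i, 0 ≤ deg i := fun i => sum_nonneg fun j _ => h0 i j
  have hdsq : ∑ i, deg i ^ 2 ≤ K * D * (a * s) := by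
    rw [← hsumdeg, mul_sum]
    refine sum_le_sum fun i _ => ?_
    have : deg i ≤ K * D := hdeg i
    nlinarith [hdsq0 i]
  have hdsq2 : a ^ 2 * s ≤ ∑ i, deg i ^ 2 := by
    have : ∑ i, (deg i - a) ^ 2 = ∑ i, deg i ^ 2 - a ^ 2 * s := by
      have : ∀ i, (deg i - a) ^ 2 = deg i ^ 2 - 2 * a * deg i + a ^ 2 := fun i => by ring
      simp only [this, sum_add_distrib, sum_sub_distrib, ← mul_sum, hsumdeg]
      simp [← hs]; ring
    have h := sum_nonneg fun i (_ : i ∈ (univ : Finset W)) => sq_nonneg (deg i - a)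
    linarith
  have expand : ∀ c : ℝ, ∑ i, ∑ j, A i j * ∑ k, (A i k + c) * (A j k + c) =
      t3 + 2 * c * ∑ i, deg i ^ 2 + c ^ 2 * s * (a * s) := by
    intro c
    have e : ∀ i j, A i j * ∑ k, (A i k + c) * (A j k + c) =
        ∑ k, A i j * (A i k * A j k) + c * (A i j * deg i) + c * (A i j * deg j)
          + c ^ 2 * s * A i j := by
      intro i j
      have : ∀ k, (A i k + c) * (A j k + c) = A i k * A j k + c * A i k + c * A j k + c ^ 2 :=
        fun k => by ring
      simp only [this, sum_add_distrib, ← mul_sum]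
      simp [← hs, hdegdef]; ring
    simp only [ht3, e, sum_add_distrib, ← mul_sum]
    have e1 : ∑ i, ∑ j, A i j * deg i = ∑ i, deg i ^ 2 := by
      refine sum_congr rfl fun i _ => ?_
      rw [← sum_mul, sq]
    have e2 : ∑ i, ∑ j, A i j * deg j = ∑ i, deg i ^ 2 := by
      rw [sum_comm]
      refine sum_congr rfl fun i _ => ?_
      rw [← sum_mul, sq, hdeg']
    rw [e1, e2, ha]
    ring
  set N : W → W → ℝ := fun i k => A i k + -q with hN
  have hNabs : ∀ i k, |N i k| ≤ A i k + q := fun i k =>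
    abs_le.2 ⟨by simp only [hN]; linarith [h0 i k], by simp only [hN]; linarith⟩
  have hN1 : ∀ i k, |N i k| ≤ 1 := fun i k =>
    abs_le.2 ⟨by simp only [hN]; linarith [h0 i k], by simp only [hN]; linarith [h1 i k]⟩
  have hrow : ∀ i, ∑ k, |N i k| ≤ 2 * K * D := by
    intro i
    refine (sum_le_sum fun k _ => hNabs i k).trans ?_
    rw [sum_add_distrib]
    have : ∑ _k : W, q = a := by simp [← hs, ← hqs, mul_comm]
    rw [this]
    nlinarith [hdeg i]
  set r : W → W → ℝ := fun i j => ∑ k, |N i k * N j k| with hr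
  have hr0 : ∀ i j, 0 ≤ r i j := fun i j => sum_nonneg fun k _ => abs_nonneg _
  have hr1 : ∀ i j, r i j ≤ 2 * K * D := fun i j => by
    refine (sum_le_sum fun k _ => ?_).trans (hrow i)
    rw [abs_mul]
    nlinarith [hN1 j k, abs_nonneg (N i k)]
  have hAr : ∑ i, ∑ j, A i j * r i j ≤ 4 * K * D ^ 3 := by
    have hle : ∑ i, ∑ j, A i j * r i j ≤ ∑ i, ∑ j, A i j * ∑ k, (A i k + q) * (A j k + q) := by
      refine sum_le_sum fun i _ => sum_le_sum fun j _ =>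
        mul_le_mul_of_nonneg_left (sum_le_sum fun k _ => ?_) (h0 i j)
      rw [abs_mul]
      exact mul_le_mul (hNabs i k) (hNabs j k) (abs_nonneg _) (add_nonneg (h0 i k) hq0)
    rw [expand] at hle
    have e1 : 2 * q * ∑ i, deg i ^ 2 ≤ 2 * K * D ^ 3 := by
      have : 2 * q * ∑ i, deg i ^ 2 ≤ 2 * q * (K * D * (a * s)) :=
        mul_le_mul_of_nonneg_left hdsq (by positivity)
      have e : 2 * q * (K * D * (a * s)) = 2 * K * D * a ^ 2 := by
        rw [← hqs]; ring
      have : a ^ 2 ≤ D ^ 2 := by gcongr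
      have : 2 * K * D * a ^ 2 ≤ 2 * K * D * D ^ 2 := by gcongr
      linarith [this, (by ring : 2 * K * D * D ^ 2 = 2 * K * D ^ 3)]
    have e2 : q ^ 2 * s * (a * s) ≤ D ^ 3 := by
      have : q ^ 2 * s * (a * s) = a ^ 3 := by rw [← hqs]; ring
      rw [this]; gcongr
    have : D ^ 3 ≤ K * D ^ 3 := by nlinarith [pow_pos hD 3]
    linarith
  have hAq : ∑ i, ∑ j, A i j * ∑ k, N i k * N j k ≤ -(ε * D ^ 3 / 2) := by
    have e := expand (-q)
    have e2 : (-q) ^ 2 * s * (a * s) = a ^ 3 := by rw [← hqs]; ring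
    have e3 : 2 * q * (a ^ 2 * s) ≤ 2 * q * ∑ i, deg i ^ 2 :=
      mul_le_mul_of_nonneg_left hdsq2 (by positivity)
    have e4 : 2 * q * (a ^ 2 * s) = 2 * a ^ 3 := by rw [← hqs]; ring
    rw [e2] at e
    simp only [hN]
    rw [e]
    linarith
  -- rounding of the scaled rows of `N`
  set b : ℝ := ε / (32 * K ^ 2 * D) with hb
  have hK0 : 0 < K := by linarith
  have hb0 : 0 < b := by positivity
  have hbD : b * (2 * K * D) ≤ 1 := by
    have : b * (2 * K * D) = ε / (16 * K) := by rw [hb]; field_simp; norm_num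
    rw [this, div_le_one (by positivity)]
    linarith
  have hsb : √b * √b = b := Real.mul_self_sqrt hb0.le
  have key := riesz_rounding A M hM (fun i k => √b * N i k) (fun i => by
    have : ∀ k, (√b * N i k) ^ 2 = b * N i k ^ 2 := fun k => by rw [mul_pow, sq, hsb]
    simp only [this, ← mul_sum]
    refine le_trans ?_ hbD
    gcongr
    refine (sum_le_sum fun k _ => ?_).trans (hrow i)
    rw [← sq_abs]
    nlinarith [hN1 i k, abs_nonneg (N i k)])
  have hprod : ∀ i j k, √b * N i k * (√b * N j k) = b * (N i k * N j k) := by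
    intro i j k; rw [mul_mul_mul_comm, hsb]
  simp only [hprod] at key
  have herr : ∀ i j, A i j * ((∏ k, (1 + b * (N i k * N j k)) - ∏ k, (1 - b * (N i k * N j k))) / 2)
      ≤ b * (A i j * ∑ k, N i k * N j k) + b ^ 3 * (2 * K * D) ^ 2 * (A i j * r i j) := by
    intro i j
    have er : ∑ k, |b * (N i k * N j k)| = b * r i j := by
      rw [hr]; simp only [abs_mul b, abs_of_pos hb0, ← mul_sum]
    have hbr : ∑ k, |b * (N i k * N j k)| ≤ 1 := by
      rw [er]
      exact (mul_le_mul_of_nonneg_left (hr1 i j) hb0.le).trans hbD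
    have h := (prod_one_add_odd_even_bound univ (fun k => b * (N i k * N j k)) hbr).1
    rw [er, ← mul_sum] at h
    have h := (abs_le.1 h).2
    have hcube : (b * r i j) ^ 3 ≤ b ^ 3 * (2 * K * D) ^ 2 * r i j := by
      have : r i j ^ 2 ≤ (2 * K * D) ^ 2 := pow_le_pow_left₀ (hr0 i j) (hr1 i j) 2
      have : b ^ 3 * (r i j ^ 2) * r i j ≤ b ^ 3 * (2 * K * D) ^ 2 * r i j := by
        have := hr0 i j
        gcongr
      linarith [(by ring : (b * r i j) ^ 3 = b ^ 3 * (r i j ^ 2) * r i j)]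
    have : A i j * ((∏ k, (1 + b * (N i k * N j k)) - ∏ k, (1 - b * (N i k * N j k))) / 2) ≤
        A i j * (b * ∑ k, N i k * N j k + b ^ 3 * (2 * K * D) ^ 2 * r i j) :=
      mul_le_mul_of_nonneg_left (by linarith) (h0 i j)
    linarith
  have hfin := sum_le_sum fun i (_ : i ∈ (univ : Finset W)) =>
    sum_le_sum fun j (_ : j ∈ (univ : Finset W)) => herr i j
  simp only [sum_add_distrib, ← mul_sum] at hfin
  have f1 := mul_le_mul_of_nonneg_left hAq hb0.le
  have f2 := mul_le_mul_of_nonneg_left hAr (by positivity : 0 ≤ b ^ 3 * (2 * K * D) ^ 2)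
  have f3 : b ^ 3 * (2 * K * D) ^ 2 * (4 * K * D ^ 3) ≤ b * (ε * D ^ 3 / 4) := by
    have : b ^ 3 * (2 * K * D) ^ 2 * (4 * K * D ^ 3) = b * D ^ 3 * (ε ^ 2 / (64 * K)) := by
      have : b ^ 2 * (2 * K * D) ^ 2 * (4 * K) = ε ^ 2 / (64 * K) := by
        rw [hb]; field_simp; norm_num
      rw [← this]; ring
    rw [this]
    have : ε ^ 2 / (64 * K) ≤ ε / 4 := by
      rw [div_le_div_iff₀ (by positivity) (by norm_num)]
      nlinarith
    calc b * D ^ 3 * (ε ^ 2 / (64 * K)) ≤ b * D ^ 3 * (ε / 4) := by gcongr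
      _ = _ := by ring
  have f4 : b * (ε * D ^ 3 / 4) = 3 * (ε ^ 2 / (384 * K ^ 2) * D ^ 2) := by
    rw [hb]; field_simp; norm_num
  linarith

open Finset in
theorem exists_densest_subset {V : Type*} [Fintype V] [Nonempty V] (A : V → V → ℝ) :
    ∃ U : Finset V, U.Nonempty ∧ ∃ D : ℝ, ∑ i ∈ U, ∑ j ∈ U, A i j = D * #U ∧
      ∀ X : Finset V, ∑ i ∈ X, ∑ j ∈ X, A i j ≤ D * #X := by
  classical
  obtain ⟨U, hU, hmax⟩ := exists_max_image (univ.filter fun X : Finset V => X.Nonempty)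
    (fun X => (∑ i ∈ X, ∑ j ∈ X, A i j) / #X) ⟨univ, by simp⟩
  have hU : U.Nonempty := (mem_filter.1 hU).2
  have pos : ∀ {X : Finset V}, X.Nonempty → (0 : ℝ) < #X := fun h => by exact_mod_cast h.card_pos
  refine ⟨U, hU, _, (div_mul_cancel₀ _ (pos hU).ne').symm, fun X => ?_⟩
  rcases X.eq_empty_or_nonempty with rfl | hX
  · simp
  · exact (div_le_iff₀ (pos hX)).1 (hmax X (by simpa using hX))

open Finset in
theorem sum_triple_subtype_le {V : Type*} [Fintype V] (S : Finset V) (f : V → V → V → ℝ)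
    (hf : ∀ i j k, 0 ≤ f i j k) :
    ∑ i : S, ∑ j : S, ∑ k : S, f i j k ≤ ∑ i, ∑ j, ∑ k, f i j k := by
  have sub (g : V → ℝ) (hg : ∀ i, 0 ≤ g i) : ∑ i : S, g i ≤ ∑ i, g i := by
    rw [sum_coe_sort S g]
    exact sum_le_sum_of_subset_of_nonneg (subset_univ _) fun i _ _ => hg i
  calc ∑ i : S, ∑ j : S, ∑ k : S, f i j k
      ≤ ∑ i : S, ∑ j : S, ∑ k, f i j k :=
        sum_le_sum fun i _ => sum_le_sum fun j _ => sub (f i j) fun k => hf i j k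
    _ ≤ ∑ i : S, ∑ j, ∑ k, f i j k :=
        sum_le_sum fun i _ => sub (fun j => ∑ k, f i j k) fun j => sum_nonneg fun k _ => hf i j k
    _ ≤ ∑ i, ∑ j, ∑ k, f i j k :=
        sub (fun i => ∑ j, ∑ k, f i j k) fun i =>
          sum_nonneg fun j _ => sum_nonneg fun k _ => hf i j k

open Finset in
theorem quadratic_form_subtype {V : Type*} [Fintype V] (A : V → V → ℝ) (M : ℝ)
    (hM : ∀ x : V → ℝ, (∀ i, |x i| ≤ 1) → -∑ i, ∑ j, A i j * (x i * x j) ≤ M)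
    (S : Finset V) (x : S → ℝ) (hx : ∀ i, |x i| ≤ 1) :
    -∑ i : S, ∑ j : S, A i j * (x i * x j) ≤ M := by
  classical
  set y : V → ℝ := fun i => if h : i ∈ S then x ⟨i, h⟩ else 0 with hy
  have hyx : ∀ i : S, y i = x i := fun i => by simp [hy]
  have hy0 : ∀ i, i ∉ S → y i = 0 := fun i hi => by simp [hy, hi]
  have h := hM y (fun i => by
    by_cases hi : i ∈ S
    · simpa [hy, hi] using hx ⟨i, hi⟩
    · simp [hy, hi])
  have ext (f : V → ℝ) (hf : ∀ i, i ∉ S → f i = 0) : ∑ i, f i = ∑ i : S, f i := by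
    rw [sum_coe_sort S f]
    exact (sum_subset (subset_univ S) fun i _ hi => hf i hi).symm
  rw [ext _ fun i hi => by simp [hy0 i hi]] at h
  have e1 (i : S) : ∑ j, A i j * (y i * y j) = ∑ j : S, A i j * (x i * x j) := by
    rw [ext _ fun j hj => by simp [hy0 j hj]]
    simp only [hyx]
  simpa only [e1] using h

theorem cube_mul_le_of_mul_le {a D δ : ℝ} (hD : 0 ≤ D) (hδ1 : 3 * δ ≤ 1)
    (h : D * (1 - 3 * δ) ≤ a) : D ^ 3 * (1 - 9 * δ) ≤ a ^ 3 := by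
  have h1 : (1 - 9 * δ) ≤ (1 - 3 * δ) ^ 3 := by
    nlinarith [mul_nonneg (sq_nonneg δ) (by linarith : 0 ≤ 1 - δ)]
  have h2 : (D * (1 - 3 * δ)) ^ 3 ≤ a ^ 3 :=
    pow_le_pow_left₀ (mul_nonneg hD (by linarith)) h 3
  rw [mul_pow] at h2
  exact (mul_le_mul_of_nonneg_left h1 (by positivity)).trans h2

open Finset in
theorem quadratic_form_of_few_triangles {V : Type*} [Fintype V] [Nonempty V] (A : V → V → ℝ)
    (hsymm : ∀ i j, A i j = A j i) (h0 : ∀ i j, 0 ≤ A i j) (h1 : ∀ i j, A i j ≤ 1) (M : ℝ)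
    (hM : ∀ x : V → ℝ, (∀ i, |x i| ≤ 1) → -∑ i, ∑ j, A i j * (x i * x j) ≤ M)
    (d ε : ℝ) (hd : 0 < d) (hε : 0 < ε) (hε1 : ε < 1)
    (hdA : ∑ i, ∑ j, A i j = d * Fintype.card V)
    (ht : ∑ i, ∑ j, ∑ k, A i j * (A i k * A j k) ≤ (1 - ε) * d ^ 3) :
    ε ^ 2 / (384 * (2 / (ε / 18) ^ 2) ^ 2) * d ^ 2 ≤ M := by
  classical
  set δ : ℝ := ε / 18 with hδ
  set K : ℝ := 2 / δ ^ 2 with hK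
  have hδ0 : 0 < δ := by positivity
  have hδ1 : δ < 1 / 18 := by rw [hδ]; linarith
  have hKδ : K * δ ^ 2 = 2 := by rw [hK]; field_simp
  have hK1 : 1 ≤ K := by
    rw [hK, le_div_iff₀ (by positivity)]; nlinarith
  have hK0 : 0 < K := by linarith
  obtain ⟨U, hU, D, hUD, hmax⟩ := exists_densest_subset A
  have hu : (0 : ℝ) < #U := by exact_mod_cast hU.card_pos
  have hdD : d ≤ D := by
    have h := hmax univ
    rw [hdA, card_univ] at h
    exact le_of_mul_le_mul_right h (by exact_mod_cast Fintype.card_pos)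
  have hD : 0 < D := hd.trans_le hdD
  have hDu : D ≤ #U := by
    have : D * #U ≤ #U * #U := by
      rw [← hUD]
      refine (sum_le_sum fun i _ => sum_le_sum fun j _ => h1 i j).trans ?_
      simp
    exact le_of_mul_le_mul_right this hu
  set B := U.filter fun i => K * D < ∑ j ∈ U, A i j with hB
  set S := U.filter fun i => ¬ K * D < ∑ j ∈ U, A i j with hS
  have hBcard : (#B : ℝ) * K ≤ #U := by
    have a1 : ∑ i ∈ B, K * D ≤ ∑ i ∈ B, ∑ j ∈ U, A i j :=
      sum_le_sum fun i hi => (mem_filter.1 hi).2.le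
    have a2 : ∑ i ∈ B, ∑ j ∈ U, A i j ≤ ∑ i ∈ U, ∑ j ∈ U, A i j :=
      sum_le_sum_of_subset_of_nonneg (filter_subset _ _)
        fun i _ _ => sum_nonneg fun j _ => h0 i j
    rw [hUD] at a2
    simp only [sum_const, nsmul_eq_mul] at a1
    have : D * (#B * K) ≤ D * #U := by linarith
    exact le_of_mul_le_mul_left this hD
  set e : Finset V → Finset V → ℝ := fun X Y => ∑ i ∈ X, ∑ j ∈ Y, A i j with he
  have hsplit (Y : Finset V) : e U Y = e B Y + e S Y :=
    (sum_filter_add_sum_filter_not U _ _).symm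
  have hcomm (X Y : Finset V) : e X Y = e Y X := by
    simp only [he]
    rw [sum_comm]
    exact sum_congr rfl fun i _ => sum_congr rfl fun j _ => hsymm _ _
  have htot : e B B + 2 * e B S + e S S = D * #U := by
    rw [← hUD]
    change _ = e U U
    rw [hsplit, hcomm B U, hcomm S U, hsplit, hsplit, hcomm S B]; ring
  have hBB : e B B * K ≤ D * #U := by
    have : e B B * K ≤ D * #B * K := mul_le_mul_of_nonneg_right (hmax B) hK0.le
    nlinarith
  have hBB' : e B B ≤ D * #U * (δ ^ 2 / 2) := by
    have : e B B * K * (δ ^ 2 / 2) ≤ D * #U * (δ ^ 2 / 2) := by gcongr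
    have e1 : e B B * K * (δ ^ 2 / 2) = e B B := by
      rw [mul_assoc, ← mul_div_assoc, hKδ]; norm_num
    linarith
  have hind : ∀ X Y : Finset V, ∑ i, ∑ j, A i j *
      ((if i ∈ X then (1 : ℝ) else 0) * (if j ∈ Y then (1 : ℝ) else 0)) = e X Y := by
    intro X Y
    simp [he, sum_ite_irrel, sum_ite_mem]
  rcases le_or_gt (δ * D * #U) (e B S) with hbig | hsmall
  · have h := hM (fun i => (if i ∈ B then (1 : ℝ) else 0) - δ * (if i ∈ S then (1 : ℝ) else 0))
      (fun i => by
        rw [abs_le]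
        have hBS : i ∈ B → i ∉ S := fun h h' => (mem_filter.1 h').2 (mem_filter.1 h).2
        by_cases hi : i ∈ B
        · simp [hi, hBS hi]
        · by_cases hi' : i ∈ S <;> simp [hi, hi']
          constructor <;> linarith)
    have ex : ∀ i j, A i j * (((if i ∈ B then (1 : ℝ) else 0) - δ * (if i ∈ S then (1 : ℝ) else 0))
        * ((if j ∈ B then (1 : ℝ) else 0) - δ * (if j ∈ S then (1 : ℝ) else 0))) =
        A i j * ((if i ∈ B then (1 : ℝ) else 0) * (if j ∈ B then (1 : ℝ) else 0))
        - δ * (A i j * ((if i ∈ B then (1 : ℝ) else 0) * (if j ∈ S then (1 : ℝ) else 0)))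
        - δ * (A i j * ((if i ∈ S then (1 : ℝ) else 0) * (if j ∈ B then (1 : ℝ) else 0)))
        + δ ^ 2 * (A i j * ((if i ∈ S then (1 : ℝ) else 0) * (if j ∈ S then (1 : ℝ) else 0))) :=
      fun i j => by ring
    simp only [ex, sum_add_distrib, sum_sub_distrib, ← mul_sum, hind] at h
    rw [hcomm S B] at h
    have hSS : e S S ≤ D * #U := by
      refine (hmax S).trans ?_
      have : (#S : ℝ) ≤ #U := by exact_mod_cast card_le_card (filter_subset _ _)
      gcongr
    have g1 : δ * (δ * D * #U) ≤ δ * e B S := by gcongr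
    have g2 : δ ^ 2 * e S S ≤ δ ^ 2 * (D * #U) := by gcongr
    have g3 : d ^ 2 ≤ D * #U := by
      rw [sq]; exact mul_le_mul hdD (hdD.trans hDu) hd.le hD.le
    have g4 : δ ^ 2 / 2 * d ^ 2 ≤ δ ^ 2 / 2 * (D * #U) := by gcongr
    have g5 : ε ^ 2 / (384 * K ^ 2) * d ^ 2 ≤ δ ^ 2 / 2 * d ^ 2 := by
      refine mul_le_mul_of_nonneg_right ?_ (sq_nonneg d)
      rw [div_le_div_iff₀ (by positivity) (by norm_num)]
      have : ε ^ 2 = 324 * δ ^ 2 := by rw [hδ]; ring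
      have : δ ^ 2 * 384 ≤ δ ^ 2 * (384 * K ^ 2) := by
        gcongr; nlinarith
      have : 0 ≤ δ ^ 2 * K ^ 2 := by positivity
      have : δ ^ 2 ≤ δ ^ 2 * K ^ 2 := by linarith
      nlinarith
    linarith
  · have hSlow : D * #U * (1 - 3 * δ) ≤ e S S := by
      have : D * #U * (δ ^ 2 / 2) ≤ D * #U * δ := by
        gcongr; nlinarith
      linarith
    have hDU : 0 < D * #U := by positivity
    have hSpos : 0 < e S S := lt_of_lt_of_le (mul_pos hDU (by linarith)) hSlow
    have hSne : S.Nonempty := by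
      by_contra h
      rw [not_nonempty_iff_eq_empty] at h
      simp [he, h] at hSpos
    have hScard : (0 : ℝ) < #S := by exact_mod_cast hSne.card_pos
    have hSU : (#S : ℝ) ≤ #U := by exact_mod_cast card_le_card (filter_subset _ _)
    set a : ℝ := e S S / #S with ha
    have haS : a * #S = e S S := div_mul_cancel₀ _ hScard.ne'
    have ha0 : 0 < a := by positivity
    have haD : a ≤ D := (div_le_iff₀ hScard).2 (hmax S)
    have haD' : D * (1 - 3 * δ) ≤ a := by
      have : D * (1 - 3 * δ) * #U ≤ a * #U := by
        calc D * (1 - 3 * δ) * #U = D * #U * (1 - 3 * δ) := by ring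
          _ ≤ e S S := hSlow
          _ = a * #S := haS.symm
          _ ≤ a * #U := by gcongr
      exact le_of_mul_le_mul_right this hu
    have htri : ∑ i : S, ∑ j : S, ∑ k : S, A i j * (A i k * A j k) ≤ (1 - ε) * D ^ 3 := by
      have t1 := sum_triple_subtype_le S (fun i j k => A i j * (A i k * A j k))
        fun i j k => mul_nonneg (h0 _ _) (mul_nonneg (h0 _ _) (h0 _ _))
      have t2 : (1 - ε) * d ^ 3 ≤ (1 - ε) * D ^ 3 :=
        mul_le_mul_of_nonneg_left (by gcongr) (by linarith)
      exact (t1.trans ht).trans t2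
    have hgap : (1 - ε) * D ^ 3 - a ^ 3 ≤ -(ε * D ^ 3 / 2) := by
      have := cube_mul_le_of_mul_le hD.le (by linarith) haD'
      have e1 : D ^ 3 * (1 - 9 * δ) = D ^ 3 - ε * D ^ 3 / 2 := by rw [hδ]; ring
      linarith
    have hεD : 0 < ε * D ^ 3 := by positivity
    have hmain := quadratic_form_of_bounded_degree (fun i j : S => A i j) (fun i j => hsymm i j)
      (fun i j => h0 i j) (fun i j => h1 i j) M (quadratic_form_subtype A M hM S)
      a D K ε ha0.le haD hD hK1 hε hε1
      (by simpa using hSne.card_pos)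
      (by
        rw [Fintype.card_coe, haS, sum_coe_sort S fun i => ∑ j : S, A i j]
        exact sum_congr rfl fun i _ => sum_coe_sort S fun j => A i j)
      (fun i => by
        rw [sum_coe_sort S fun j => A i j]
        refine le_trans (sum_le_sum_of_subset_of_nonneg (filter_subset _ _)
          fun j _ _ => h0 i j) (not_lt.1 (mem_filter.1 i.2).2))
      (by linarith) (by linarith)
    exact (mul_le_mul_of_nonneg_left (pow_le_pow_left₀ hd.le hdD 2) (by positivity)).trans hmain

section SimpleGraph

variable [Fintype V] (G : SimpleGraph V) [DecidableRel G.Adj]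

theorem sum_adj_eq_two_mul_edgeCount :
    ∑ i, ∑ j, (if G.Adj i j then (1 : ℝ) else 0) = 2 * edgeCount G := by
  classical
  have h := G.sum_degrees_eq_twice_card_edges
  have e : edgeCount G = G.edgeFinset.card := by
    rw [edgeCount, Nat.card_eq_fintype_card, SimpleGraph.edgeFinset_card]
  rw [e]
  have hd : ∀ i, ∑ j, (if G.Adj i j then (1 : ℝ) else 0) = G.degree i := by
    intro i
    rw [Finset.sum_boole, ← SimpleGraph.card_neighborFinset_eq_degree,
      SimpleGraph.neighborFinset_eq_filter]
  simp only [hd]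
  exact_mod_cast h

theorem neg_quadratic_form_le_surplus (x : V → ℝ) (hx : ∀ i, |x i| ≤ 1) :
    -∑ i, ∑ j, (if G.Adj i j then (1 : ℝ) else 0) * (x i * x j) ≤ 4 * surplus G := by
  classical
  obtain ⟨y, hy, hyx⟩ := exists_sign_le (fun i j => if G.Adj i j then (1 : ℝ) else 0)
    (fun i => by simp) x hx
  set S : Finset V := Finset.univ.filter fun i => y i = 1 with hS
  have hcut : (cutSize G S : ℝ) =
      ∑ i, ∑ j, if i ∈ S ∧ j ∉ S ∧ G.Adj i j then (1 : ℝ) else 0 := by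
    rw [cutSize, Nat.card_eq_fintype_card, Fintype.card_subtype, ← Fintype.sum_prod_type',
      Finset.sum_boole]
  have hmax : (cutSize G S : ℝ) ≤ maxCut G := by
    exact_mod_cast Finset.le_sup (f := cutSize G) (by simp)
  have hcut' : (cutSize G S : ℝ) =
      ∑ i, ∑ j, if j ∈ S ∧ i ∉ S ∧ G.Adj i j then (1 : ℝ) else 0 := by
    rw [hcut, Finset.sum_comm]
    simp only [G.adj_comm]
  have hterm : ∀ i j, -((if G.Adj i j then (1 : ℝ) else 0) * (y i * y j)) =
      2 * (if i ∈ S ∧ j ∉ S ∧ G.Adj i j then (1 : ℝ) else 0) +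
      2 * (if j ∈ S ∧ i ∉ S ∧ G.Adj i j then (1 : ℝ) else 0) -
      (if G.Adj i j then (1 : ℝ) else 0) := by
    intro i j
    have h1 : ¬ (-1 : ℝ) = 1 := by norm_num
    by_cases h : G.Adj i j <;> rcases hy i with hi | hi <;> rcases hy j with hj | hj <;>
      simp [hS, h, hi, hj, h1] <;> norm_num
  have hsum : -∑ i, ∑ j, (if G.Adj i j then (1 : ℝ) else 0) * (y i * y j) =
      4 * cutSize G S - 2 * edgeCount G := by
    rw [← sum_adj_eq_two_mul_edgeCount]
    simp only [← Finset.sum_neg_distrib, hterm, Finset.sum_sub_distrib, Finset.sum_add_distrib,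
      ← Finset.mul_sum]
    rw [← hcut, ← hcut']
    ring
  rw [surplus]
  linarith

theorem sum_adj_triple_le :
    ∑ i, ∑ j, ∑ k, (if G.Adj i j then (1 : ℝ) else 0) *
      ((if G.Adj i k then (1 : ℝ) else 0) * (if G.Adj j k then (1 : ℝ) else 0)) ≤
      6 * cliqueCount G 3 := by
  classical
  set T : Finset (V × V × V) := Finset.univ.filter fun p =>
    G.Adj p.1 p.2.1 ∧ G.Adj p.1 p.2.2 ∧ G.Adj p.2.1 p.2.2 with hT
  have e : ∑ i, ∑ j, ∑ k, (if G.Adj i j then (1 : ℝ) else 0) *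
      ((if G.Adj i k then (1 : ℝ) else 0) * (if G.Adj j k then (1 : ℝ) else 0)) = T.card := by
    rw [hT, ← Finset.sum_boole, Fintype.sum_prod_type]
    refine Finset.sum_congr rfl fun i _ => ?_
    rw [Fintype.sum_prod_type]
    refine Finset.sum_congr rfl fun j _ => Finset.sum_congr rfl fun k _ => ?_
    by_cases h1 : G.Adj i j <;> by_cases h2 : G.Adj i k <;> by_cases h3 : G.Adj j k <;>
      simp [h1, h2, h3]
  have hc : cliqueCount G 3 = (G.cliqueFinset 3).card := by
    rw [cliqueCount, Nat.card_eq_fintype_card, Fintype.card_subtype]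
    rfl
  rw [e, hc]
  suffices T.card ≤ 6 * (G.cliqueFinset 3).card by exact_mod_cast this
  refine Finset.card_le_mul_card_image_of_maps_to
    (f := fun p : V × V × V => ({p.1, p.2.1, p.2.2} : Finset V)) (fun p hp => ?_) 6 fun s hs => ?_
  · rw [SimpleGraph.mem_cliqueFinset_iff, SimpleGraph.is3Clique_triple_iff]
    simpa [hT] using hp
  · obtain ⟨a, b, c, -, -, -, rfl⟩ :=
      SimpleGraph.is3Clique_iff.1 (SimpleGraph.mem_cliqueFinset_iff.1 hs)
    refine (Finset.card_le_card ?_).trans (Finset.card_le_six (a := (a, b, c)) (b := (a, c, b))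
      (c := (b, a, c)) (d := (b, c, a)) (e := (c, a, b)) (f := (c, b, a)))
    rintro ⟨i, j, k⟩ hp
    simp only [hT, Finset.mem_filter, Finset.mem_univ, true_and] at hp
    obtain ⟨⟨h1, h2, h3⟩, hp⟩ := hp
    have hi : i ∈ ({a, b, c} : Finset V) := by rw [← hp]; simp
    have hj : j ∈ ({a, b, c} : Finset V) := by rw [← hp]; simp
    have hk : k ∈ ({a, b, c} : Finset V) := by rw [← hp]; simp
    simp only [Finset.mem_insert, Finset.mem_singleton, Prod.mk.injEq] at hi hj hk ⊢
    have := h1.ne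
    have := h2.ne
    have := h3.ne
    clear hp hs hT e
    grind

end SimpleGraph

/-- For every `ε > 0` there is `c = c(ε) > 0` such that: if `G` has `n ≥ 1` vertices,
average degree `d = 2e(G)/n`, and fewer than `(1-ε)d³/6` triangles, then
`sp(G) ≥ c·d²`. -/
theorem statement1 (ε : ℝ) (hε : 0 < ε) :
    ∃ c : ℝ, 0 < c ∧
      ∀ (V : Type) [Fintype V] (G : SimpleGraph V) (d : ℝ),
        1 ≤ Fintype.card V →
        d = 2 * edgeCount G / Fintype.card V →
        (cliqueCount G 3 : ℝ) < (1 - ε) * d ^ 3 / 6 →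
        surplus G ≥ c * d ^ 2 := by
  classical
  refine ⟨ε ^ 2 / (384 * (2 / (ε / 18) ^ 2) ^ 2) / 4, by positivity, ?_⟩
  intro V _ G d hn hd hT
  have : Nonempty V := Fintype.card_pos_iff.1 hn
  have hn' : (0 : ℝ) < Fintype.card V := by exact_mod_cast hn
  have hd0 : 0 ≤ d := by rw [hd]; positivity
  have hpos : 0 < (1 - ε) * d ^ 3 := by
    have : (0 : ℝ) ≤ cliqueCount G 3 := Nat.cast_nonneg _
    linarith
  have hε1 : ε < 1 := by
    by_contra h
    nlinarith [pow_nonneg hd0 3]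
  have hdpos : 0 < d := by
    refine lt_of_le_of_ne hd0 fun h => ?_
    rw [← h] at hpos
    simp at hpos
  have key := quadratic_form_of_few_triangles (fun i j => if G.Adj i j then (1 : ℝ) else 0)
    (fun i j => by simp only [G.adj_comm]) (fun i j => by split_ifs <;> norm_num)
    (fun i j => by split_ifs <;> norm_num) (4 * surplus G)
    (neg_quadratic_form_le_surplus G) d ε hdpos hε hε1
    (by rw [sum_adj_eq_two_mul_edgeCount, hd, div_mul_cancel₀ _ hn'.ne'])
    ((sum_adj_triple_le G).trans (by linarith))
  linarith

end MaxCutPaper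
end

section
/- There exists an absolute constant c > 0 such that the following holds. Let G be a d-regular finite simple graph with n vertices, with d ≤ n/2, and suppose G has exactly d³/6 + s triangles (s a real number). Then: (i) if s < −n·d^(3/2), the surplus of G is at least c·|s|/d; (ii) if −n·d^(3/2) ≤ s ≤ n·d^(3/2), the surplus of G is at least c·n·d^(1/2); (iii) if s > n·d^(3/2), the surplus of G is at least c·n²·d²/s. -/
namespace MaxCutPaper

variable {V : Type*}

open Finset Matrix

theorem card_ordered_triangles [Fintype V] [DecidableEq V] (G : SimpleGraph V)
    [DecidableRel G.Adj] :
    #{p : V × V × V | G.Adj p.1 p.2.1 ∧ G.Adj p.2.1 p.2.2 ∧ G.Adj p.2.2 p.1} =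
      6 * cliqueCount G 3 := by
  have hc : cliqueCount G 3 = #(G.cliqueFinset 3) := by
    rw [cliqueCount, Nat.card_eq_fintype_card, Fintype.card_subtype]
    rfl
  rw [hc, mul_comm, ← smul_eq_mul, ← Finset.sum_const,
    card_eq_sum_card_fiberwise (f := fun p : V × V × V => ({p.1, p.2.1, p.2.2} : Finset V))
      (t := G.cliqueFinset 3)]
  · refine Finset.sum_congr rfl fun s hs => ?_
    rw [SimpleGraph.mem_cliqueFinset_iff, SimpleGraph.is3Clique_iff] at hs
    obtain ⟨a, b, c, hab, hac, hbc, rfl⟩ := hs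
    have hab' := hab.ne
    have hac' := hac.ne
    have hbc' := hbc.ne
    have : ({p ∈ ({p : V × V × V | G.Adj p.1 p.2.1 ∧ G.Adj p.2.1 p.2.2 ∧ G.Adj p.2.2 p.1} :
        Finset (V × V × V)) | ({p.1, p.2.1, p.2.2} : Finset V) = {a, b, c}}) =
        {(a, b, c), (a, c, b), (b, a, c), (b, c, a), (c, a, b), (c, b, a)} := by
      ext ⟨x, y, z⟩
      simp only [mem_filter, mem_univ, true_and, mem_insert, mem_singleton, Prod.mk.injEq]
      constructor
      · rintro ⟨⟨hxy, hyz, hzx⟩, h⟩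
        have hx : x ∈ ({a, b, c} : Finset V) := h ▸ by simp
        have hy : y ∈ ({a, b, c} : Finset V) := h ▸ by simp
        have hz : z ∈ ({a, b, c} : Finset V) := h ▸ by simp
        simp only [mem_insert, mem_singleton] at hx hy hz
        have := hxy.ne
        have := hyz.ne
        have := hzx.ne
        clear h
        grind
      · rintro (⟨rfl, rfl, rfl⟩ | ⟨rfl, rfl, rfl⟩ | ⟨rfl, rfl, rfl⟩ | ⟨rfl, rfl, rfl⟩ |
          ⟨rfl, rfl, rfl⟩ | ⟨rfl, rfl, rfl⟩) <;>
        simp only [hab, hac, hbc, hab.symm, hac.symm, hbc.symm, and_self, true_and] <;>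
        (ext w; simp only [mem_insert, mem_singleton]; tauto)
    rw [this]
    have := hab'.symm
    have := hac'.symm
    have := hbc'.symm
    simp [card_insert_of_notMem, *]
  · rintro ⟨x, y, z⟩ h
    simp only [coe_filter, mem_univ, true_and, Set.mem_ofPred_eq] at h
    simp [SimpleGraph.is3Clique_triple_iff, h.1, h.2.1, h.2.2.symm]

theorem trace_adjMatrix_cube [Fintype V] [DecidableEq V] (G : SimpleGraph V)
    [DecidableRel G.Adj] :
    trace (G.adjMatrix ℝ * G.adjMatrix ℝ * G.adjMatrix ℝ) = 6 * (cliqueCount G 3 : ℝ) := by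
  have h := congrArg (Nat.cast : ℕ → ℝ) (card_ordered_triangles G)
  push_cast at h
  rw [← h, card_filter, Fintype.sum_prod_type]
  simp only [Matrix.trace, Matrix.diag, Matrix.mul_apply, Fintype.sum_prod_type,
    SimpleGraph.adjMatrix_apply]
  push_cast
  refine Finset.sum_congr rfl fun a _ => ?_
  simp only [Finset.sum_mul]
  rw [Finset.sum_comm]
  refine Finset.sum_congr rfl fun b _ => Finset.sum_congr rfl fun c _ => ?_
  by_cases h1 : G.Adj a b <;> by_cases h2 : G.Adj b c <;> by_cases h3 : G.Adj c a <;>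
    simp [h1, h2, h3]

/-- Every `±1`-weighting of the vertices gives a lower bound for the surplus. -/
theorem surplus_ge_of_sign [Fintype V] [DecidableEq V] (G : SimpleGraph V)
    [DecidableRel G.Adj] (σ : V → ℝ) (hσ : ∀ v, σ v = 1 ∨ σ v = -1) :
    -(∑ u, ∑ v, G.adjMatrix ℝ u v * (σ u * σ v)) / 4 ≤ surplus G := by
  set S : Finset V := {v | σ v = 1}
  have hcut : cutSize G S ≤ maxCut G := Finset.le_sup (by simp)
  have hS : (cutSize G S : ℝ) =
      ∑ u, ∑ v, G.adjMatrix ℝ u v * ((1 + σ u) / 2 * ((1 - σ v) / 2)) := by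
    rw [cutSize, Nat.card_eq_fintype_card, Fintype.card_subtype, card_filter,
      Fintype.sum_prod_type]
    push_cast
    refine Finset.sum_congr rfl fun u _ => Finset.sum_congr rfl fun v _ => ?_
    have hn : ¬ ((-1 : ℝ) = 1) := by norm_num
    by_cases h : G.Adj u v <;> rcases hσ u with hu | hu <;> rcases hσ v with hv | hv <;>
      simp [S, h, hu, hv, hn]
  have hsymm : ∑ u, ∑ v, G.adjMatrix ℝ u v * σ u = ∑ u, ∑ v, G.adjMatrix ℝ u v * σ v := by
    rw [Finset.sum_comm]
    simp only [SimpleGraph.adjMatrix_apply, G.adj_comm]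
  have he : (∑ u, ∑ v, G.adjMatrix ℝ u v) = 2 * (edgeCount G : ℝ) := by
    have h := congrArg (Nat.cast : ℕ → ℝ) G.sum_degrees_eq_twice_card_edges
    push_cast at h
    rw [edgeCount, Nat.card_eq_fintype_card, ← SimpleGraph.edgeFinset_card, ← h]
    refine Finset.sum_congr rfl fun u _ => ?_
    simp [SimpleGraph.adjMatrix_apply, ← SimpleGraph.card_neighborFinset_eq_degree,
      SimpleGraph.neighborFinset_eq_filter]
  have hexp : (cutSize G S : ℝ) = (∑ u, ∑ v, G.adjMatrix ℝ u v) / 4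
      + (∑ u, ∑ v, G.adjMatrix ℝ u v * σ u) / 4 - (∑ u, ∑ v, G.adjMatrix ℝ u v * σ v) / 4
      - (∑ u, ∑ v, G.adjMatrix ℝ u v * (σ u * σ v)) / 4 := by
    rw [hS]
    simp only [Finset.sum_div, ← Finset.sum_add_distrib, ← Finset.sum_sub_distrib]
    refine Finset.sum_congr rfl fun u _ => Finset.sum_congr rfl fun v _ => ?_
    ring
  have hcut' : (cutSize G S : ℝ) ≤ maxCut G := by exact_mod_cast hcut
  rw [surplus]
  rw [hsymm, he] at hexp
  linarith

/-- A quadratic form with zero diagonal, evaluated on the cube, is at least its value at some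
vertex of the cube. -/
theorem exists_sign_le_of_abs_le_one [Fintype V] [DecidableEq V] (A : Matrix V V ℝ)
    (hA : ∀ v, A v v = 0) (f : V → ℝ) (hf : ∀ v, |f v| ≤ 1) :
    ∃ σ : V → ℝ, (∀ v, σ v = 1 ∨ σ v = -1) ∧
      ∑ u, ∑ v, A u v * (σ u * σ v) ≤ ∑ u, ∑ v, A u v * (f u * f v) := by
  suffices h : ∀ T : Finset V, ∃ σ : V → ℝ, (∀ v ∈ T, σ v = 1 ∨ σ v = -1) ∧ (∀ v, |σ v| ≤ 1) ∧
      ∑ u, ∑ v, A u v * (σ u * σ v) ≤ ∑ u, ∑ v, A u v * (f u * f v) by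
    obtain ⟨σ, h1, -, h2⟩ := h univ
    exact ⟨σ, fun v => h1 v (mem_univ v), h2⟩
  intro T
  induction T using Finset.induction_on with
  | empty => exact ⟨f, by simp, hf, le_rfl⟩
  | insert w T hw ih =>
    obtain ⟨σ, h1, h2, h3⟩ := ih
    have key (a : ℝ) : ∑ u, ∑ v, A u v * (Function.update σ w a u * Function.update σ w a v) =
        ∑ u ∈ univ.erase w, ∑ v ∈ univ.erase w, A u v * (σ u * σ v) +
        a * (∑ v ∈ univ.erase w, A w v * σ v + ∑ v ∈ univ.erase w, A v w * σ v) := by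
      have hu (u : V) : ∑ v, A u v * (Function.update σ w a u * Function.update σ w a v) =
          A u w * (Function.update σ w a u * a) +
          ∑ v ∈ univ.erase w, A u v * (Function.update σ w a u * σ v) := by
        rw [← Finset.add_sum_erase _ _ (mem_univ w)]
        congr 1
        · simp
        · refine Finset.sum_congr rfl fun v hv => ?_
          rw [Function.update_of_ne (ne_of_mem_erase hv) (f := σ)]
      simp only [hu]
      rw [← Finset.add_sum_erase _ _ (mem_univ w)]
      simp only [hA, Function.update_self, zero_mul, zero_add]
      have : ∑ u ∈ univ.erase w, (A u w * (Function.update σ w a u * a) +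
          ∑ v ∈ univ.erase w, A u v * (Function.update σ w a u * σ v)) =
          ∑ u ∈ univ.erase w, (a * (A u w * σ u) + ∑ v ∈ univ.erase w, A u v * (σ u * σ v)) := by
        refine Finset.sum_congr rfl fun u hu => ?_
        rw [Function.update_of_ne (ne_of_mem_erase hu)]
        ring
      rw [this, Finset.sum_add_distrib, mul_add, Finset.mul_sum, Finset.mul_sum]
      have : ∑ v ∈ univ.erase w, A w v * (a * σ v) = ∑ v ∈ univ.erase w, a * (A w v * σ v) :=
        Finset.sum_congr rfl fun v _ => by ring
      rw [this]
      ring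
    set L := ∑ v ∈ univ.erase w, A w v * σ v + ∑ v ∈ univ.erase w, A v w * σ v
    have h0 := key (σ w)
    rw [Function.update_eq_self] at h0
    have hwb := abs_le.1 (h2 w)
    obtain ⟨a, ha, hle⟩ : ∃ a : ℝ, (a = 1 ∨ a = -1) ∧ a * L ≤ σ w * L := by
      rcases le_total 0 L with hL | hL
      · exact ⟨-1, .inr rfl, by nlinarith⟩
      · exact ⟨1, .inl rfl, by nlinarith⟩
    refine ⟨Function.update σ w a, fun v hv => ?_, fun v => ?_, ?_⟩
    · rcases eq_or_ne v w with rfl | hvw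
      · simpa using ha
      · rw [Function.update_of_ne hvw]
        exact h1 v (by simpa [hvw] using hv)
    · rcases eq_or_ne v w with rfl | hvw
      · rcases ha with rfl | rfl <;> simp
      · rw [Function.update_of_ne hvw]
        exact h2 v
    · rw [key a]
      linarith

open MeasureTheory ProbabilityTheory in
theorem integral_cos_inner_stdGaussian {E : Type*} [NormedAddCommGroup E] [InnerProductSpace ℝ E]
    [FiniteDimensional ℝ E] [MeasurableSpace E] [BorelSpace E] (w : E) :
    ∫ g, Real.cos (inner ℝ g w) ∂(stdGaussian E) = Real.exp (-‖w‖ ^ 2 / 2) := by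
  have h := congrArg Complex.re (charFun_stdGaussian w)
  rw [charFun_apply] at h
  have hint : Integrable (fun g : E => Complex.exp ((inner ℝ g w : ℝ) * Complex.I))
      (stdGaussian E) := by
    refine Integrable.of_bound (Measurable.aestronglyMeasurable (by fun_prop)) 1
      (.of_forall fun g => ?_)
    rw [Complex.norm_exp_ofReal_mul_I]
  have h2 := integral_re hint
  simp only [RCLike.re_to_complex, Complex.exp_ofReal_mul_I_re] at h2
  rw [h2, h]
  norm_cast

open MeasureTheory ProbabilityTheory in
theorem integral_sin_inner_mul_sin_inner_stdGaussian {E : Type*} [NormedAddCommGroup E]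
    [InnerProductSpace ℝ E] [FiniteDimensional ℝ E] [MeasurableSpace E] [BorelSpace E] (x y : E) :
    ∫ g, Real.sin (inner ℝ g x) * Real.sin (inner ℝ g y) ∂(stdGaussian E) =
      Real.exp (-(‖x‖ ^ 2 + ‖y‖ ^ 2) / 2) * Real.sinh (inner ℝ x y) := by
  have hint (w : E) : Integrable (fun g : E => Real.cos (inner ℝ g w)) (stdGaussian E) := by
    refine Integrable.of_bound (Measurable.aestronglyMeasurable (by fun_prop)) 1
      (.of_forall fun g => ?_)
    exact Real.abs_cos_le_one _
  have h (g : E) : Real.sin (inner ℝ g x) * Real.sin (inner ℝ g y) =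
      (Real.cos (inner ℝ g (x - y)) - Real.cos (inner ℝ g (x + y))) / 2 := by
    rw [inner_sub_right, inner_add_right, Real.cos_sub, Real.cos_add]
    ring
  simp only [h]
  rw [integral_div, integral_sub (hint _) (hint _), integral_cos_inner_stdGaussian,
    integral_cos_inner_stdGaussian, Real.sinh_eq, norm_sub_sq_real, norm_add_sq_real,
    ← mul_div_assoc, mul_sub, ← Real.exp_add, ← Real.exp_add]
  ring_nf

open MeasureTheory ProbabilityTheory in
/-- Rounding unit-ball vectors to a cut: `sin` of Gaussian projections turns the Gram matrix
into its entrywise `sinh`. -/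
theorem surplus_ge_of_vectors [Fintype V] [DecidableEq V] (G : SimpleGraph V) [DecidableRel G.Adj]
    {E : Type*} [NormedAddCommGroup E] [InnerProductSpace ℝ E] [FiniteDimensional ℝ E]
    (x : V → E) (hx : ∀ v, ‖x v‖ ≤ 1) :
    -(∑ u, ∑ v, G.adjMatrix ℝ u v * Real.sinh (inner ℝ (x u) (x v))) / (4 * Real.exp 1) ≤
      surplus G := by
  borelize E
  let f (v : V) (g : E) : ℝ := Real.exp ((‖x v‖ ^ 2 - 1) / 2) * Real.sin (inner ℝ g (x v))
  have hf (v : V) (g : E) : |f v g| ≤ 1 := by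
    rw [abs_mul, Real.abs_exp]
    have h1 : ‖x v‖ ^ 2 ≤ 1 := pow_le_one₀ (norm_nonneg _) (hx v)
    exact mul_le_one₀ (Real.exp_le_one_iff.2 (by linarith)) (abs_nonneg _) (Real.abs_sin_le_one _)
  have hint (u v : V) : Integrable (fun g => f u g * f v g) (stdGaussian E) := by
    refine Integrable.of_bound (Measurable.aestronglyMeasurable (by fun_prop)) 1
      (.of_forall fun g => ?_)
    rw [norm_mul]
    exact mul_le_one₀ (hf u g) (norm_nonneg _) (hf v g)
  have hval (u v : V) : ∫ g, f u g * f v g ∂(stdGaussian E) =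
      Real.sinh (inner ℝ (x u) (x v)) / Real.exp 1 := by
    have h (g : E) : f u g * f v g = (Real.exp ((‖x u‖ ^ 2 - 1) / 2) *
        Real.exp ((‖x v‖ ^ 2 - 1) / 2)) * (Real.sin (inner ℝ g (x u)) *
        Real.sin (inner ℝ g (x v))) := by
      simp only [f]; ring
    simp only [h]
    rw [integral_const_mul, integral_sin_inner_mul_sin_inner_stdGaussian, ← mul_assoc,
      ← Real.exp_add, ← Real.exp_add, div_eq_mul_inv _ (Real.exp 1), mul_comm, ← Real.exp_neg]
    ring_nf
  have hpt (g : E) : -4 * surplus G ≤ ∑ u, ∑ v, G.adjMatrix ℝ u v * (f u g * f v g) := by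
    obtain ⟨σ, h1, h2⟩ := exists_sign_le_of_abs_le_one (G.adjMatrix ℝ) (by simp)
      (fun v => f v g) (fun v => hf v g)
    have := surplus_ge_of_sign G σ h1
    linarith
  have hI (a : V → V → ℝ) : Integrable (fun g => ∑ u, ∑ v, a u v * (f u g * f v g))
      (stdGaussian E) :=
    integrable_finsetSum _ fun u _ => integrable_finsetSum _ fun v _ => (hint u v).const_mul _
  have hIval (a : V → V → ℝ) : ∫ g, ∑ u, ∑ v, a u v * (f u g * f v g) ∂(stdGaussian E) =
      (∑ u, ∑ v, a u v * Real.sinh (inner ℝ (x u) (x v))) / Real.exp 1 := by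
    rw [integral_finsetSum _ fun u _ => integrable_finsetSum _ fun v _ =>
      (hint u v).const_mul _, Finset.sum_div]
    refine Finset.sum_congr rfl fun u _ => ?_
    rw [integral_finsetSum _ fun v _ => (hint u v).const_mul _, Finset.sum_div]
    refine Finset.sum_congr rfl fun v _ => ?_
    rw [integral_const_mul, hval, mul_div_assoc]
  have hmono := integral_mono (integrable_const (-4 * surplus G)) (hI (G.adjMatrix ℝ)) hpt
  rw [integral_const, hIval (G.adjMatrix ℝ)] at hmono
  simp only [probReal_univ, one_smul] at hmono
  rw [mul_comm (4 : ℝ), ← div_div, neg_div]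
  linarith

theorem sinh_le_self_add_sq {x : ℝ} (hx : |x| ≤ 1) : Real.sinh x ≤ x + x ^ 2 := by
  have h1 := (abs_le.1 (Real.abs_exp_sub_one_sub_id_le hx)).2
  have h2 := Real.add_one_le_exp (-x)
  rw [Real.sinh_eq]
  nlinarith [sq_nonneg x]

theorem adjMatrix_nonneg (G : SimpleGraph V) [DecidableRel G.Adj] (u v : V) :
    0 ≤ G.adjMatrix ℝ u v := by
  rw [SimpleGraph.adjMatrix_apply]
  split_ifs <;> norm_num

/-- If the Gram matrix of vectors in the unit ball is negatively correlated with the adjacency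
matrix and its entries on edges are small in the `ℓ²` sense, then the surplus is large. -/
theorem surplus_ge_of_gram [Fintype V] [DecidableEq V] (G : SimpleGraph V) [DecidableRel G.Adj]
    {E : Type*} [NormedAddCommGroup E] [InnerProductSpace ℝ E] [FiniteDimensional ℝ E]
    (x : V → E) (hx : ∀ v, ‖x v‖ ≤ 1) {K L : ℝ} (hK : 1 ≤ K)
    (hL : ∑ u, ∑ v, G.adjMatrix ℝ u v * inner ℝ (x u) (x v) ≤ -L)
    (hQ : ∑ u, ∑ v, G.adjMatrix ℝ u v * inner ℝ (x u) (x v) ^ 2 ≤ K * L) :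
    L / (16 * Real.exp 1 * K) ≤ surplus G := by
  have hK0 : 0 < K := by linarith
  set ε : ℝ := 1 / (2 * K) with hε
  have hε0 : 0 < ε := by positivity
  have hε1 : ε ≤ 1 := by
    rw [hε, div_le_one (by positivity)]
    linarith
  have hsq : Real.sqrt ε * Real.sqrt ε = ε := Real.mul_self_sqrt hε0.le
  have hs1 : Real.sqrt ε ≤ 1 := Real.sqrt_le_one.2 hε1
  have key := surplus_ge_of_vectors G (fun v => Real.sqrt ε • x v) (fun v => by
    rw [norm_smul, Real.norm_of_nonneg (Real.sqrt_nonneg _)]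
    exact mul_le_one₀ hs1 (norm_nonneg _) (hx v))
  have hin (u v : V) : inner ℝ (Real.sqrt ε • x u) (Real.sqrt ε • x v) =
      ε * inner ℝ (x u) (x v) := by
    rw [real_inner_smul_left, real_inner_smul_right, ← mul_assoc, hsq]
  simp only [hin] at key
  have hbound : ∑ u, ∑ v, G.adjMatrix ℝ u v * Real.sinh (ε * inner ℝ (x u) (x v)) ≤
      ε * (∑ u, ∑ v, G.adjMatrix ℝ u v * inner ℝ (x u) (x v)) +
      ε ^ 2 * (∑ u, ∑ v, G.adjMatrix ℝ u v * inner ℝ (x u) (x v) ^ 2) := by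
    simp only [Finset.mul_sum, ← Finset.sum_add_distrib]
    refine Finset.sum_le_sum fun u _ => Finset.sum_le_sum fun v _ => ?_
    have h1 : |inner ℝ (x u) (x v)| ≤ 1 :=
      (abs_real_inner_le_norm _ _).trans (mul_le_one₀ (hx u) (norm_nonneg _) (hx v))
    have h2 : |ε * inner ℝ (x u) (x v)| ≤ 1 := by
      rw [abs_mul, abs_of_pos hε0]
      exact mul_le_one₀ hε1 (abs_nonneg _) h1
    have := mul_le_mul_of_nonneg_left (sinh_le_self_add_sq h2) (adjMatrix_nonneg G u v)
    linarith
  have h3 : ∑ u, ∑ v, G.adjMatrix ℝ u v * Real.sinh (ε * inner ℝ (x u) (x v)) ≤ -(L / (4 * K)) := by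
    have h4 := mul_le_mul_of_nonneg_left hL hε0.le
    have h5 := mul_le_mul_of_nonneg_left hQ (sq_nonneg ε)
    have h6 : ε * -L + ε ^ 2 * (K * L) = -(L / (4 * K)) := by
      rw [hε]; field_simp; ring
    linarith
  refine le_trans ?_ key
  rw [div_le_div_iff₀ (by positivity) (by positivity)]
  have h7 : L ≤ (4 * K) * -∑ u, ∑ v, G.adjMatrix ℝ u v * Real.sinh (ε * inner ℝ (x u) (x v)) := by
    have := mul_le_mul_of_nonneg_left h3 (show 0 ≤ 4 * K by linarith)
    have h8 : 4 * K * -(L / (4 * K)) = -L := by field_simp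
    linarith
  nlinarith [Real.exp_pos 1]

section OrthogonalConjugation

variable [Fintype V] [DecidableEq V]

theorem conj_diagonal_mul {U : Matrix V V ℝ} (hU : Uᵀ * U = 1) (a b : V → ℝ) :
    U * diagonal a * Uᵀ * (U * diagonal b * Uᵀ) = U * diagonal (fun i => a i * b i) * Uᵀ := by
  calc U * diagonal a * Uᵀ * (U * diagonal b * Uᵀ)
      = U * diagonal a * (Uᵀ * U) * diagonal b * Uᵀ := by simp only [Matrix.mul_assoc]
    _ = _ := by rw [hU, Matrix.mul_one, Matrix.mul_assoc U, diagonal_mul_diagonal]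

theorem trace_conj_diagonal {U : Matrix V V ℝ} (hU : Uᵀ * U = 1) (a : V → ℝ) :
    trace (U * diagonal a * Uᵀ) = ∑ i, a i := by
  rw [Matrix.mul_assoc, Matrix.trace_mul_comm, Matrix.mul_assoc, hU, Matrix.mul_one,
    Matrix.trace_diagonal]

theorem conj_diagonal_apply (U : Matrix V V ℝ) (a : V → ℝ) (u v : V) :
    (U * diagonal a * Uᵀ) u v = ∑ i, a i * (U u i * U v i) := by
  rw [Matrix.mul_apply]
  refine Finset.sum_congr rfl fun i _ => ?_
  rw [mul_diagonal, transpose_apply]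
  ring

theorem conj_diagonal_apply_comm (U : Matrix V V ℝ) (a : V → ℝ) (u v : V) :
    (U * diagonal a * Uᵀ) u v = (U * diagonal a * Uᵀ) v u := by
  simp only [conj_diagonal_apply, mul_comm (U u _)]

theorem sum_sq_conj_diagonal {U : Matrix V V ℝ} (hU : Uᵀ * U = 1) (a : V → ℝ) :
    ∑ u, ∑ v, (U * diagonal a * Uᵀ) u v ^ 2 = ∑ i, a i ^ 2 := by
  have h := trace_conj_diagonal hU (fun i => a i * a i)
  rw [← conj_diagonal_mul hU] at h
  simp only [sq]
  rw [← h]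
  simp only [Matrix.trace, Matrix.diag]
  refine Finset.sum_congr rfl fun u _ => ?_
  rw [Matrix.mul_apply]
  refine Finset.sum_congr rfl fun v _ => ?_
  rw [conj_diagonal_apply_comm U a v u]

theorem exists_conj_diagonal {B : Matrix V V ℝ} (hB : B.IsHermitian) :
    ∃ (U : Matrix V V ℝ) (μ : V → ℝ), Uᵀ * U = 1 ∧ U * Uᵀ = 1 ∧ B = U * diagonal μ * Uᵀ := by
  refine ⟨hB.eigenvectorUnitary, hB.eigenvalues, ?_, ?_, ?_⟩
  · simpa [star_eq_conjTranspose] using (Matrix.mem_unitaryGroup_iff' (α := ℝ)).1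
      hB.eigenvectorUnitary.2
  · simpa [star_eq_conjTranspose] using (Matrix.mem_unitaryGroup_iff (α := ℝ)).1
      hB.eigenvectorUnitary.2
  · conv_lhs => rw [hB.spectral_theorem]
    simp [Unitary.conjStarAlgAut_apply, star_eq_conjTranspose]

theorem abs_le_of_conj_diagonal {B U : Matrix V V ℝ} {μ : V → ℝ} (hU : Uᵀ * U = 1)
    (hB : B = U * diagonal μ * Uᵀ) {r : ℝ} (hr : ∀ u, ∑ v, |B u v| ≤ r) (i : V) : |μ i| ≤ r := by
  have hBU : B * U = U * diagonal μ := by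
    rw [hB, Matrix.mul_assoc, hU, Matrix.mul_one]
  obtain ⟨w, -, hw⟩ := Finset.exists_max_image univ (fun u => |U u i|) ⟨i, mem_univ i⟩
  have hpos : 0 < |U w i| := by
    by_contra! h
    have h0 (u : V) : U u i = 0 := abs_nonpos_iff.1 ((hw u (mem_univ u)).trans h)
    have h1 := congrFun (congrFun hU i) i
    simp [Matrix.mul_apply, h0] at h1
  have h1 := congrFun (congrFun hBU w) i
  rw [mul_diagonal, Matrix.mul_apply] at h1
  have h2 : |U w i * μ i| ≤ r * |U w i| := by
    rw [← h1]
    calc |∑ v, B w v * U v i| ≤ ∑ v, |B w v * U v i| := Finset.abs_sum_le_sum_abs _ _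
      _ ≤ ∑ v, |B w v| * |U w i| := Finset.sum_le_sum fun v _ => by
          rw [abs_mul]
          exact mul_le_mul_of_nonneg_left (hw v (mem_univ v)) (abs_nonneg _)
      _ ≤ r * |U w i| := by
          rw [← Finset.sum_mul]
          exact mul_le_mul_of_nonneg_right (hr w) (abs_nonneg _)
  rw [abs_mul, mul_comm] at h2
  exact le_of_mul_le_mul_right h2 hpos

theorem surplus_ge_of_conj_diagonal (G : SimpleGraph V) [DecidableRel G.Adj]
    {Y U : Matrix V V ℝ} {a : V → ℝ} (ha : ∀ i, 0 ≤ a i) (hY : Y = U * diagonal a * Uᵀ)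
    (hdiag : ∀ v, Y v v ≤ 1) {K L : ℝ} (hK : 1 ≤ K) (hL : trace (G.adjMatrix ℝ * Y) ≤ -L)
    (hQ : ∑ u, ∑ v, G.adjMatrix ℝ u v * Y u v ^ 2 ≤ K * L) :
    L / (16 * Real.exp 1 * K) ≤ surplus G := by
  let x (v : V) : EuclideanSpace ℝ V := WithLp.toLp 2 fun i => Real.sqrt (a i) * U v i
  have hx (u v : V) : inner ℝ (x u) (x v) = Y u v := by
    rw [hY, conj_diagonal_apply, PiLp.inner_apply]
    refine Finset.sum_congr rfl fun i _ => ?_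
    have := Real.mul_self_sqrt (ha i)
    simp only [x, RCLike.inner_apply, conj_trivial]
    linear_combination (U u i * U v i) * this
  refine surplus_ge_of_gram G x (fun v => ?_) hK ?_ ?_
  · have h := hdiag v
    rw [← hx, real_inner_self_eq_norm_sq] at h
    exact (sq_le_one_iff₀ (norm_nonneg _)).1 h
  · refine le_of_eq_of_le ?_ hL
    simp only [hx, Matrix.trace, Matrix.diag, Matrix.mul_apply]
    refine Finset.sum_congr rfl fun u _ => Finset.sum_congr rfl fun v _ => ?_
    rw [hY, conj_diagonal_apply_comm]
  · simpa only [hx] using hQ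

end OrthogonalConjugation

/-- The adjacency matrix of a `d`-regular graph with the trivial eigenvalue removed. -/
noncomputable def centeredAdjMatrix [Fintype V] (G : SimpleGraph V) [DecidableRel G.Adj]
    (d : ℕ) : Matrix V V ℝ :=
  G.adjMatrix ℝ - ((d : ℝ) / Fintype.card V) • Matrix.of fun _ _ => 1

section CenteredAdjMatrix

variable [Fintype V] (G : SimpleGraph V) [DecidableRel G.Adj] {d : ℕ}

theorem centeredAdjMatrix_isHermitian : (centeredAdjMatrix G d).IsHermitian := by
  refine Matrix.IsHermitian.ext fun u v => ?_
  simp [centeredAdjMatrix, G.adj_comm]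

theorem adjMatrix_row_sum (hd : ∀ v, G.degree v = d) (u : V) : ∑ v, G.adjMatrix ℝ u v = d := by
  simp [SimpleGraph.adjMatrix_apply, ← hd u, ← SimpleGraph.card_neighborFinset_eq_degree,
    SimpleGraph.neighborFinset_eq_filter]

theorem adjMatrix_mul_ones (hd : ∀ v, G.degree v = d) :
    G.adjMatrix ℝ * Matrix.of (fun _ _ => (1 : ℝ)) = (d : ℝ) • Matrix.of fun _ _ => 1 := by
  ext u v
  rw [Matrix.mul_apply]
  simp [← adjMatrix_row_sum G hd u]

theorem ones_mul_adjMatrix (hd : ∀ v, G.degree v = d) :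
    Matrix.of (fun _ _ => (1 : ℝ)) * G.adjMatrix ℝ = (d : ℝ) • Matrix.of fun _ _ => 1 := by
  have h := congrArg Matrix.transpose (adjMatrix_mul_ones G hd)
  rw [Matrix.transpose_mul, SimpleGraph.transpose_adjMatrix] at h
  exact h

theorem ones_mul_centeredAdjMatrix [Nonempty V] (hd : ∀ v, G.degree v = d) :
    Matrix.of (fun _ _ => (1 : ℝ)) * centeredAdjMatrix G d = 0 := by
  rw [centeredAdjMatrix, Matrix.mul_sub, ones_mul_adjMatrix G hd]
  ext u v
  have : (Fintype.card V : ℝ) ≠ 0 := by simp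
  simp only [Matrix.sub_apply, Matrix.smul_apply, Matrix.mul_apply, Matrix.of_apply,
    Matrix.zero_apply, smul_eq_mul, one_mul, Finset.sum_const, card_univ, nsmul_eq_mul]
  field_simp
  ring

theorem centeredAdjMatrix_mul_self [Nonempty V] (hd : ∀ v, G.degree v = d) :
    centeredAdjMatrix G d * centeredAdjMatrix G d =
      G.adjMatrix ℝ * G.adjMatrix ℝ -
        ((d : ℝ) ^ 2 / Fintype.card V) • Matrix.of fun _ _ => 1 := by
  conv_lhs => enter [1]; rw [centeredAdjMatrix]
  rw [Matrix.sub_mul, Matrix.smul_mul, ones_mul_centeredAdjMatrix G hd, smul_zero, sub_zero,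
    centeredAdjMatrix, Matrix.mul_sub, Matrix.mul_smul, adjMatrix_mul_ones G hd, smul_smul]
  congr 2
  ring

theorem adjMatrix_mul_centeredAdjMatrix [Nonempty V] (hd : ∀ v, G.degree v = d) :
    G.adjMatrix ℝ * centeredAdjMatrix G d = centeredAdjMatrix G d * centeredAdjMatrix G d := by
  conv_rhs => enter [1]; rw [centeredAdjMatrix]
  rw [Matrix.sub_mul, Matrix.smul_mul, ones_mul_centeredAdjMatrix G hd, smul_zero, sub_zero]

theorem centeredAdjMatrix_mul_self_apply_self [Nonempty V] (hd : ∀ v, G.degree v = d) (v : V) :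
    (centeredAdjMatrix G d * centeredAdjMatrix G d) v v = d - (d : ℝ) ^ 2 / Fintype.card V := by
  rw [centeredAdjMatrix_mul_self G hd, Matrix.sub_apply,
    SimpleGraph.adjMatrix_mul_self_apply_self, hd]
  simp

theorem trace_centeredAdjMatrix_sq [Nonempty V] (hd : ∀ v, G.degree v = d) :
    trace (centeredAdjMatrix G d * centeredAdjMatrix G d) = Fintype.card V * d - (d : ℝ) ^ 2 := by
  have : (Fintype.card V : ℝ) ≠ 0 := by simp
  simp only [Matrix.trace, Matrix.diag, centeredAdjMatrix_mul_self_apply_self G hd]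
  rw [Finset.sum_const, card_univ, nsmul_eq_mul]
  field_simp

theorem trace_centeredAdjMatrix_cube [DecidableEq V] [Nonempty V] (hd : ∀ v, G.degree v = d) :
    trace (centeredAdjMatrix G d * centeredAdjMatrix G d * centeredAdjMatrix G d) =
      6 * (cliqueCount G 3 : ℝ) - (d : ℝ) ^ 3 := by
  have : (Fintype.card V : ℝ) ≠ 0 := by simp
  rw [Matrix.mul_assoc, ← adjMatrix_mul_centeredAdjMatrix G hd, Matrix.trace_mul_comm,
    Matrix.mul_assoc, centeredAdjMatrix_mul_self G hd, Matrix.mul_sub, Matrix.mul_smul,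
    adjMatrix_mul_ones G hd, smul_smul, Matrix.trace_sub, ← Matrix.mul_assoc,
    trace_adjMatrix_cube, Matrix.trace_smul]
  simp only [Matrix.trace, Matrix.diag, Matrix.of_apply, Finset.sum_const, card_univ,
    nsmul_eq_mul, smul_eq_mul]
  field_simp

theorem sum_abs_centeredAdjMatrix_le [Nonempty V] (hd : ∀ v, G.degree v = d) (u : V) :
    ∑ v, |centeredAdjMatrix G d u v| ≤ 2 * d := by
  have : (Fintype.card V : ℝ) ≠ 0 := by simp
  calc ∑ v, |centeredAdjMatrix G d u v|
      ≤ ∑ v, (G.adjMatrix ℝ u v + (d : ℝ) / Fintype.card V) := Finset.sum_le_sum fun v _ => by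
        have h1 := adjMatrix_nonneg G u v
        have h2 : (0 : ℝ) ≤ (d : ℝ) / Fintype.card V := by positivity
        simp only [centeredAdjMatrix, Matrix.sub_apply, Matrix.smul_apply, Matrix.of_apply,
          smul_eq_mul, mul_one]
        exact abs_le.2 ⟨by linarith, by linarith⟩
    _ = 2 * d := by
        rw [Finset.sum_add_distrib, adjMatrix_row_sum G hd, Finset.sum_const, card_univ,
          nsmul_eq_mul]
        field_simp
        ring

end CenteredAdjMatrix

section SpectralBounds

variable [Fintype V] [DecidableEq V] [Nonempty V] {G : SimpleGraph V} [DecidableRel G.Adj] {d : ℕ}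

theorem trace_adjMatrix_mul_conj_diagonal (hd : ∀ v, G.degree v = d) {U : Matrix V V ℝ}
    {μ : V → ℝ} (hU : Uᵀ * U = 1) (hB : centeredAdjMatrix G d = U * diagonal μ * Uᵀ)
    (g : V → ℝ) :
    trace (G.adjMatrix ℝ * (U * diagonal (fun i => μ i * g i) * Uᵀ)) = ∑ i, μ i ^ 2 * g i := by
  rw [← conj_diagonal_mul hU, ← hB, ← Matrix.mul_assoc, adjMatrix_mul_centeredAdjMatrix G hd, hB,
    conj_diagonal_mul hU, conj_diagonal_mul hU, trace_conj_diagonal hU]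
  simp only [sq]

/-- Surplus from a test matrix `κ + g(B) B`, with `B` the centred adjacency matrix. -/
theorem surplus_ge_of_spectrum (hd : ∀ v, G.degree v = d) {U : Matrix V V ℝ} {μ : V → ℝ}
    (hU : Uᵀ * U = 1) (hU' : U * Uᵀ = 1) (hB : centeredAdjMatrix G d = U * diagonal μ * Uᵀ)
    {κ α γ K L : ℝ} {g : V → ℝ} (h0 : ∀ i, 0 ≤ κ + μ i * g i)
    (h1 : ∀ i, κ + μ i * g i ≤ α + γ * μ i ^ 2) (hγ : 0 ≤ γ) (hα : α + γ * d ≤ 1) (hK : 1 ≤ K)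
    (hL : ∑ i, μ i ^ 2 * g i ≤ -L) (hQ : ∑ i, (μ i * g i) ^ 2 ≤ K * L) :
    L / (16 * Real.exp 1 * K) ≤ surplus G := by
  set Z := U * diagonal (fun i => μ i * g i) * Uᵀ with hZ
  have hone (c : ℝ) : U * diagonal (fun _ => c) * Uᵀ = c • (1 : Matrix V V ℝ) := by
    rw [show (diagonal fun _ : V => c) = c • (1 : Matrix V V ℝ) from
      (Matrix.smul_one_eq_diagonal c).symm, Matrix.mul_smul, Matrix.mul_one, Matrix.smul_mul, hU']
  have hY : κ • (1 : Matrix V V ℝ) + Z = U * diagonal (fun i => κ + μ i * g i) * Uᵀ := by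
    rw [hZ, ← hone κ, ← Matrix.add_mul, ← Matrix.mul_add, Matrix.diagonal_add]
  refine surplus_ge_of_conj_diagonal G h0 hY (fun v => ?_) hK ?_ ?_
  · have hBB := centeredAdjMatrix_mul_self_apply_self G hd v
    rw [hB, conj_diagonal_mul hU, conj_diagonal_apply] at hBB
    have h11 := congrFun (congrFun (hone 1) v) v
    rw [conj_diagonal_apply] at h11
    simp only [Matrix.smul_apply, Matrix.one_apply_eq, smul_eq_mul, mul_one, one_mul] at h11
    rw [hY, conj_diagonal_apply]
    calc ∑ i, (κ + μ i * g i) * (U v i * U v i)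
        ≤ ∑ i, (α * (U v i * U v i) + γ * (μ i * μ i * (U v i * U v i))) :=
          Finset.sum_le_sum fun i _ => by
            have := mul_le_mul_of_nonneg_right (h1 i) (mul_self_nonneg (U v i))
            linarith
      _ = α + γ * (d - (d : ℝ) ^ 2 / Fintype.card V) := by
          rw [Finset.sum_add_distrib, ← Finset.mul_sum, ← Finset.mul_sum, h11, hBB, mul_one]
      _ ≤ α + γ * d := by
          have : (0 : ℝ) ≤ (d : ℝ) ^ 2 / Fintype.card V := by positivity
          have := mul_nonneg hγ this
          linarith
      _ ≤ 1 := hα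
  · rw [Matrix.mul_add, Matrix.mul_smul, Matrix.mul_one, Matrix.trace_add, Matrix.trace_smul,
      SimpleGraph.trace_adjMatrix, smul_zero, zero_add,
      trace_adjMatrix_mul_conj_diagonal hd hU hB]
    exact hL
  · refine le_trans ?_ hQ
    rw [← sum_sq_conj_diagonal hU]
    refine Finset.sum_le_sum fun u _ => Finset.sum_le_sum fun v _ => ?_
    rw [SimpleGraph.adjMatrix_apply]
    split_ifs with h
    · rw [Matrix.add_apply, Matrix.smul_apply, Matrix.one_apply_ne h.ne, smul_zero, zero_add,
        one_mul]
    · rw [zero_mul]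
      positivity

/-- The surplus is controlled from below by the cubes of the negative eigenvalues. -/
theorem surplus_ge_of_negative_cubes (hd : ∀ v, G.degree v = d) (hd0 : 0 < d) {U : Matrix V V ℝ}
    {μ : V → ℝ} (hU : Uᵀ * U = 1) (hU' : U * Uᵀ = 1)
    (hB : centeredAdjMatrix G d = U * diagonal μ * Uᵀ) :
    (∑ i, -(min (μ i) 0) ^ 3) / d / (32 * Real.exp 1) ≤ surplus G := by
  have hd1 : (0 : ℝ) < d := by exact_mod_cast hd0
  have h := surplus_ge_of_spectrum hd hU hU' hB (κ := 0) (α := 0) (γ := 1 / d) (K := 2)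
    (L := (∑ i, -(min (μ i) 0) ^ 3) / d) (g := fun i => min (μ i) 0 / d) ?_ ?_ (by positivity)
    (by field_simp; norm_num) (by norm_num) ?_ ?_
  · rwa [show 16 * Real.exp 1 * 2 = 32 * Real.exp 1 by ring] at h
  · intro i
    rw [zero_add, ← mul_div_assoc]
    refine div_nonneg ?_ hd1.le
    rcases min_cases (μ i) 0 with ⟨h, h'⟩ | ⟨h, h'⟩ <;> rw [h] <;> nlinarith
  · intro i
    rw [zero_add, zero_add, ← mul_div_assoc, one_div_mul_eq_div]
    refine div_le_div_of_nonneg_right ?_ hd1.le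
    rcases min_cases (μ i) 0 with ⟨h, h'⟩ | ⟨h, h'⟩ <;> rw [h] <;> nlinarith
  · rw [Finset.sum_div, ← Finset.sum_neg_distrib]
    refine Finset.sum_le_sum fun i _ => le_of_eq ?_
    rw [neg_div, neg_neg, ← mul_div_assoc]
    rcases min_cases (μ i) 0 with ⟨h, h'⟩ | ⟨h, h'⟩ <;> rw [h] <;> ring
  · rw [Finset.sum_div, Finset.mul_sum]
    refine Finset.sum_le_sum fun i _ => ?_
    have hμ := (abs_le.1 (abs_le_of_conj_diagonal hU hB (sum_abs_centeredAdjMatrix_le G hd) i)).1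
    rcases min_cases (μ i) 0 with ⟨h, h'⟩ | ⟨h, h'⟩ <;> rw [h]
    · rw [← sub_nonneg]
      have : 2 * (-μ i ^ 3 / d) - (μ i * (μ i / d)) ^ 2 =
          (-μ i) * μ i ^ 2 * (2 * d + μ i) / d ^ 2 := by
        field_simp
        ring
      rw [this]
      exact div_nonneg (mul_nonneg (mul_nonneg (by linarith) (sq_nonneg _)) (by linarith))
        (sq_nonneg _)
    · simp

/-- If neither the negative eigenvalues nor the third moment are too large, a linear perturbation
of the identity certifies a large surplus. -/
theorem surplus_ge_of_moments (hd : ∀ v, G.degree v = d) (hd0 : 0 < d)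
    (hdn : (d : ℝ) ≤ (Fintype.card V : ℝ) / 2) {U : Matrix V V ℝ}
    {μ : V → ℝ} (hU : Uᵀ * U = 1) (hU' : U * Uᵀ = 1)
    (hB : centeredAdjMatrix G d = U * diagonal μ * Uᵀ) {r : ℝ}
    (hμ3 : ∑ i, μ i ^ 3 ≤ 6 * r) (hneg : ∑ i, -(min (μ i) 0) ^ 3 ≤ r)
    (hr : Fintype.card V * d * Real.sqrt d ≤ r) :
    (Fintype.card V : ℝ) ^ 2 * d ^ 2 / r / (3072 * Real.exp 1) ≤ surplus G := by
  have hd1 : (1 : ℝ) ≤ d := by exact_mod_cast hd0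
  have hn0 : (0 : ℝ) < Fintype.card V := by exact_mod_cast Fintype.card_pos
  set n : ℝ := (Fintype.card V : ℝ)
  have hs1 : 1 ≤ Real.sqrt d := Real.one_le_sqrt.2 hd1
  have hs2 : Real.sqrt d * Real.sqrt d = d := Real.mul_self_sqrt (by linarith)
  have hnd : 0 < n * d := by positivity
  have hr0 : 0 < r := by nlinarith
  set t : ℝ := n * d / (24 * r) with ht
  have ht0 : 0 < t := by positivity
  have htr : t * r = n * d / 24 := by
    rw [ht]; field_simp
  have hts : t * Real.sqrt d ≤ 1 / 24 := by
    have h := mul_le_mul_of_nonneg_left hr ht0.le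
    rw [htr] at h
    refine le_of_mul_le_mul_right ?_ hnd
    linarith
  have ht1 : t ≤ 1 / 24 := by nlinarith
  have htd : t ^ 2 * d ≤ 1 / 576 := by
    have : t ^ 2 * d = (t * Real.sqrt d) ^ 2 := by rw [mul_pow, sq (Real.sqrt d), hs2]
    rw [this]
    have : 0 ≤ t * Real.sqrt d := by positivity
    nlinarith
  have hμ2 : ∑ i, μ i ^ 2 = n * d - d ^ 2 := by
    rw [← trace_centeredAdjMatrix_sq G hd, hB, conj_diagonal_mul hU, trace_conj_diagonal hU]
    simp only [sq]
  have hμ4 : ∑ i, μ i ^ 4 ≤ 16 * d * r := by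
    have h : ∑ i, μ i ^ 4 ≤ 2 * d * ∑ i, (μ i ^ 3 + 2 * (-(min (μ i) 0) ^ 3)) := by
      rw [Finset.mul_sum]
      refine Finset.sum_le_sum fun i _ => ?_
      have h1 := abs_le.1 (abs_le_of_conj_diagonal hU hB (sum_abs_centeredAdjMatrix_le G hd) i)
      rcases min_cases (μ i) 0 with ⟨h, h'⟩ | ⟨h, h'⟩ <;> rw [h]
      · have := mul_nonneg (mul_nonneg (sq_nonneg (μ i)) (neg_nonneg.2 h'))
          (show 0 ≤ 2 * d + μ i by linarith)
        nlinarith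
      · have := mul_nonneg (mul_nonneg (sq_nonneg (μ i)) h'.le)
          (show 0 ≤ 2 * d - μ i by linarith)
        nlinarith
    rw [Finset.sum_add_distrib, ← Finset.mul_sum] at h
    refine h.trans ?_
    have : 2 * (d : ℝ) * (∑ i, μ i ^ 3 + 2 * ∑ i, -(min (μ i) 0) ^ 3) ≤ 2 * d * (8 * r) :=
      mul_le_mul_of_nonneg_left (by linarith) (by linarith)
    linarith
  have h := surplus_ge_of_spectrum hd hU hU' hB (κ := 1 / 2) (α := 3 / 4) (γ := 3 / 4 * t ^ 2)
    (K := 1) (L := t * (n * d) / 8) (g := fun i => (t ^ 2 * μ i - t) / 2) ?_ ?_ (by positivity)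
    (by linarith) le_rfl ?_ ?_
  · refine le_of_eq_of_le ?_ h
    rw [ht]
    field_simp
    norm_num
  · intro i
    nlinarith [sq_nonneg (t * μ i - 1 / 2)]
  · intro i
    nlinarith [sq_nonneg (t * μ i + 1)]
  · have h1 : ∑ i, μ i ^ 2 * ((t ^ 2 * μ i - t) / 2) =
        t ^ 2 / 2 * ∑ i, μ i ^ 3 - t / 2 * ∑ i, μ i ^ 2 := by
      rw [Finset.mul_sum, Finset.mul_sum, ← Finset.sum_sub_distrib]
      exact Finset.sum_congr rfl fun i _ => by ring
    rw [h1, hμ2]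
    have h2 := mul_le_mul_of_nonneg_left hμ3 (show 0 ≤ t ^ 2 / 2 by positivity)
    have h3 : t ^ 2 / 2 * (6 * r) = t * (n * d) / 8 := by
      linear_combination 3 * t * htr
    have h4 := mul_le_mul_of_nonneg_left hdn (show 0 ≤ t / 2 * d by positivity)
    linarith
  · have h1 : ∑ i, (μ i * ((t ^ 2 * μ i - t) / 2)) ^ 2 ≤
        t ^ 2 / 2 * ∑ i, μ i ^ 2 + t ^ 4 / 2 * ∑ i, μ i ^ 4 := by
      rw [Finset.mul_sum, Finset.mul_sum, ← Finset.sum_add_distrib]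
      refine Finset.sum_le_sum fun i _ => ?_
      nlinarith [sq_nonneg (t * μ i + t ^ 2 * μ i ^ 2)]
    have h2 := mul_le_mul_of_nonneg_left hμ4 (show 0 ≤ t ^ 4 / 2 by positivity)
    have h3 : t ^ 4 / 2 * (16 * d * r) = t ^ 2 * d * (t * (n * d) / 3) := by
      linear_combination 8 * t ^ 3 * d * htr
    have h4 : t ^ 2 * d * (t * (n * d) / 3) ≤ 1 / 576 * (t * (n * d) / 3) :=
      mul_le_mul_of_nonneg_right htd (by positivity)
    have h5 : t ^ 2 / 2 * ∑ i, μ i ^ 2 ≤ t ^ 2 / 2 * (n * d) :=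
      mul_le_mul_of_nonneg_left (by rw [hμ2]; nlinarith) (by positivity)
    have h6 : t ^ 2 / 2 * (n * d) ≤ 1 / 24 * (t * (n * d) / 2) := by
      have := mul_le_mul_of_nonneg_right ht1 (show 0 ≤ t * (n * d) / 2 by positivity)
      linarith
    have h7 : 0 < t * (n * d) := by positivity
    linarith

end SpectralBounds

theorem surplus_nonneg [Fintype V] (G : SimpleGraph V) : 0 ≤ surplus G := by
  classical
  simpa using surplus_ge_of_vectors G (fun _ => (0 : ℝ)) (by simp)

/-- Surplus of a `d`-regular graph with `n` vertices (`d ≤ n/2`) and `d³/6 + s`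
triangles, in the three regimes of `s`. -/
theorem statement2 :
    ∃ c : ℝ, 0 < c ∧
      ∀ (V : Type) [Fintype V] (G : SimpleGraph V) (d : ℕ) (s : ℝ),
        (∀ v : V, degC G v = d) →
        (d : ℝ) ≤ (Fintype.card V : ℝ) / 2 →
        (cliqueCount G 3 : ℝ) = (d : ℝ) ^ 3 / 6 + s →
        ((s < -(Fintype.card V : ℝ) * (d : ℝ) ^ ((3 : ℝ) / 2) →
            surplus G ≥ c * |s| / d) ∧
         (-(Fintype.card V : ℝ) * (d : ℝ) ^ ((3 : ℝ) / 2) ≤ s ∧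
            s ≤ (Fintype.card V : ℝ) * (d : ℝ) ^ ((3 : ℝ) / 2) →
            surplus G ≥ c * (Fintype.card V : ℝ) * (d : ℝ) ^ ((1 : ℝ) / 2)) ∧
         ((Fintype.card V : ℝ) * (d : ℝ) ^ ((3 : ℝ) / 2) < s →
            surplus G ≥ c * (Fintype.card V : ℝ) ^ 2 * (d : ℝ) ^ 2 / s)) := by
  refine ⟨1 / 10000, by norm_num, fun V _ G d s hdeg hdn hT => ?_⟩
  classical
  have hsp := surplus_nonneg G
  rcases Nat.eq_zero_or_pos d with rfl | hd0
  · have h32 : ((0 : ℕ) : ℝ) ^ ((3 : ℝ) / 2) = 0 := by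
      rw [Nat.cast_zero, Real.zero_rpow (by norm_num)]
    have h12 : ((0 : ℕ) : ℝ) ^ ((1 : ℝ) / 2) = 0 := by
      rw [Nat.cast_zero, Real.zero_rpow (by norm_num)]
    rw [h32, h12]
    simpa using ⟨fun _ => hsp, fun _ _ => hsp, fun _ => hsp⟩
  have hd1 : (1 : ℝ) ≤ d := by exact_mod_cast hd0
  have hn0 : (0 : ℝ) < Fintype.card V := by linarith
  have : Nonempty V := Fintype.card_pos_iff.1 (by exact_mod_cast hn0)
  have hd (v : V) : G.degree v = d := by
    rw [← hdeg v, degC, Nat.card_eq_fintype_card, SimpleGraph.card_neighborSet_eq_degree]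
  obtain ⟨U, μ, hU, hU', hB⟩ := exists_conj_diagonal (centeredAdjMatrix_isHermitian G (d := d))
  have hμ3 : ∑ i, μ i ^ 3 = 6 * s := by
    have h := trace_centeredAdjMatrix_cube G hd
    rw [hT, hB, conj_diagonal_mul hU, conj_diagonal_mul hU, trace_conj_diagonal hU] at h
    simp only [pow_succ, pow_zero, one_mul] at h ⊢
    linarith
  have hnegA := surplus_ge_of_negative_cubes hd hd0 hU hU' hB
  have hposneg : -(6 * s) ≤ ∑ i, -(min (μ i) 0) ^ 3 := by
    rw [← hμ3, ← Finset.sum_neg_distrib]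
    refine Finset.sum_le_sum fun i _ => ?_
    rcases min_cases (μ i) 0 with ⟨h, h'⟩ | ⟨h, h'⟩ <;> rw [h]
    have := pow_pos h' 3
    linarith
  have hmom (r : ℝ) := surplus_ge_of_moments hd hd0 hdn hU hU' hB (r := r)
  set N := ∑ i, -(min (μ i) 0) ^ 3
  have he : Real.exp 1 ≤ 3 := Real.exp_one_lt_three.le
  have he0 := Real.exp_pos 1
  have hsq2 : Real.sqrt d * Real.sqrt d = d := Real.mul_self_sqrt (by linarith)
  have hsq1 : 1 ≤ Real.sqrt d := Real.one_le_sqrt.2 hd1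
  have h12 : (d : ℝ) ^ ((1 : ℝ) / 2) = Real.sqrt d := (Real.sqrt_eq_rpow _).symm
  have h32 : (d : ℝ) ^ ((3 : ℝ) / 2) = d * Real.sqrt d := by
    rw [← h12, show (3 : ℝ) / 2 = 1 + 1 / 2 by norm_num, Real.rpow_add (by linarith),
      Real.rpow_one]
  rw [h32, h12]
  set n : ℝ := (Fintype.card V : ℝ)
  set q := Real.sqrt d
  have hndq : 0 < n * (d * q) := by positivity
  have hnegB (x : ℝ) (hx : 0 ≤ x) (hxN : x ≤ N) : 1 / 10000 * (x / d) ≤ surplus G := by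
    refine le_trans ?_ hnegA
    rw [le_div_iff₀ (by positivity)]
    have h1 : x / d ≤ N / d := div_le_div_of_nonneg_right hxN (by linarith)
    have h2 : 0 ≤ x / d := by positivity
    nlinarith
  have hmain (r : ℝ) (hsr : s ≤ r) (hr : n * (d * q) ≤ r) :
      1 / 10000 * (n ^ 2 * d ^ 2 / r) ≤ surplus G := by
    have hr0 : 0 < r := by linarith
    rcases le_total N (n * (d * q)) with hN | hN
    · refine le_trans ?_ (hmom r (by linarith) (by linarith) (by linarith))
      rw [le_div_iff₀ (by positivity)]
      have h2 : 0 ≤ n ^ 2 * d ^ 2 / r := by positivity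
      nlinarith
    · refine le_trans ?_ (hnegB _ hndq.le hN)
      refine mul_le_mul_of_nonneg_left ?_ (by norm_num)
      rw [div_le_div_iff₀ hr0 (by linarith)]
      have h3 : n ^ 2 * d ^ 2 * d = (n * (d * q)) * (n * (d * q)) := by
        linear_combination -n ^ 2 * d ^ 2 * hsq2
      rw [h3]
      exact mul_le_mul_of_nonneg_left hr hndq.le
  refine ⟨fun hs => ?_, fun hs => ?_, fun hs => ?_⟩
  · have hs0 : s < 0 := by linarith
    rw [abs_of_neg hs0]
    have := hnegB (-s) (by linarith) (by linarith)
    rwa [ge_iff_le, mul_div_assoc]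
  · have h := hmain _ hs.2 le_rfl
    have h4 : n ^ 2 * d ^ 2 / (n * (d * q)) = n * q := by
      rw [div_eq_iff hndq.ne']
      linear_combination -n ^ 2 * d * hsq2
    rw [h4] at h
    linarith
  · have h := hmain s le_rfl hs.le
    have h5 : 1 / 10000 * n ^ 2 * (d : ℝ) ^ 2 / s = 1 / 10000 * (n ^ 2 * d ^ 2 / s) := by ring
    rw [ge_iff_le, h5]
    exact h

end MaxCutPaper
end
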